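/- Assume [H1] and [H2]. Then there exists δ > 0 and a unique ψ ∈ C([0,δ], D^{σ,p}(𝕋ⁿ)) such that for all t ∈ [0,δ], ψ(t) − 1 = e^{−tA_p}(ψ₀ − 1) + ∫₀ᵗ e^{−(t−s)A_p} F(ψ(s)) ds. -/

import Mathlib

open MeasureTheory ENNReal Set Filter

noncomputable section

/-- Ambient space `ℝ × ℝ^m`: the universal cover of the torus `𝕋^{m+1}` (so `n = m + 1`). -/
abbrev Spc (m : ℕ) : Type := ℝ × (Fin m → ℝ)

/-- Unit cube in the last `m` coordinates: a fundamental domain for `𝕋^m`. -/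
def cube1 (m : ℕ) : Set (Fin m → ℝ) := Set.pi Set.univ fun _ => Set.Ico (0 : ℝ) 1

/-- A fundamental domain for the torus `𝕋^{m+1}`. -/
def cube (m : ℕ) : Set (Spc m) := Set.Ico (0 : ℝ) 1 ×ˢ cube1 m

/-- The measure of the torus: Lebesgue measure restricted to a fundamental domain. -/
def μT (m : ℕ) : Measure (Spc m) := volume.restrict (cube m)

/-- `ℤ^{m+1}`-periodicity: `f` is a function on the torus `𝕋^{m+1}`. -/
def IsPeriodic {m : ℕ} (f : Spc m → ℝ) : Prop :=
  ∀ (x : Spc m) (k : ℤ) (j : Fin m → ℤ), f (x.1 + k, fun i => x.2 i + j i) = f x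

/-- The first coordinate direction. -/
def e1 (m : ℕ) : Spc m := (1, 0)

/-- The remaining coordinate directions. -/
def eC (m : ℕ) (i : Fin m) : Spc m := (0, Pi.single i 1)

/-- Partial derivative in the direction `v`. -/
def pd {m : ℕ} (v : Spc m) (f : Spc m → ℝ) (x : Spc m) : ℝ := fderiv ℝ f x v

/-- `∇f ⋅ ∇g`. -/
def gradDot {m : ℕ} (f g : Spc m → ℝ) (x : Spc m) : ℝ :=
  pd (e1 m) f x * pd (e1 m) g x + ∑ i, pd (eC m i) f x * pd (eC m i) g x

/-- The Laplacian. -/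
def lap {m : ℕ} (f : Spc m → ℝ) (x : Spc m) : ℝ :=
  pd (e1 m) (pd (e1 m) f) x + ∑ i, pd (eC m i) (pd (eC m i) f) x

/-- The marginal `ψ̄(x₁) = ∫_{𝕋^m} ψ(x₁, ⋅)`. -/
def marg {m : ℕ} (ψ : Spc m → ℝ) (x1 : ℝ) : ℝ := ∫ y in cube1 m, ψ (x1, y)

/-- The nonlocal coefficient `φ_ψ = (∫ ∂_{x₁}V ψ dx₂…dxₙ) / ψ̄`. -/
def phiF {m : ℕ} (V ψ : Spc m → ℝ) (x1 : ℝ) : ℝ :=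
  (∫ y in cube1 m, pd (e1 m) V (x1, y) * ψ (x1, y)) / marg ψ x1

/-- `F(ψ) = ∇V⋅∇ψ + ΔV ψ − ∂_{x₁}(φ_ψ ψ)`. -/
def Fop {m : ℕ} (V ψ : Spc m → ℝ) (x : Spc m) : ℝ :=
  gradDot V ψ x + lap V x * ψ x - pd (e1 m) (fun z => phiF V ψ z.1 * ψ z) x

/-- `L^p`-norm on the torus. -/
def LpN {m : ℕ} (p : ℝ) (f : Spc m → ℝ) : ℝ≥0∞ := eLpNorm f (ENNReal.ofReal p) (μT m)

/-- Gagliardo (Sobolev–Slobodeckij) seminorm of fractional order `s`. -/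
def gagl {m : ℕ} {F : Type*} [NormedAddCommGroup F] (s p : ℝ) (f : Spc m → F) : ℝ≥0∞ :=
  (∫⁻ x in cube m, ∫⁻ y in cube m,
      ENNReal.ofReal (‖f x - f y‖ ^ p / ‖x - y‖ ^ ((m : ℝ) + 1 + s * p))) ^ (1 / p)

/-- The differential of `f`. -/
def grd {m : ℕ} (f : Spc m → ℝ) (x : Spc m) : Spc m →L[ℝ] ℝ := fderiv ℝ f x

/-- The `W^{σ,p}`-norm on the torus, for `0 ≤ σ ≤ 2`. -/
def WNorm {m : ℕ} (σ p : ℝ) (f : Spc m → ℝ) : ℝ≥0∞ :=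
  if σ ≤ 0 then LpN p f
  else if σ < 1 then LpN p f + gagl σ p f
  else if σ < 2 then
    LpN p f + eLpNorm (fun x => ‖grd f x‖) (ENNReal.ofReal p) (μT m)
      + (if σ = 1 then 0 else gagl (σ - 1) p (grd f))
  else
    LpN p f + eLpNorm (fun x => ‖grd f x‖) (ENNReal.ofReal p) (μT m)
      + eLpNorm (fun x => ‖iteratedFDeriv ℝ 2 f x‖) (ENNReal.ofReal p) (μT m)

/-- Membership in `W^{σ,p}(𝕋^{m+1})`, for `0 ≤ σ ≤ 2`. -/
def MemW {m : ℕ} (σ p : ℝ) (f : Spc m → ℝ) : Prop :=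
  IsPeriodic f ∧ Measurable f ∧ (1 ≤ σ → Differentiable ℝ f) ∧
    (2 ≤ σ → Differentiable ℝ (grd f)) ∧ WNorm σ p f < ⊤

/-- Membership in `𝒟^{σ,p}(𝕋^{m+1}) = {ψ ∈ W^{σ,p} | ψ̄ > 0}`. -/
def MemD {m : ℕ} (σ p : ℝ) (f : Spc m → ℝ) : Prop :=
  MemW σ p f ∧ ∀ x1 : ℝ, 0 < marg f x1

/-- Hypothesis `[H₁]`: `ψ₀ ∈ 𝒟^{σ,p}`, `ψ₀ ≥ 0`, `∫ ψ₀ = 1`. -/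
def Hyp1 {m : ℕ} (σ p : ℝ) (ψ0 : Spc m → ℝ) : Prop :=
  MemD σ p ψ0 ∧ (∀ x, 0 ≤ ψ0 x) ∧ (∫ x in cube m, ψ0 x) = 1

/-- Hypothesis `[H₂]`: `n = m + 1 ≥ 2`, `p > n`, `σ ∈ (1 + n/p, 2)`. -/
def Hyp2 (m : ℕ) (σ p : ℝ) : Prop :=
  1 ≤ m ∧ (m : ℝ) + 1 < p ∧ 1 + ((m : ℝ) + 1) / p < σ ∧ σ < 2

/-- The real interval `[0, Tmax)`, where `Tmax ∈ (0, ∞]`. -/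
def Ico0 (Tmax : ℝ≥0∞) : Set ℝ := {t : ℝ | 0 ≤ t ∧ ENNReal.ofReal t < Tmax}

/-- The real interval `(0, Tmax)`, where `Tmax ∈ (0, ∞]`. -/
def Ioo0 (Tmax : ℝ≥0∞) : Set ℝ := {t : ℝ | 0 < t ∧ ENNReal.ofReal t < Tmax}

/-- Continuity in `W^{σ,p}`-norm of a curve, on a time set `s`. -/
def ContW {m : ℕ} (σ p : ℝ) (s : Set ℝ) (ψ : ℝ → Spc m → ℝ) : Prop :=
  ∀ t ∈ s, ∀ ε : ℝ, 0 < ε → ∃ δ > 0, ∀ t' ∈ s, |t' - t| < δ →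
    WNorm σ p (fun x => ψ t' x - ψ t x) < ENNReal.ofReal ε

/-- Hölder continuity (exponent `α`) in `W^{σ,p}`-norm of a curve, on a time set `s`. -/
def HolderW {m : ℕ} (α σ p : ℝ) (s : Set ℝ) (ψ : ℝ → Spc m → ℝ) : Prop :=
  ∃ C : ℝ, ∀ t ∈ s, ∀ t' ∈ s,
    WNorm σ p (fun x => ψ t' x - ψ t x) ≤ ENNReal.ofReal (C * |t' - t| ^ α)

/-- `ψ` is an `L^p`-solution on `[0, Tmax)` of the nonlocal Fokker–Planck equation
`∂ₜψ = div(∇V ψ + β⁻¹∇ψ) − ∂_{x₁}(φ_ψ ψ) = β⁻¹Δψ + F(ψ)`, `ψ(0) = ψ₀`. -/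
structure IsLpSolution {m : ℕ} (V : Spc m → ℝ) (β σ p : ℝ) (ψ0 : Spc m → ℝ)
    (Tmax : ℝ≥0∞) (ψ : ℝ → Spc m → ℝ) : Prop where
  init : ∀ x, ψ 0 x = ψ0 x
  contLp : ContW 0 p (Ico0 Tmax) ψ
  regW2 : ∀ t ∈ Ioo0 Tmax, MemW 2 p (ψ t)
  regD : ∀ t ∈ Ioo0 Tmax, MemD σ p (ψ t)
  eqn : ∀ t ∈ Ioo0 Tmax,
    Tendsto (fun h : ℝ => LpN p
        (fun x => (ψ (t + h) x - ψ t x) / h - (β⁻¹ * lap (ψ t) x + Fop V (ψ t) x)))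
      (nhdsWithin 0 {h : ℝ | h ≠ 0}) (nhds 0)
  derivCont : ContW 0 p (Ioo0 Tmax)
    (fun t x => β⁻¹ * lap (ψ t) x + Fop V (ψ t) x)

/-- A maximal `L^p`-solution: an `L^p`-solution admitting no proper extension. -/
def IsMaximalLpSolution {m : ℕ} (V : Spc m → ℝ) (β σ p : ℝ) (ψ0 : Spc m → ℝ)
    (Tmax : ℝ≥0∞) (ψ : ℝ → Spc m → ℝ) : Prop :=
  IsLpSolution V β σ p ψ0 Tmax ψ ∧ 0 < Tmax ∧
    ∀ (Tmax' : ℝ≥0∞) (ψ' : ℝ → Spc m → ℝ), IsLpSolution V β σ p ψ0 Tmax' ψ' →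
      (∀ t ∈ Ico0 Tmax, ψ' t = ψ t) → Tmax' ≤ Tmax

/-- The Euclidean quadratic form on `Spc m`. -/
def qd {m : ℕ} (z : Spc m) : ℝ := z.1 ^ 2 + ∑ i, z.2 i ^ 2

/-- The heat semigroup `e^{β⁻¹ t Δ}` on the torus, realized by convolution with the Gaussian
heat kernel on the universal cover (and the identity for `t ≤ 0`). -/
def heatSG {m : ℕ} (β t : ℝ) (f : Spc m → ℝ) (x : Spc m) : ℝ :=
  if t ≤ 0 then f x
  else ∫ y : Spc m, (4 * Real.pi * (t / β)) ^ (-((m : ℝ) + 1) / 2) *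
      Real.exp (-qd (x - y) / (4 * (t / β))) * f y

/-- `ψ` is a mild solution of the nonlocal Fokker–Planck equation on `[0, Tmax)`:
`ψ ∈ C([0,Tmax), 𝒟^{σ,p})` and `ψ(t) = e^{β⁻¹tΔ}ψ₀ + ∫₀ᵗ e^{β⁻¹(t−s)Δ} F(ψ(s)) ds`. -/
def IsMildSolution {m : ℕ} (V : Spc m → ℝ) (β σ p : ℝ) (ψ0 : Spc m → ℝ)
    (Tmax : ℝ≥0∞) (ψ : ℝ → Spc m → ℝ) : Prop :=
  (∀ x, ψ 0 x = ψ0 x) ∧ (∀ t ∈ Ico0 Tmax, MemD σ p (ψ t)) ∧ ContW σ p (Ico0 Tmax) ψ ∧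
    ∀ t ∈ Ico0 Tmax, ∀ᵐ x ∂(volume : Measure (Spc m)),
      ψ t x = heatSG β t ψ0 x + ∫ s in Set.Ioc (0 : ℝ) t, heatSG β (t - s) (Fop V (ψ s)) x

/-- A maximal mild solution. -/
def IsMaximalMildSolution {m : ℕ} (V : Spc m → ℝ) (β σ p : ℝ) (ψ0 : Spc m → ℝ)
    (Tmax : ℝ≥0∞) (ψ : ℝ → Spc m → ℝ) : Prop :=
  IsMildSolution V β σ p ψ0 Tmax ψ ∧ 0 < Tmax ∧
    ∀ (Tmax' : ℝ≥0∞) (ψ' : ℝ → Spc m → ℝ), IsMildSolution V β σ p ψ0 Tmax' ψ' →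
      (∀ t ∈ Ico0 Tmax, ψ' t = ψ t) → Tmax' ≤ Tmax

/-- `L^p`-norm on the one-dimensional torus `𝕋`. -/
def LpN1 (p : ℝ) (g : ℝ → ℝ) : ℝ≥0∞ :=
  eLpNorm g (ENNReal.ofReal p) (volume.restrict (Set.Ico (0 : ℝ) 1))

/-- Membership in `L^p₀(𝕋^{m+1})`: periodic, `L^p` and of mean zero. -/
def MemL0 {m : ℕ} (p : ℝ) (f : Spc m → ℝ) : Prop :=
  IsPeriodic f ∧ Measurable f ∧ LpN p f < ⊤ ∧ (∫ x in cube m, f x) = 0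

/-- `ψ ∈ C([0,δ], 𝒟^{σ,p}(𝕋ⁿ))` satisfies the fixed point (integral-evolution) equation
`ψ(t) − 1 = e^{−tA_p}(ψ₀ − 1) + ∫₀ᵗ e^{−(t−s)A_p} F(ψ(s)) ds` on `[0,δ]`. -/
def MildOnIcc {m : ℕ} (V : Spc m → ℝ) (β σ p : ℝ) (ψ0 : Spc m → ℝ) (δ : ℝ)
    (ψ : ℝ → Spc m → ℝ) : Prop :=
  (∀ t ∈ Set.Icc (0 : ℝ) δ, MemD σ p (ψ t)) ∧ ContW σ p (Set.Icc (0 : ℝ) δ) ψ ∧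
    ∀ t ∈ Set.Icc (0 : ℝ) δ, ∀ᵐ x ∂(volume : Measure (Spc m)),
      ψ t x - 1 = heatSG β t (fun y => ψ0 y - 1) x +
        ∫ s in Set.Ioc (0 : ℝ) t, heatSG β (t - s) (Fop V (ψ s)) x



set_option linter.unusedSectionVars false
set_option linter.unusedVariables false

/-- the all-ones vector -/
def one1 (m : ℕ) : Spc m := (1, fun _ => 1)

/-- closed cube -/
def Kc {m : ℕ} (a : Spc m) (r : ℝ) : Set (Spc m) := Icc a (a + r • one1 m)

lemma mem_Kc {m : ℕ} {a x : Spc m} {r : ℝ} : x ∈ Kc a r ↔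
    (a.1 ≤ x.1 ∧ x.1 ≤ a.1 + r) ∧ ∀ i, a.2 i ≤ x.2 i ∧ x.2 i ≤ a.2 i + r := by
  simp only [Kc, one1, mem_Icc, Prod.le_def, Pi.le_def, Prod.fst_add, Prod.snd_add, Prod.smul_fst,
    Prod.smul_snd, Pi.add_apply, Pi.smul_apply, smul_eq_mul, mul_one]
  constructor
  · rintro ⟨⟨h1, h2⟩, h3, h4⟩
    exact ⟨⟨h1, h3⟩, fun i => ⟨h2 i, h4 i⟩⟩
  · rintro ⟨⟨h1, h3⟩, h⟩
    exact ⟨⟨h1, fun i => (h i).1⟩, h3, fun i => (h i).2⟩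

lemma measurableSet_Kc {m : ℕ} (a : Spc m) (r : ℝ) : MeasurableSet (Kc a r) := by
  have : Kc a r = Icc a.1 (a + r • one1 m).1 ×ˢ Icc a.2 (a + r • one1 m).2 := by
    rw [Kc, Icc_prod_eq]
  rw [this]
  exact measurableSet_Icc.prod measurableSet_Icc

lemma vol_Kc {m : ℕ} (a : Spc m) {r : ℝ} (hr : 0 ≤ r) :
    volume (Kc a r) = ENNReal.ofReal (r ^ (m + 1)) := by
  have : Kc a r = Icc a.1 (a + r • one1 m).1 ×ˢ Icc a.2 (a + r • one1 m).2 := by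
    rw [Kc, Icc_prod_eq]
  rw [this, Measure.volume_eq_prod, Measure.prod_prod, Real.volume_Icc, Real.volume_Icc_pi]
  simp [one1, pow_succ, ENNReal.ofReal_mul, ENNReal.ofReal_pow, hr, mul_comm]

lemma norm_sub_le_Kc {m : ℕ} {a u v : Spc m} {r : ℝ} (hu : u ∈ Kc a r) (hv : v ∈ Kc a r) :
    ‖u - v‖ ≤ r := by
  rw [mem_Kc] at hu hv
  have hr : 0 ≤ r := by linarith [hu.1.1, hu.1.2]
  rw [Prod.norm_def]
  refine max_le ?_ ?_
  · rw [Prod.fst_sub, Real.norm_eq_abs, abs_le]; constructor <;> linarith [hu.1.1, hu.1.2, hv.1.1, hv.1.2]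
  · refine (pi_norm_le_iff_of_nonneg hr).2 fun i => ?_
    rw [Prod.snd_sub, Pi.sub_apply, Real.norm_eq_abs, abs_le]
    constructor <;> linarith [(hu.2 i).1, (hu.2 i).2, (hv.2 i).1, (hv.2 i).2]

/-- basis vectors indexed by Fin (m+1) -/
def eB (m : ℕ) (k : Fin (m + 1)) : Spc m :=
  (Fin.consEquivL ℝ (fun _ : Fin (m + 1) => ℝ)).symm (Pi.single k 1)

lemma div_bound {m : ℕ} (h : Spc m → ℝ) (hd : Differentiable ℝ h) (a : Spc m) (r : ℝ) (hr : 0 ≤ r)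
    (hi : IntegrableOn (fderiv ℝ h) (Kc a r)) (M : ℝ) (hM : ∀ y ∈ Kc a r, |h y| ≤ M)
    (k : Fin (m + 1)) :
    |∫ y in Kc a r, fderiv ℝ h y (eB m k)| ≤ 2 * M * r ^ m := by
  classical
  set eL := Fin.consEquivL ℝ (fun _ : Fin (m + 1) => ℝ) with heL
  have he_ord : ∀ x y, eL x ≤ eL y ↔ x ≤ y := fun x y => by
    show Fin.cons (α := fun _ => ℝ) x.1 x.2 ≤ Fin.cons (α := fun _ => ℝ) y.1 y.2 ↔ _
    rw [Fin.cons_le_cons]; rfl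
  have he_vol : MeasurePreserving eL volume volume := by
    have := (volume_preserving_piFinSuccAbove (fun _ : Fin (m+1) => ℝ) 0).symm
    convert! this using 1
    funext x j
    refine Fin.cases ?_ (fun i => ?_) j <;> rfl
  have hle : a ≤ a + r • one1 m := by
    constructor <;> simp [one1, Pi.le_def, hr]
  have key := integral_divergence_of_hasFDerivAt_off_countable_of_equiv (E := ℝ) eL he_ord he_vol
    (fun i => if i = k then h else 0) (fun i => if i = k then fderiv ℝ h else 0) ∅ countable_empty
    a (a + r • one1 m) hle
    (by intro i; split_ifs
        · exact hd.continuous.continuousOn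
        · exact continuousOn_const)
    (by intro x _ i
        by_cases hik : i = k
        · simp only [hik, if_true]; exact (hd x).hasFDerivAt
        · simp only [hik, if_false]; exact hasFDerivAt_const 0 x)
    (fun y => fderiv ℝ h y (eB m k))
    (by intro x
        rw [Finset.sum_eq_single k]
        · simp [eB, heL]
        · intro b _ hb; simp [hb]
        · simp)
    (by exact ((ContinuousLinearMap.apply ℝ ℝ (eB m k)).integrable_comp hi))
  rw [Kc, key, Finset.sum_eq_single k]
  · simp only [if_true]
    have hvol : (volume (Icc (eL a ∘ k.succAbove) (eL (a + r • one1 m) ∘ k.succAbove))).toReal = r ^ m := by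
      have : ∀ i : Fin (m+1), (eL (a + r • one1 m)) i = eL a i + r := by
        intro i
        rw [map_add, map_smul]
        have : eL (one1 m) i = 1 := by
          show Fin.cons (α := fun _ => ℝ) (1:ℝ) (fun _ => 1) i = 1
          refine Fin.cases ?_ (fun j => ?_) i <;> simp
        simp [this]
      rw [Real.volume_Icc_pi]
      simp only [Function.comp, this]
      simp [hr]
    have hmem : ∀ c : ℝ, eL a k ≤ c → c ≤ eL (a + r • one1 m) k →
        ∀ x ∈ Icc (eL a ∘ k.succAbove) (eL (a + r • one1 m) ∘ k.succAbove),
        eL.symm (k.insertNth c x) ∈ Kc a r := by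
      intro c hc1 hc2 x hx
      constructor
      · rw [← he_ord, ContinuousLinearEquiv.apply_symm_apply, Fin.le_insertNth_iff]
        exact ⟨hc1, hx.1⟩
      · rw [← he_ord, ContinuousLinearEquiv.apply_symm_apply, Fin.insertNth_le_iff]
        exact ⟨hc2, hx.2⟩
    have hb : ∀ c : ℝ, eL a k ≤ c → c ≤ eL (a + r • one1 m) k →
       ‖∫ x in Icc (eL a ∘ k.succAbove) (eL (a + r • one1 m) ∘ k.succAbove),
          h (eL.symm (k.insertNth c x))‖ ≤ M * r ^ m := by
      intro c hc1 hc2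
      rw [← hvol]
      refine norm_setIntegral_le_of_norm_le_const ?_ ?_
      · exact isCompact_Icc.measure_lt_top
      · intro x hx
        exact hM _ (hmem c hc1 hc2 x hx)
    have h0 : eL a k ≤ eL (a + r • one1 m) k := ((he_ord _ _).2 hle) k
    have h1 := hb _ h0 le_rfl
    have h2 := hb _ le_rfl h0
    rw [Real.norm_eq_abs] at h1 h2
    refine (abs_sub _ _).trans ?_
    linarith
  · intro b _ hb; simp [hb]
  · simp

lemma norm_clm_le {m : ℕ} (L : Spc m →L[ℝ] ℝ) : ‖L‖ ≤ ∑ k, |L (eB m k)| := by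
  refine ContinuousLinearMap.opNorm_le_bound _ (Finset.sum_nonneg fun _ _ => abs_nonneg _) fun x => ?_
  set eL := Fin.consEquivL ℝ (fun _ : Fin (m + 1) => ℝ) with heL
  have hx : x = ∑ k, eL x k • eB m k := by
    apply eL.injective
    rw [map_sum]
    ext j
    simp [eB, ← heL, Finset.sum_apply, Pi.single_apply]
  have hn : ∀ k, |eL x k| ≤ ‖x‖ := by
    intro k
    show |Fin.cons (α := fun _ => ℝ) x.1 x.2 k| ≤ _
    refine Fin.cases ?_ (fun j => ?_) k
    · simpa using norm_fst_le x
    · simpa using (norm_le_pi_norm x.2 j).trans (norm_snd_le x)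
  rw [Finset.sum_mul]
  conv_lhs => rw [hx, map_sum]
  refine (norm_sum_le _ _).trans (Finset.sum_le_sum fun k _ => ?_)
  rw [map_smul, norm_smul, Real.norm_eq_abs, Real.norm_eq_abs, mul_comm]
  exact mul_le_mul_of_nonneg_left (hn k) (abs_nonneg _)

/-- dual -/
abbrev Du (m : ℕ) : Type := Spc m →L[ℝ] ℝ

/-- integrand -/
def Hk {m : ℕ} {W : Type*} [NormedAddCommGroup W] (p q : ℝ) (g : Spc m → W) (u v : Spc m) : ℝ≥0∞ :=
  ENNReal.ofReal (‖g u - g v‖ ^ p / ‖u - v‖ ^ q)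

/-- energy -/
def Jq {m : ℕ} {W : Type*} [NormedAddCommGroup W] (p q : ℝ) (g : Spc m → W) (A : Set (Spc m)) : ℝ≥0∞ :=
  ∫⁻ u in A, ∫⁻ v in A, Hk p q g u v

/-- normalised -/
def PK {m : ℕ} (a : Spc m) (r : ℝ) : Measure (Spc m) :=
  (ENNReal.ofReal (r ^ (m + 1)))⁻¹ • volume.restrict (Kc a r)

lemma prob_PK {m : ℕ} (a : Spc m) {r : ℝ} (hr : 0 < r) : IsProbabilityMeasure (PK a r) := by
  constructor
  simp only [PK, Measure.smul_apply, Measure.restrict_apply_univ, vol_Kc a hr.le, smul_eq_mul]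
  exact ENNReal.inv_mul_cancel (by simp; positivity) ENNReal.ofReal_ne_top

lemma measurable_Hk {m : ℕ} {W : Type*} [NormedAddCommGroup W] [NormedSpace ℝ W] [CompleteSpace W] [MeasurableSpace W] [BorelSpace W]
    [SecondCountableTopology W] (p q : ℝ)
    {g : Spc m → W} (hg : Measurable g) :
    Measurable (fun z : Spc m × Spc m => Hk p q g z.1 z.2) := by
  unfold Hk; fun_prop

lemma jensen {α : Type*} [MeasurableSpace α] (μ : Measure α) [IsProbabilityMeasure μ] (p : ℝ)
    (hp : 1 ≤ p) (φ : α → ℝ≥0∞) (hφ : AEMeasurable φ μ) :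
    (∫⁻ x, φ x ∂μ) ^ p ≤ ∫⁻ x, φ x ^ p ∂μ := by
  have hp0 : 0 < p := by linarith
  rcases hp.eq_or_lt with h | h
  · simp [← h]
  have := ENNReal.lintegral_mul_le_Lp_mul_Lq μ (Real.HolderConjugate.conjExponent h) hφ
    (g := fun _ => 1) aemeasurable_const
  simp only [Pi.mul_apply, mul_one, ENNReal.one_rpow, lintegral_one, measure_univ] at this
  calc _ ≤ ((∫⁻ x, φ x ^ p ∂μ) ^ (1 / p)) ^ p := ENNReal.rpow_le_rpow this hp0.le
    _ = _ := by rw [← ENNReal.rpow_mul, one_div_mul_cancel hp0.ne', ENNReal.rpow_one]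

lemma integ_PK {m : ℕ} {W : Type*} [NormedAddCommGroup W] {g : Spc m → W} {a : Spc m} {r : ℝ} (hr : 0 < r)
    (hi : IntegrableOn g (Kc a r)) : Integrable g (PK a r) := by
  have h : (ENNReal.ofReal (r ^ (m + 1)))⁻¹ ≠ ⊤ := by simp; positivity
  exact Integrable.smul_measure (show Integrable g (volume.restrict (Kc a r)) from hi) h

lemma intOn_const {α W : Type*} [NormedAddCommGroup W] [MeasurableSpace α] {μ : Measure α} {s : Set α}
    (hs : μ s ≠ ⊤) (c : W) : IntegrableOn (fun _ : α => c) s μ :=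
  integrableOn_const hs enorm_ne_top

lemma avg_near {m : ℕ} (f : Spc m → ℝ) (hd : Differentiable ℝ f) (x : Spc m) (ε : ℝ) (hε : 0 < ε) :
    ∃ ρ > 0, ∀ (a : Spc m) (r : ℝ), 0 < r → r < ρ → x ∈ Kc a r → IntegrableOn (grd f) (Kc a r) →
      ‖(∫ y, grd f y ∂(PK a r)) - grd f x‖ ≤ ε := by
  set η := ε / (2 * (m + 1)) with hη
  have hη0 : 0 < η := by positivity
  have hx := (hd x).hasFDerivAt.isLittleO.def hη0
  obtain ⟨ρ, hρ, hb⟩ := Metric.eventually_nhds_iff.1 hx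
  refine ⟨ρ, hρ, fun a r hr hrρ hxK hi => ?_⟩
  have := prob_PK a hr
  set h : Spc m → ℝ := fun y => f y - f x - fderiv ℝ f x (y - x) with hh
  have hfd : ∀ y, HasFDerivAt h (fderiv ℝ f y - fderiv ℝ f x) y := by
    intro y
    have h1 := ((hd y).hasFDerivAt.sub_const (f x)).sub
      ((fderiv ℝ f x).hasFDerivAt.comp y ((hasFDerivAt_id y).sub_const x))
    simpa using! h1
  have hfe : fderiv ℝ h = fun y => fderiv ℝ f y - fderiv ℝ f x := funext fun y => (hfd y).fderiv
  have hvol : volume (Kc a r) ≠ ⊤ := by rw [vol_Kc a hr.le]; exact ENNReal.ofReal_ne_top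
  have hci : IntegrableOn (fun _ : Spc m => fderiv ℝ f x) (Kc a r) :=
    intOn_const hvol _
  have hih : IntegrableOn (fderiv ℝ h) (Kc a r) := by
    rw [hfe]; exact hi.sub hci
  have hiP : Integrable (fderiv ℝ h) (PK a r) :=
    integ_PK hr hih
  have hif : Integrable (grd f) (PK a r) := integ_PK hr hi
  have e1 : (∫ y, grd f y ∂(PK a r)) - grd f x = ∫ y, fderiv ℝ h y ∂(PK a r) := by
    have e0 := integral_sub hif (integrable_const (μ := PK a r) (grd f x))
    rw [hfe]
    refine Eq.trans ?_ e0.symm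
    simp
  rw [e1]
  refine (norm_clm_le _).trans ?_
  have : ∀ k : Fin (m+1), |(∫ y, fderiv ℝ h y ∂(PK a r)) (eB m k)| ≤ 2 * η := by
    intro k
    rw [ContinuousLinearMap.integral_apply hiP]
    rw [PK, integral_smul_measure]
    have hB := div_bound h (fun y => (hfd y).differentiableAt) a r hr.le hih (η * r) (by
      intro y hy
      have hn := norm_sub_le_Kc hy hxK
      have := hb (y := y) (by rw [dist_eq_norm]; linarith)
      refine this.trans ?_
      gcongr) k
    rw [ENNReal.toReal_inv, ENNReal.toReal_ofReal (by positivity), smul_eq_mul, abs_mul,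
      abs_of_pos (by positivity), inv_mul_le_iff₀ (by positivity)]
    refine hB.trans (le_of_eq ?_)
    ring
  refine (Finset.sum_le_sum fun k _ => this k).trans (le_of_eq ?_)
  simp [hη]
  field_simp

lemma avg_diff {m : ℕ} {W : Type*} [NormedAddCommGroup W] [NormedSpace ℝ W] [CompleteSpace W] [MeasurableSpace W] [BorelSpace W]
    [SecondCountableTopology W] (g : Spc m → W) (hg : Measurable g) (p q : ℝ) (hp : 1 ≤ p) (hq : 0 ≤ q)
    (a a' : Spc m) (r r' : ℝ) (hr : 0 < r) (hr' : 0 < r') (hsub : Kc a' r' ⊆ Kc a r)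
    (hi : IntegrableOn g (Kc a r)) :
    ‖(∫ y, g y ∂(PK a' r')) - ∫ y, g y ∂(PK a r)‖ₑ ^ p ≤
      ENNReal.ofReal ((r' ^ (m + 1))⁻¹ * (r ^ (m + 1))⁻¹ * r ^ q) * Jq p q g (Kc a r) := by
  have := prob_PK a hr
  have := prob_PK a' hr'
  have hp0 : 0 < p := by linarith
  have hiP : Integrable g (PK a r) := integ_PK hr hi
  have hiP' : Integrable g (PK a' r') := integ_PK hr' (hi.mono_set hsub)
  have e1 : (∫ y, g y ∂(PK a' r')) - ∫ y, g y ∂(PK a r) =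
      ∫ u, ∫ v, (g u - g v) ∂(PK a r) ∂(PK a' r') := by
    have : ∀ u, ∫ v, (g u - g v) ∂(PK a r) = g u - ∫ v, g v ∂(PK a r) := by
      intro u; rw [integral_sub (integrable_const _) hiP]; simp
    simp_rw [this]
    rw [integral_sub hiP' (integrable_const _)]; simp
  have hm : Measurable (fun z : Spc m × Spc m => ‖g z.1 - g z.2‖ₑ) := by fun_prop
  have e2 : ‖(∫ y, g y ∂(PK a' r')) - ∫ y, g y ∂(PK a r)‖ₑ ≤
      ∫⁻ u, ∫⁻ v, ‖g u - g v‖ₑ ∂(PK a r) ∂(PK a' r') := by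
    rw [e1]
    refine (enorm_integral_le_lintegral_enorm _).trans (lintegral_mono fun u => ?_)
    exact enorm_integral_le_lintegral_enorm _
  have e3 : (∫⁻ u, ∫⁻ v, ‖g u - g v‖ₑ ∂(PK a r) ∂(PK a' r')) ^ p ≤
      ∫⁻ u, ∫⁻ v, ‖g u - g v‖ₑ ^ p ∂(PK a r) ∂(PK a' r') := by
    refine (jensen _ p hp _ hm.lintegral_prod_right'.aemeasurable).trans (lintegral_mono fun u => ?_)
    refine jensen _ p hp _ (Measurable.aemeasurable ?_)
    fun_prop
  refine (ENNReal.rpow_le_rpow e2 hp0.le).trans (e3.trans ?_)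
  have e4 : ∀ u ∈ Kc a' r', ∀ v ∈ Kc a r, ‖g u - g v‖ₑ ^ p ≤ ENNReal.ofReal (r ^ q) * Hk p q g u v := by
    intro u hu v hv
    rw [Hk, ← ENNReal.ofReal_mul (by positivity), ← ofReal_norm,
      ENNReal.ofReal_rpow_of_nonneg (norm_nonneg _) hp0.le]
    apply ENNReal.ofReal_le_ofReal
    by_cases huv : u = v
    · simp [huv, Real.zero_rpow hp0.ne']
    have h0 : 0 < ‖u - v‖ := norm_pos_iff.2 (sub_ne_zero.2 huv)
    have h1 : ‖u - v‖ ≤ r := norm_sub_le_Kc (hsub hu) hv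
    have h2 : ‖u - v‖ ^ q ≤ r ^ q := Real.rpow_le_rpow h0.le h1 hq
    have h3 : 0 < ‖u - v‖ ^ q := by positivity
    rw [← mul_div_assoc, le_div_iff₀ h3, mul_comm]
    gcongr
  simp only [PK, lintegral_smul_measure, smul_eq_mul]
  have mH := measurable_Hk p q hg
  have e5 : ∫⁻ u in Kc a' r', (ENNReal.ofReal (r ^ (m+1)))⁻¹ * ∫⁻ v in Kc a r, ‖g u - g v‖ₑ ^ p
      ≤ (ENNReal.ofReal (r ^ (m+1)))⁻¹ * (ENNReal.ofReal (r ^ q) * Jq p q g (Kc a r)) := by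
    rw [lintegral_const_mul' _ _ (by simp; positivity)]
    gcongr
    calc _ ≤ ∫⁻ u in Kc a' r', ∫⁻ v in Kc a r, ENNReal.ofReal (r ^ q) * Hk p q g u v := by
          refine setLIntegral_mono' (measurableSet_Kc _ _) fun u hu => ?_
          exact setLIntegral_mono' (measurableSet_Kc _ _) fun v hv => e4 u hu v hv
      _ ≤ ∫⁻ u in Kc a r, ∫⁻ v in Kc a r, ENNReal.ofReal (r ^ q) * Hk p q g u v :=
          lintegral_mono_set hsub
      _ = _ := by
          rw [Jq, ← lintegral_const_mul' _ _ ENNReal.ofReal_ne_top]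
          refine lintegral_congr fun u => ?_
          rw [lintegral_const_mul' _ _ ENNReal.ofReal_ne_top]
  refine (mul_le_mul_right e5 _).trans (le_of_eq ?_)
  rw [ENNReal.ofReal_mul (by positivity), ENNReal.ofReal_mul (by positivity),
    ENNReal.ofReal_inv_of_pos (by positivity), ENNReal.ofReal_inv_of_pos (by positivity)]
  ring

lemma Jq_mono {m : ℕ} {W : Type*} [NormedAddCommGroup W] (p q : ℝ) (g : Spc m → W) {A B : Set (Spc m)}
    (h : A ⊆ B) : Jq p q g A ≤ Jq p q g B := by
  unfold Jq
  exact (lintegral_mono_set h).trans (lintegral_mono fun u => lintegral_mono_set h)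

lemma measurable_grd {m : ℕ} (f : Spc m → ℝ) : Measurable (grd f) := measurable_fderiv ℝ f

/-- shrunk corner -/
def aj {m : ℕ} (a x : Spc m) (j : ℕ) : Spc m := x - ((1/2:ℝ)^j) • (x - a)

lemma Kc_aj {m : ℕ} {a x : Spc m} {r : ℝ} (hx : x ∈ Kc a r) (j : ℕ) :
    x ∈ Kc (aj a x j) (r * (1/2)^j) ∧
    Kc (aj a x (j+1)) (r * (1/2)^(j+1)) ⊆ Kc (aj a x j) (r * (1/2)^j) := by
  have ht : (0:ℝ) < (1/2)^j := by positivity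
  constructor
  · rw [mem_Kc] at hx ⊢
    simp only [aj, Prod.fst_sub, Prod.smul_fst, Prod.snd_sub, Prod.smul_snd, Pi.sub_apply, Pi.smul_apply, smul_eq_mul]
    refine ⟨⟨?_, ?_⟩, fun i => ⟨?_, ?_⟩⟩
    · nlinarith [hx.1.1]
    · nlinarith [hx.1.2]
    · nlinarith [(hx.2 i).1]
    · nlinarith [(hx.2 i).2]
  · intro y hy
    rw [mem_Kc] at hx hy ⊢
    simp only [aj, Prod.fst_sub, Prod.smul_fst, Prod.snd_sub, Prod.smul_snd, Pi.sub_apply, Pi.smul_apply, smul_eq_mul, pow_succ] at hy ⊢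
    set t : ℝ := (1/2)^j
    refine ⟨⟨?_, ?_⟩, fun i => ⟨?_, ?_⟩⟩
    · nlinarith [hx.1.1, hy.1.1]
    · nlinarith [hx.1.2, hy.1.2]
    · nlinarith [(hx.2 i).1, (hy.2 i).1]
    · nlinarith [(hx.2 i).2, (hy.2 i).2]

lemma Kc_aj_sub {m : ℕ} {a x : Spc m} {r : ℝ} (hx : x ∈ Kc a r) (j : ℕ) :
    Kc (aj a x j) (r * (1/2)^j) ⊆ Kc a r := by
  induction j with
  | zero => simp [aj]
  | succ j ih => exact (Kc_aj hx j).2.trans ih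

lemma avg_point {m : ℕ} (f : Spc m → ℝ) (hd : Differentiable ℝ f) (p q : ℝ) (hp : 1 ≤ p)
    (hq : 2 * ((m:ℝ) + 1) < q) (a : Spc m) (r : ℝ) (hr : 0 < r) (hi : IntegrableOn (grd f) (Kc a r))
    (hJ : Jq p q (grd f) (Kc a r) ≠ ⊤) (x : Spc m) (hx : x ∈ Kc a r) :
    ‖(∫ y, grd f y ∂(PK a r)) - grd f x‖ ≤
      (2 ^ (m+1) * r ^ (q - 2 * ((m:ℝ) + 1)) * (Jq p q (grd f) (Kc a r)).toReal) ^ (1/p) /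
        (1 - (1/2:ℝ) ^ ((q - 2 * ((m:ℝ) + 1)) / p)) := by
  have hp0 : 0 < p := by linarith
  set γ := q - 2 * ((m:ℝ) + 1) with hγ
  have hγ0 : 0 < γ := by linarith
  set J := (Jq p q (grd f) (Kc a r)).toReal with hJdef
  set A : ℕ → Du m := fun j => ∫ y, grd f y ∂(PK (aj a x j) (r * (1/2)^j)) with hA
  have hrj : ∀ j : ℕ, 0 < r * (1/2)^j := fun j => by positivity
  have hA0 : A 0 = ∫ y, grd f y ∂(PK a r) := by simp [hA, aj]
  have hlim : Tendsto A atTop (nhds (grd f x)) := by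
    rw [Metric.tendsto_atTop]
    intro ε hε
    obtain ⟨ρ, hρ, hb⟩ := avg_near f hd x (ε/2) (by positivity)
    have : Tendsto (fun j : ℕ => r * (1/2:ℝ)^j) atTop (nhds (r * 0)) :=
      (_root_.tendsto_pow_atTop_nhds_zero_of_lt_one (by norm_num) (by norm_num)).const_mul r
    rw [mul_zero] at this
    obtain ⟨N, hN⟩ := (this.eventually (gt_mem_nhds hρ)).exists_forall_of_atTop
    refine ⟨N, fun j hj => ?_⟩
    rw [dist_eq_norm]
    refine (hb _ _ (hrj j) (hN j hj) (Kc_aj hx j).1 (hi.mono_set (Kc_aj_sub hx j))).trans_lt (by linarith)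
  set D := (2 ^ (m+1) * r ^ γ * J) ^ (1/p) with hD
  set ϑ := (1/2:ℝ) ^ (γ / p) with hϑ
  have hϑ1 : ϑ < 1 := Real.rpow_lt_one (by norm_num) (by norm_num) (by positivity)
  have hstep : ∀ j, dist (A j) (A (j+1)) ≤ D * ϑ ^ j := by
    intro j
    have h1 := avg_diff (grd f) (measurable_grd f) p q hp (by linarith [(Nat.cast_nonneg m : (0:ℝ) ≤ m)]) (aj a x j) (aj a x (j+1))
      (r * (1/2)^j) (r * (1/2)^(j+1)) (hrj j) (hrj (j+1)) (Kc_aj hx j).2 (hi.mono_set (Kc_aj_sub hx j))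
    have h2 := h1.trans (mul_le_mul_right (Jq_mono p q (grd f) (Kc_aj_sub hx j)) _)
    have h3 : ‖A (j+1) - A j‖ ^ p ≤ ((r * (1/2)^(j+1)) ^ (m+1))⁻¹ * ((r * (1/2)^j) ^ (m+1))⁻¹ * (r * (1/2)^j)^q * J := by
      rw [← ENNReal.ofReal_toReal hJ, ← ENNReal.ofReal_mul (by positivity), ← ofReal_norm,
        ENNReal.ofReal_rpow_of_nonneg (norm_nonneg _) hp0.le] at h2
      exact (ENNReal.ofReal_le_ofReal_iff (by positivity)).1 h2
    have h4 : ((r * (1/2)^(j+1)) ^ (m+1))⁻¹ * ((r * (1/2)^j) ^ (m+1))⁻¹ * (r * (1/2)^j)^q * J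
        = (D * ϑ ^ j) ^ p := by
      have e1 : (r * (1/2)^j)^q = (r * (1/2:ℝ)^j)^γ * ((r * (1/2)^j) ^ (m+1) * (r * (1/2)^j) ^ (m+1)) := by
        rw [← pow_add, ← Real.rpow_natCast (r * (1/2:ℝ)^j) (m+1+(m+1)), ← Real.rpow_add (hrj j)]
        congr 1; push_cast; rw [hγ]; ring
      have e2 : (D * ϑ ^ j) ^ p = 2^(m+1) * J * (r * (1/2:ℝ)^j)^γ := by
        rw [Real.mul_rpow (by positivity) (by positivity), hD, ← Real.rpow_mul (by positivity),
          one_div_mul_cancel hp0.ne', Real.rpow_one, hϑ, ← Real.rpow_natCast ((1/2:ℝ) ^ (γ / p)) j, ← Real.rpow_mul (by positivity),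
          ← Real.rpow_mul (by positivity), Real.mul_rpow hr.le (by positivity), ← Real.rpow_natCast (1/2) j,
          ← Real.rpow_mul (by positivity)]
        have : γ / p * (j * p) = j * γ := by field_simp
        rw [this]; ring
      rw [e1, e2]
      have h0 := hrj j
      have e3 : r * (1/2:ℝ)^(j+1) = (r * (1/2)^j) / 2 := by rw [pow_succ]; ring
      rw [e3]
      set R := r * (1/2:ℝ)^j
      rw [div_pow]
      field_simp
    rw [h4] at h3
    rw [dist_comm, dist_eq_norm]
    exact (Real.rpow_le_rpow_iff (norm_nonneg _) (by positivity) hp0).1 h3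
  have := dist_le_of_le_geometric_of_tendsto₀ ϑ D hϑ1 hstep hlim
  rwa [hA0, dist_eq_norm] at this

/-- Morrey constant -/
def CM (m : ℕ) (p q : ℝ) : ℝ :=
  (2 / (1 - (1/2:ℝ) ^ ((q - 2 * ((m:ℝ) + 1)) / p))) ^ p * 2 ^ (m+1)

lemma CM_pos (m : ℕ) {p q : ℝ} (hp : 1 ≤ p) (hq : 2 * ((m:ℝ) + 1) < q) : 0 < CM m p q := by
  have hϑ1 : (1/2:ℝ) ^ ((q - 2 * ((m:ℝ) + 1)) / p) < 1 :=
    Real.rpow_lt_one (by norm_num) (by norm_num) (div_pos (by linarith) (by linarith))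
  have : 0 < 1 - (1/2:ℝ) ^ ((q - 2 * ((m:ℝ) + 1)) / p) := by linarith
  unfold CM; positivity

lemma morrey {m : ℕ} (f : Spc m → ℝ) (hd : Differentiable ℝ f) (p q : ℝ) (hp : 1 ≤ p)
    (hq : 2 * ((m:ℝ) + 1) < q) (a : Spc m) (r : ℝ) (hr : 0 < r) (hi : IntegrableOn (grd f) (Kc a r))
    (x z : Spc m) (hx : x ∈ Kc a r) (hz : z ∈ Kc a r) :
    ENNReal.ofReal (‖grd f x - grd f z‖ ^ p) ≤
      ENNReal.ofReal (CM m p q * r ^ (q - 2 * ((m:ℝ) + 1))) * Jq p q (grd f) (Kc a r) := by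
  have hp0 : 0 < p := by linarith
  have hCM := CM_pos m hp hq
  by_cases hJ : Jq p q (grd f) (Kc a r) = ⊤
  · rw [hJ, ENNReal.mul_top]
    · exact le_top
    · simp; positivity
  have h1 := avg_point f hd p q hp hq a r hr hi hJ x hx
  have h2 := avg_point f hd p q hp hq a r hr hi hJ z hz
  have hϑ1 : (1/2:ℝ) ^ ((q - 2 * ((m:ℝ) + 1)) / p) < 1 :=
    Real.rpow_lt_one (by norm_num) (by norm_num) (div_pos (by linarith) (by linarith))
  have h1ϑ : 0 < 1 - (1/2:ℝ) ^ ((q - 2 * ((m:ℝ) + 1)) / p) := by linarith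
  have h3 : ‖grd f x - grd f z‖ ≤ 2 / (1 - (1/2:ℝ) ^ ((q - 2 * ((m:ℝ) + 1)) / p)) *
      (2 ^ (m+1) * r ^ (q - 2 * ((m:ℝ) + 1)) * (Jq p q (grd f) (Kc a r)).toReal) ^ (1/p) := by
    have : grd f x - grd f z = ((∫ y, grd f y ∂(PK a r)) - grd f z) - ((∫ y, grd f y ∂(PK a r)) - grd f x) := by abel
    rw [this]
    refine (norm_sub_le _ _).trans ((add_le_add h2 h1).trans (le_of_eq ?_))
    ring
  rw [← ENNReal.ofReal_toReal hJ, ← ENNReal.ofReal_mul (by positivity)]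
  apply ENNReal.ofReal_le_ofReal
  refine (Real.rpow_le_rpow (norm_nonneg _) h3 hp0.le).trans (le_of_eq ?_)
  rw [Real.mul_rpow (by positivity) (by positivity), ← Real.rpow_mul (by positivity),
          one_div_mul_cancel hp0.ne', Real.rpow_one, CM]
  ring

/-- lattice index -/
abbrev Lx (m : ℕ) : Type := ℤ × (Fin m → ℤ)

/-- lattice vector -/
def lz {m : ℕ} (k : Lx m) : Spc m := ((k.1 : ℝ), fun i => (k.2 i : ℝ))

/-- floor -/
def fl {m : ℕ} (x : Spc m) : Lx m := (⌊x.1⌋, fun i => ⌊x.2 i⌋)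

/-- periodicity -/
def Per {m : ℕ} {W : Type*} (g : Spc m → W) : Prop := ∀ (x : Spc m) (k : Lx m), g (x + lz k) = g x

lemma per_iff {m : ℕ} (f : Spc m → ℝ) : IsPeriodic f ↔ Per f := by
  constructor
  · intro h x k
    have := h x k.1 k.2
    rw [← this]; rfl
  · intro h x k j
    have := h x (k, j)
    rw [← this]; rfl

lemma per_grd {m : ℕ} {f : Spc m → ℝ} (h : Per f) : Per (grd f) := by
  intro x k
  unfold grd
  rw [← fderiv_comp_add_right]
  congr 1
  funext y; exact h y k

lemma mem_Kc_fl {m : ℕ} (x : Spc m) : x ∈ Kc (lz (fl x)) 1 := by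
  rw [mem_Kc]
  simp only [lz, fl]
  exact ⟨⟨Int.floor_le _, (Int.lt_floor_add_one _).le⟩, fun i => ⟨Int.floor_le _, (Int.lt_floor_add_one _).le⟩⟩

lemma mid1 (x y : ℝ) (h : |x - y| < 1) : ∃ w : ℝ, ((⌊x⌋:ℝ) ≤ w ∧ w ≤ ⌊x⌋ + 1) ∧
    ((⌊y⌋:ℝ) ≤ w ∧ w ≤ ⌊y⌋ + 1) ∧ |x - w| ≤ |x - y| ∧ |y - w| ≤ |x - y| := by
  wlog hxy : x ≤ y generalizing x y
  · obtain ⟨w, h1, h2, h3, h4⟩ := this y x (by rwa [abs_sub_comm]) (le_of_not_ge hxy)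
    exact ⟨w, h2, h1, by rwa [abs_sub_comm x y], by rwa [abs_sub_comm x y]⟩
  have hx1 := Int.floor_le x
  have hx2 := Int.lt_floor_add_one x
  have hy1 := Int.floor_le y
  have hy2 := Int.lt_floor_add_one y
  rw [abs_lt] at h
  rcases (Int.floor_le_floor hxy).eq_or_lt with e | e
  · refine ⟨x, ⟨hx1, hx2.le⟩, ?_, ?_, ?_⟩
    · rw [← e]; exact ⟨hx1, hx2.le⟩
    · simp
    · rw [abs_sub_comm]
  · have e2 : ⌊y⌋ = ⌊x⌋ + 1 := by
      have : ⌊y⌋ < ⌊x⌋ + 2 := by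
        have : (⌊y⌋:ℝ) < ⌊x⌋ + 2 := by linarith
        exact_mod_cast this
      omega
    have e3 : (⌊y⌋:ℝ) = ⌊x⌋ + 1 := by rw [e2]; push_cast; ring
    refine ⟨⌊y⌋, ⟨by linarith, by linarith⟩, ⟨by linarith, by linarith⟩, ?_, ?_⟩
    · rw [abs_of_nonpos (by linarith), abs_of_nonpos (by linarith)]; linarith
    · rw [abs_of_nonneg (by linarith), abs_of_nonpos (by linarith)]; linarith

lemma nrm_le {m : ℕ} {x : Spc m} {r : ℝ} (hr : 0 ≤ r) : ‖x‖ ≤ r ↔ |x.1| ≤ r ∧ ∀ i, |x.2 i| ≤ r := by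
  rw [Prod.norm_def, max_le_iff, pi_norm_le_iff_of_nonneg hr]; rfl

lemma mid {m : ℕ} (x y : Spc m) (h : ‖x - y‖ < 1) : ∃ w, w ∈ Kc (lz (fl x)) 1 ∧ w ∈ Kc (lz (fl y)) 1 ∧
    ‖x - w‖ ≤ ‖x - y‖ ∧ ‖y - w‖ ≤ ‖x - y‖ := by
  have h0 := (nrm_le (norm_nonneg (x - y))).1 le_rfl
  obtain ⟨w1, a1, a2, a3, a4⟩ := mid1 x.1 y.1 (h0.1.trans_lt h)
  have H : ∀ i, ∃ w : ℝ, ((⌊x.2 i⌋:ℝ) ≤ w ∧ w ≤ ⌊x.2 i⌋ + 1) ∧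
    ((⌊y.2 i⌋:ℝ) ≤ w ∧ w ≤ ⌊y.2 i⌋ + 1) ∧ |x.2 i - w| ≤ |x.2 i - y.2 i| ∧ |y.2 i - w| ≤ |x.2 i - y.2 i| :=
    fun i => mid1 _ _ ((h0.2 i).trans_lt h)
  choose w2 b1 b2 b3 b4 using H
  refine ⟨(w1, w2), ?_, ?_, ?_, ?_⟩
  · rw [mem_Kc]; exact ⟨a1, b1⟩
  · rw [mem_Kc]; exact ⟨a2, b2⟩
  · exact (nrm_le (norm_nonneg _)).2 ⟨a3.trans h0.1, fun i => (b3 i).trans (h0.2 i)⟩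
  · exact (nrm_le (norm_nonneg _)).2 ⟨a4.trans h0.1, fun i => (b4 i).trans (h0.2 i)⟩

lemma sub1 (a x z r : ℝ) (hr : r ≤ 1) (hx : a ≤ x ∧ x ≤ a + 1) (hz : a ≤ z ∧ z ≤ a + 1) (h : |x - z| ≤ r) :
    ∃ b, a ≤ b ∧ b + r ≤ a + 1 ∧ (b ≤ x ∧ x ≤ b + r) ∧ (b ≤ z ∧ z ≤ b + r) := by
  rw [abs_le] at h
  refine ⟨min (min x z) (a + 1 - r), ?_, ?_, ⟨?_, ?_⟩, ?_, ?_⟩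
  · exact le_min (le_min hx.1 hz.1) (by linarith)
  · linarith [min_le_right (min x z) (a + 1 - r)]
  · exact (min_le_left _ _).trans (min_le_left _ _)
  · rcases min_cases (min x z) (a+1-r) with h1 | h1 <;> rcases min_cases x z with h2 | h2 <;> linarith
  · exact (min_le_left _ _).trans (min_le_right _ _)
  · rcases min_cases (min x z) (a+1-r) with h1 | h1 <;> rcases min_cases x z with h2 | h2 <;> linarith

lemma subcube {m : ℕ} {a x z : Spc m} {r : ℝ} (hr0 : 0 ≤ r) (hr : r ≤ 1) (hx : x ∈ Kc a 1) (hz : z ∈ Kc a 1)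
    (h : ‖x - z‖ ≤ r) : ∃ b, Kc b r ⊆ Kc a 1 ∧ x ∈ Kc b r ∧ z ∈ Kc b r := by
  rw [mem_Kc] at hx hz
  have h0 := (nrm_le hr0).1 h
  obtain ⟨b1, a1, a2, a3, a4⟩ := sub1 a.1 x.1 z.1 r hr hx.1 hz.1 h0.1
  have H := fun i => sub1 (a.2 i) (x.2 i) (z.2 i) r hr (hx.2 i) (hz.2 i) (h0.2 i)
  choose b2 c1 c2 c3 c4 using H
  refine ⟨(b1, b2), ?_, ?_, ?_⟩
  · intro y hy
    rw [mem_Kc] at hy ⊢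
    exact ⟨⟨a1.trans hy.1.1, hy.1.2.trans a2⟩, fun i => ⟨(c1 i).trans (hy.2 i).1, (hy.2 i).2.trans (c2 i)⟩⟩
  · rw [mem_Kc]; exact ⟨a3, c3⟩
  · rw [mem_Kc]; exact ⟨a4, c4⟩

lemma osc {m : ℕ} (f : Spc m → ℝ) (hd : Differentiable ℝ f) (p q : ℝ) (hp : 1 ≤ p)
    (hq : 2 * ((m:ℝ) + 1) < q) (hi : ∀ k : Lx m, IntegrableOn (grd f) (Kc (lz k) 1))
    (x y : Spc m) (hxy : ‖x - y‖ < 1) :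
    ENNReal.ofReal (‖grd f x - grd f y‖ ^ p) ≤
      ENNReal.ofReal (2 ^ p * CM m p q * ‖x - y‖ ^ (q - 2 * ((m:ℝ) + 1))) *
       (Jq p q (grd f) (Kc (lz (fl x)) 1 ∩ Metric.closedBall x (2 * ‖x - y‖)) +
        Jq p q (grd f) (Kc (lz (fl y)) 1 ∩ Metric.closedBall x (2 * ‖x - y‖))) := by
  have hp0 : 0 < p := by linarith
  by_cases hxy0 : x = y
  · simp [hxy0, hp0.ne']
  set r := ‖x - y‖ with hr
  have hr0 : 0 < r := by rw [hr, norm_pos_iff, sub_ne_zero]; exact hxy0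
  obtain ⟨w, w1, w2, w3, w4⟩ := mid x y hxy
  obtain ⟨b, b1, b2, b3⟩ := subcube hr0.le hxy.le (mem_Kc_fl x) w1 w3
  obtain ⟨c, c1, c2, c3⟩ := subcube hr0.le hxy.le (mem_Kc_fl y) w2 w4
  have m1 := morrey f hd p q hp hq b r hr0 ((hi _).mono_set b1) x w b2 b3
  have m2 := morrey f hd p q hp hq c r hr0 ((hi _).mono_set c1) w y c3 c2
  have s1 : Kc b r ⊆ Kc (lz (fl x)) 1 ∩ Metric.closedBall x (2 * r) := by
    refine subset_inter b1 fun u hu => ?_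
    rw [Metric.mem_closedBall, dist_eq_norm]
    linarith [norm_sub_le_Kc hu b2]
  have s2 : Kc c r ⊆ Kc (lz (fl y)) 1 ∩ Metric.closedBall x (2 * r) := by
    refine subset_inter c1 fun u hu => ?_
    rw [Metric.mem_closedBall, dist_eq_norm]
    have := norm_sub_le_Kc hu c2
    have h3 : ‖u - x‖ ≤ ‖u - y‖ + ‖y - x‖ := norm_sub_le_norm_sub_add_norm_sub _ _ _
    rw [norm_sub_rev y x] at h3
    linarith
  have m1' := m1.trans (mul_le_mul_right (Jq_mono p q (grd f) s1) _)
  have m2' := m2.trans (mul_le_mul_right (Jq_mono p q (grd f) s2) _)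
  set J1 := Jq p q (grd f) (Kc (lz (fl x)) 1 ∩ Metric.closedBall x (2 * r))
  set J2 := Jq p q (grd f) (Kc (lz (fl y)) 1 ∩ Metric.closedBall x (2 * r))
  have hCM := CM_pos m hp hq
  have key : ‖grd f x - grd f y‖ ^ p ≤ 2 ^ p * (‖grd f x - grd f w‖ ^ p + ‖grd f w - grd f y‖ ^ p) := by
    have h3 : ‖grd f x - grd f y‖ ≤ ‖grd f x - grd f w‖ + ‖grd f w - grd f y‖ := norm_sub_le_norm_sub_add_norm_sub _ _ _
    set A := ‖grd f x - grd f w‖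
    set B := ‖grd f w - grd f y‖
    have hA : 0 ≤ A := norm_nonneg _
    have hB : 0 ≤ B := norm_nonneg _
    calc _ ≤ (2 * max A B) ^ p := Real.rpow_le_rpow (norm_nonneg _) (by linarith [le_max_left A B, le_max_right A B]) hp0.le
      _ = 2 ^ p * (max A B) ^ p := Real.mul_rpow (by norm_num) (le_max_of_le_left hA)
      _ ≤ _ := by
        gcongr
        rcases max_cases A B with h | h <;> rw [h.1]
        · linarith [Real.rpow_nonneg hB p]
        · linarith [Real.rpow_nonneg hA p]
  calc _ ≤ ENNReal.ofReal (2 ^ p) * (ENNReal.ofReal (‖grd f x - grd f w‖ ^ p) + ENNReal.ofReal (‖grd f w - grd f y‖ ^ p)) := by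
        rw [← ENNReal.ofReal_add (by positivity) (by positivity), ← ENNReal.ofReal_mul (by positivity)]
        exact ENNReal.ofReal_le_ofReal key
    _ ≤ ENNReal.ofReal (2 ^ p) * (ENNReal.ofReal (CM m p q * r ^ (q - 2 * ((m:ℝ) + 1))) * J1 + ENNReal.ofReal (CM m p q * r ^ (q - 2 * ((m:ℝ) + 1))) * J2) :=
        mul_le_mul_right (add_le_add m1' m2') _
    _ = _ := by
      rw [← mul_add, ← mul_assoc, ← ENNReal.ofReal_mul (by positivity), mul_assoc]

instance haarSpc (m : ℕ) : (volume : Measure (Spc m)).IsAddHaarMeasure :=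
  inferInstanceAs ((volume : Measure ℝ).prod (volume : Measure (Fin m → ℝ))).IsAddHaarMeasure

lemma measurableSet_cube1 (m : ℕ) : MeasurableSet (cube1 m) :=
  MeasurableSet.univ_pi fun _ => measurableSet_Ico

lemma measurableSet_cube (m : ℕ) : MeasurableSet (cube m) :=
  measurableSet_Ico.prod (measurableSet_cube1 m)

lemma vol_cube1 (m : ℕ) : volume (cube1 m) = 1 := by
  rw [cube1, volume_pi_pi]; simp

lemma vol_cube (m : ℕ) : volume (cube m) = 1 := by
  rw [cube, Measure.volume_eq_prod, Measure.prod_prod, vol_cube1]; simp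

lemma prob_μT (m : ℕ) : IsProbabilityMeasure (μT m) := ⟨by simp [μT, vol_cube]⟩

lemma mem_cube {m : ℕ} {x : Spc m} : x ∈ cube m ↔ (0 ≤ x.1 ∧ x.1 < 1) ∧ ∀ i, 0 ≤ x.2 i ∧ x.2 i < 1 := by
  simp [cube, cube1, mem_prod, Set.mem_pi]

lemma cube_sub {m : ℕ} : cube m ⊆ Kc (0 : Spc m) 1 := by
  intro x hx
  rw [mem_cube] at hx; rw [mem_Kc]
  simp only [Prod.fst_zero, Prod.snd_zero, Pi.zero_apply, zero_add]
  exact ⟨⟨hx.1.1, hx.1.2.le⟩, fun i => ⟨(hx.2 i).1, (hx.2 i).2.le⟩⟩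

lemma cube_ae (m : ℕ) : cube m =ᵐ[volume] Kc (0 : Spc m) 1 := by
  refine ae_eq_of_subset_of_measure_ge cube_sub ?_ (measurableSet_cube m).nullMeasurableSet ?_
  · rw [vol_cube, vol_Kc _ zero_le_one]; simp
  · rw [vol_Kc _ zero_le_one]; simp

lemma restr_cube (m : ℕ) : (volume : Measure (Spc m)).restrict (cube m) = volume.restrict (Kc 0 1) :=
  Measure.restrict_congr_set (cube_ae m)

lemma Jq_cube {m : ℕ} {W : Type*} [NormedAddCommGroup W] (p q : ℝ) (g : Spc m → W) :
    Jq p q g (cube m) = Jq p q g (Kc 0 1) := by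
  unfold Jq; rw [restr_cube]

lemma lint_shift {m : ℕ} (φ : Spc m → ℝ≥0∞) (a b : Spc m) (r : ℝ) :
    ∫⁻ x in Kc (a + b) r, φ x = ∫⁻ x in Kc a r, φ (x + b) := by
  rw [← lintegral_indicator (measurableSet_Kc _ _), ← lintegral_indicator (measurableSet_Kc _ _),
    ← lintegral_add_right_eq_self (μ := (volume : Measure (Spc m))) _ b]
  congr 1; funext x
  have : x + b ∈ Kc (a + b) r ↔ x ∈ Kc a r := by
    simp only [mem_Kc, Prod.fst_add, Prod.snd_add, Pi.add_apply]
    constructor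
    · rintro ⟨⟨h1, h2⟩, h⟩
      exact ⟨⟨by linarith, by linarith⟩, fun i => ⟨by linarith [(h i).1], by linarith [(h i).2]⟩⟩
    · rintro ⟨⟨h1, h2⟩, h⟩
      exact ⟨⟨by linarith, by linarith⟩, fun i => ⟨by linarith [(h i).1], by linarith [(h i).2]⟩⟩
  by_cases h : x ∈ Kc a r
  · rw [indicator_of_mem h, indicator_of_mem (this.2 h)]
  · rw [indicator_of_notMem h, indicator_of_notMem (fun h' => h (this.1 h'))]

lemma lint_per {m : ℕ} (φ : Spc m → ℝ≥0∞) (hφ : Per φ) (k : Lx m) :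
    ∫⁻ x in Kc (lz k) 1, φ x = ∫⁻ x in Kc 0 1, φ x := by
  have := lint_shift φ 0 (lz k) 1
  rw [zero_add] at this
  rw [this]
  simp_rw [hφ _ k]

lemma Jq_per {m : ℕ} {W : Type*} [NormedAddCommGroup W] (p q : ℝ) (g : Spc m → W) (hg : Per g) (k : Lx m) :
    Jq p q g (Kc (lz k) 1) = Jq p q g (Kc 0 1) := by
  unfold Jq
  have h1 := fun φ => lint_shift φ (0 : Spc m) (lz k) 1
  simp only [zero_add] at h1
  rw [h1]
  simp_rw [h1]
  simp only [Hk, hg _ k, add_sub_add_right_eq_sub]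

lemma const_le_eLp {m : ℕ} {W : Type*} [NormedAddCommGroup W] {p : ℝ} (hp : 1 ≤ p) (h : Spc m → W) (c : ℝ)
    (hc : ∀ z ∈ cube m, c ≤ ‖h z‖) : ENNReal.ofReal c ≤ eLpNorm h (ENNReal.ofReal p) (μT m) := by
  have := prob_μT m
  by_cases hc0 : c ≤ 0
  · rw [ENNReal.ofReal_of_nonpos hc0]; exact zero_le
  push Not at hc0
  have e : eLpNorm (fun _ : Spc m => c) (ENNReal.ofReal p) (μT m) = ENNReal.ofReal c := by
    rw [eLpNorm_const _ (by simp; linarith) this.ne_zero]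
    simp [Real.enorm_eq_ofReal hc0.le]
  rw [← e]
  apply eLpNorm_mono_ae
  refine (ae_restrict_iff' (measurableSet_cube m)).2 (ae_of_all _ fun z hz => ?_)
  rw [Real.norm_of_nonneg hc0.le]; exact hc z hz

lemma WNorm_eq {m : ℕ} {σ p : ℝ} (h : Hyp2 m σ p) (f : Spc m → ℝ) : WNorm σ p f =
    LpN p f + eLpNorm (fun x => ‖grd f x‖) (ENNReal.ofReal p) (μT m) + gagl (σ - 1) p (grd f) := by
  obtain ⟨h1, h2, h3, h4⟩ := h
  have hp0 : 0 < p := by have : (0:ℝ) ≤ m := Nat.cast_nonneg m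
                         linarith
  have : 0 < ((m:ℝ) + 1) / p := by positivity
  unfold WNorm
  rw [if_neg (by linarith), if_neg (by linarith), if_pos h4, if_neg (by linarith)]

/-- the exponent -/
def qq (m : ℕ) (σ p : ℝ) : ℝ := (m:ℝ) + 1 + (σ - 1) * p

lemma gagl_eq {m : ℕ} {W : Type*} [NormedAddCommGroup W] (σ p : ℝ) (g : Spc m → W) : gagl (σ - 1) p g = (Jq p (qq m σ p) g (cube m)) ^ (1/p) := rfl

lemma hyp2_one {m : ℕ} {σ p : ℝ} (h : Hyp2 m σ p) : 1 < p := by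
  have : (0:ℝ) ≤ m := Nat.cast_nonneg m
  linarith [h.2.1]

lemma hyp2_q {m : ℕ} {σ p : ℝ} (h : Hyp2 m σ p) : 2 * ((m:ℝ) + 1) < qq m σ p := by
  have h1 := hyp2_one h
  have := h.2.2.1
  unfold qq
  have : ((m:ℝ) + 1) / p < σ - 1 := by linarith
  rw [div_lt_iff₀ (by linarith)] at this
  linarith

lemma memLp_intOn {m : ℕ} {p : ℝ} (hp : 1 ≤ p) {f : Spc m → ℝ}
    (hf : eLpNorm (fun x => ‖grd f x‖) (ENNReal.ofReal p) (μT m) < ⊤) : IntegrableOn (grd f) (Kc 0 1) := by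
  have := prob_μT m
  have h1 : MemLp (grd f) (ENNReal.ofReal p) (μT m) :=
    ⟨(measurable_grd f).aestronglyMeasurable, by rwa [eLpNorm_norm] at hf⟩
  have h2 := h1.integrable (by simpa using hp)
  rw [μT, restr_cube] at h2
  exact h2

lemma intOn_per {m : ℕ} {f : Spc m → ℝ} (hf : Per f) (hi : IntegrableOn (grd f) (Kc 0 1)) (k : Lx m) :
    IntegrableOn (grd f) (Kc (lz k) 1) := by
  refine ⟨(measurable_grd f).aestronglyMeasurable, ?_⟩
  have h2 := hi.2
  unfold HasFiniteIntegral at h2 ⊢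
  rwa [lint_per _ (fun x k => by rw [per_grd hf])]

lemma root_bd {p A B N : ℝ} (hp : 0 < p) (hA : 0 ≤ A) (hB : 0 ≤ B) (hN : 0 ≤ N) (h : A ^ p ≤ B * N ^ p) :
    A ≤ B ^ (1/p) * N := by
  have : A ^ p ≤ (B ^ (1/p) * N) ^ p := by
    rw [Real.mul_rpow (by positivity) hN, ← Real.rpow_mul hB, one_div_mul_cancel hp.ne', Real.rpow_one]
    exact h
  exact (Real.rpow_le_rpow_iff hA (by positivity) hp).1 this

lemma embed {m : ℕ} {σ p : ℝ} (h : Hyp2 m σ p) : ∃ C > 0, ∀ (f : Spc m → ℝ) (N : ℝ), MemW σ p f → 0 ≤ N →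
    WNorm σ p f ≤ ENNReal.ofReal N →
    (∀ x y, ‖x - y‖ < 1 → ‖grd f x - grd f y‖ ≤ C * ‖x - y‖ ^ ((qq m σ p - 2 * ((m:ℝ) + 1))/p) * N) ∧
    (∀ x, ‖grd f x‖ ≤ C * N) ∧ ∀ x, |f x| ≤ C * N := by
  have hp := hyp2_one h
  have hp0 : 0 < p := by linarith
  have hq := hyp2_q h
  set q := qq m σ p with hqd
  have hCM := CM_pos m hp.le hq
  set C1 := (2 ^ p * CM m p q * 2) ^ (1/p) with hC1
  have hC1p : 0 < C1 := by positivity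
  set C2 := (CM m p q) ^ (1/p) with hC2
  have hC2p : 0 < C2 := by positivity
  refine ⟨C1 + 2 * C2 + 3, by positivity, fun f N hf hN hW => ?_⟩
  rw [WNorm_eq h] at hW
  have hper : Per f := (per_iff f).1 hf.1
  have hd : Differentiable ℝ f := hf.2.2.1 (by have := h.2.2.1; have : 0 < ((m:ℝ) + 1) / p := by positivity
                                               linarith)
  have w1 : LpN p f ≤ ENNReal.ofReal N := le_trans (le_trans le_self_add le_self_add) hW
  have w2 : eLpNorm (fun x => ‖grd f x‖) (ENNReal.ofReal p) (μT m) ≤ ENNReal.ofReal N :=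
    le_trans (le_trans le_add_self le_self_add) hW
  have w3 : gagl (σ - 1) p (grd f) ≤ ENNReal.ofReal N := le_trans le_add_self hW
  have hi : IntegrableOn (grd f) (Kc 0 1) := memLp_intOn hp.le (w2.trans_lt ENNReal.ofReal_lt_top)
  have hJ : Jq p q (grd f) (Kc 0 1) ≤ ENNReal.ofReal (N ^ p) := by
    rw [gagl_eq, Jq_cube, ← hqd] at w3
    have := ENNReal.rpow_le_rpow w3 hp0.le
    rwa [← ENNReal.rpow_mul, one_div_mul_cancel hp0.ne', ENNReal.rpow_one, ENNReal.ofReal_rpow_of_nonneg hN hp0.le] at this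
  have red : ∀ x : Spc m, ∃ x' ∈ Kc (0 : Spc m) 1, grd f x = grd f x' ∧ f x = f x' := by
    intro x
    refine ⟨x - lz (fl x), ?_, ?_, ?_⟩
    · have := mem_Kc_fl x
      rw [mem_Kc] at this ⊢
      simp only [Prod.fst_sub, Prod.snd_sub, Pi.sub_apply, Prod.fst_zero, Prod.snd_zero, Pi.zero_apply]
      exact ⟨⟨by linarith [this.1.1], by linarith [this.1.2]⟩, fun i => ⟨by linarith [(this.2 i).1], by linarith [(this.2 i).2]⟩⟩
    · rw [← per_grd hper (x - lz (fl x)) (fl x), sub_add_cancel]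
    · rw [← hper (x - lz (fl x)) (fl x), sub_add_cancel]
  have g0 : ∀ x ∈ Kc (0:Spc m) 1, ‖grd f x‖ ≤ (C2 + 1) * N := by
    intro x hx
    have h5 : ENNReal.ofReal (‖grd f x‖ - C2 * N) ≤ ENNReal.ofReal N := by
      rw [eLpNorm_norm] at w2
      refine le_trans (const_le_eLp hp.le _ _ fun z hz => ?_) w2
      have h6 := morrey f hd p q hp.le hq 0 1 one_pos hi x z hx (cube_sub hz)
      have h7 := h6.trans (mul_le_mul_right hJ _)
      rw [Real.one_rpow, mul_one, ← ENNReal.ofReal_mul hCM.le, ENNReal.ofReal_le_ofReal_iff (by positivity)] at h7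
      have h8 := root_bd hp0 (norm_nonneg _) hCM.le hN h7
      have := norm_sub_norm_le (grd f x) (grd f z)
      linarith
    rw [ENNReal.ofReal_le_ofReal_iff hN] at h5
    linarith
  have g1 : ∀ x, ‖grd f x‖ ≤ (C2 + 1) * N := by
    intro x
    obtain ⟨x', hx', e, -⟩ := red x
    rw [e]; exact g0 x' hx'
  refine ⟨fun x y hxy => ?_, fun x => ?_, fun x => ?_⟩
  · have h5 := osc f hd p q hp.le hq (intOn_per hper hi) x y hxy
    have h6 : ∀ (k : Lx m) (B : Set (Spc m)), Jq p q (grd f) (Kc (lz k) 1 ∩ B) ≤ ENNReal.ofReal (N ^ p) := by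
      intro k B
      refine (Jq_mono p q _ inter_subset_left).trans ?_
      rwa [Jq_per p q _ (per_grd hper)]
    have h7 := h5.trans (mul_le_mul_right (add_le_add (h6 _ _) (h6 _ _)) _)
    rw [← ENNReal.ofReal_add (by positivity) (by positivity), ← ENNReal.ofReal_mul (by positivity),
      ENNReal.ofReal_le_ofReal_iff (by positivity), ← two_mul, ← mul_assoc] at h7
    have h8 := root_bd hp0 (norm_nonneg _) (by positivity) hN h7
    have e : (2 ^ p * CM m p q * ‖x - y‖ ^ (q - 2 * ((m:ℝ) + 1)) * 2) ^ (1/p) = C1 * ‖x - y‖ ^ ((q - 2 * ((m:ℝ) + 1))/p) := by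
      rw [mul_right_comm, Real.mul_rpow (by positivity) (by positivity), ← Real.rpow_mul (norm_nonneg _), mul_one_div]
    rw [e] at h8
    refine h8.trans ?_
    gcongr
    linarith
  · refine (g1 x).trans (mul_le_mul_of_nonneg_right (by linarith) hN)
  · obtain ⟨x', hx', -, e⟩ := red x
    rw [e]
    have h5 : ENNReal.ofReal (|f x'| - (C2 + 1) * N) ≤ ENNReal.ofReal N := by
      refine le_trans (const_le_eLp hp.le _ _ fun z hz => ?_) w1
      have h6 := convex_univ.norm_image_sub_le_of_norm_fderiv_le (𝕜 := ℝ) (f := f) (fun x _ => hd x) (fun x _ => g1 x) (mem_univ z) (mem_univ x')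
      have h7 := norm_sub_le_Kc hx' (cube_sub hz)
      have h8 : ‖f x' - f z‖ ≤ (C2 + 1) * N := h6.trans (mul_le_of_le_one_right (by positivity) h7)
      have := norm_sub_norm_le (f x') (f z)
      rw [Real.norm_eq_abs (f x')] at this
      linarith
    rw [ENNReal.ofReal_le_ofReal_iff hN] at h5
    nlinarith

lemma finrank_Spc (m : ℕ) : Module.finrank ℝ (Spc m) = m + 1 := by
  rw [Module.finrank_prod]; simp [add_comm]

lemma near_int (m : ℕ) {α r : ℝ} (hα : α < m + 1) :
    IntegrableOn (fun h : Spc m => ‖h‖ ^ (-α)) (Metric.ball 0 r) := by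
  refine integrableOn_ball_of_norm_le_rpow (C := 1) (α := α) (by rw [finrank_Spc]; omega) (by rw [finrank_Spc]; push_cast; exact hα) ?_ ?_
  · refine ae_of_all _ fun x => ?_
    rw [one_mul, Real.norm_of_nonneg (by positivity)]
  · exact (Measurable.pow_const measurable_norm _).aestronglyMeasurable

/-- tail function -/
def tailF (m : ℕ) (a : ℝ) (h : Spc m) : ℝ := if 1 ≤ ‖h‖ then ‖h‖ ^ (-a) else 0

lemma tail_int (m : ℕ) {a : ℝ} (ha : (m:ℝ) + 1 < a) : Integrable (tailF m a) := by
  have h1 : Integrable (fun x : Spc m => (1 + ‖x‖) ^ (-a)) := by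
    apply integrable_one_add_norm
    rw [finrank_Spc]; push_cast; exact ha
  have ha0 : 0 < a := by have : (0:ℝ) ≤ m := Nat.cast_nonneg m
                         linarith
  refine (h1.const_mul (2 ^ a)).mono' ?_ (ae_of_all _ fun h => ?_)
  · unfold tailF
    exact (Measurable.ite (measurableSet_le measurable_const measurable_norm) (Measurable.pow_const measurable_norm _) measurable_const).aestronglyMeasurable
  · unfold tailF
    split_ifs with hh
    · rw [Real.norm_of_nonneg (by positivity), Real.rpow_neg (by positivity), Real.rpow_neg (by positivity), ← div_eq_mul_inv]
      rw [le_div_iff₀ (by positivity), inv_mul_le_iff₀ (by positivity), mul_comm, ← Real.mul_rpow (by norm_num) (norm_nonneg _)]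
      exact Real.rpow_le_rpow (by positivity) (by linarith) ha0.le
    · simp; positivity

lemma tail_lint (m : ℕ) {a : ℝ} (ha : (m:ℝ) + 1 < a) : ∃ C : ℝ, 0 ≤ C ∧ ∀ ρ : ℝ, 0 < ρ →
    ∫⁻ h : Spc m, ENNReal.ofReal (if ρ ≤ ‖h‖ then ‖h‖ ^ (-a) else 0) ≤ ENNReal.ofReal (C * ρ ^ ((m:ℝ) + 1 - a)) := by
  have hnn : ∀ h, 0 ≤ tailF m a h := fun h => by unfold tailF; split_ifs <;> positivity
  refine ⟨∫ h, tailF m a h, integral_nonneg hnn, fun ρ hρ => ?_⟩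
  have e : ∀ h : Spc m, (if ρ ≤ ‖h‖ then ‖h‖ ^ (-a) else 0) = ρ ^ (-a) * tailF m a (ρ⁻¹ • h) := by
    intro h
    unfold tailF
    rw [norm_smul, Real.norm_of_nonneg (by positivity)]
    have : ρ ≤ ‖h‖ ↔ 1 ≤ ρ⁻¹ * ‖h‖ := by rw [le_inv_mul_iff₀ hρ, mul_one]
    by_cases h1 : ρ ≤ ‖h‖
    · rw [if_pos h1, if_pos (this.1 h1), ← Real.mul_rpow (by positivity) (by positivity)]
      congr 1; field_simp
    · rw [if_neg h1, if_neg (fun h2 => h1 (this.2 h2)), mul_zero]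
  have hint : Integrable (fun h : Spc m => ρ ^ (-a) * tailF m a (ρ⁻¹ • h)) :=
    ((tail_int m ha).comp_smul (inv_ne_zero hρ.ne')).const_mul _
  simp_rw [e]
  rw [← ofReal_integral_eq_lintegral_ofReal hint (ae_of_all _ fun h => mul_nonneg (by positivity) (hnn _)),
    integral_const_mul, Measure.integral_comp_inv_smul_of_nonneg volume _ hρ.le, finrank_Spc, smul_eq_mul]
  apply ENNReal.ofReal_le_ofReal (le_of_eq _)
  rw [sub_eq_add_neg, Real.rpow_add hρ, ← Real.rpow_natCast]
  push_cast
  ring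

lemma cball_eq {m : ℕ} (u : Spc m) {r : ℝ} (hr : 0 ≤ r) : volume (Metric.closedBall u r) = ENNReal.ofReal ((2*r) ^ (m+1)) := by
  rw [← vol_Kc (u - r • one1 m) (by positivity)]
  congr 1
  ext x
  rw [Metric.mem_closedBall, dist_eq_norm, nrm_le hr, mem_Kc]
  simp only [one1, Prod.fst_sub, Prod.snd_sub, Pi.sub_apply, Prod.smul_fst, Prod.smul_snd, Pi.smul_apply, smul_eq_mul, mul_one, abs_le]
  constructor
  · rintro ⟨h1, h2⟩
    exact ⟨⟨by linarith, by linarith⟩, fun i => ⟨by linarith [(h2 i).1], by linarith [(h2 i).2]⟩⟩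
  · rintro ⟨h1, h2⟩
    exact ⟨⟨by linarith, by linarith⟩, fun i => ⟨by linarith [(h2 i).1], by linarith [(h2 i).2]⟩⟩

/-- four-fold swap -/
lemma four {m : ℕ} (H : Spc m × Spc m → ℝ≥0∞) (hH : Measurable H) (K : Set (Spc m)) (hK : MeasurableSet K)
    (w : Spc m → ℝ≥0∞) (hw : Measurable w) :
    ∫⁻ x : Spc m, ∫⁻ h : Spc m, w h * ∫⁻ u in K ∩ Metric.closedBall x (2 * ‖h‖), ∫⁻ v in K ∩ Metric.closedBall x (2 * ‖h‖), H (u, v)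
    ≤ ∫⁻ u in K, ∫⁻ v in K, H (u, v) * ∫⁻ h : Spc m, w h * ENNReal.ofReal (if ‖u - v‖/4 ≤ ‖h‖ then (4 * ‖h‖)^(m+1) else 0) := by
  set I : Spc m → Spc m → Spc m → ℝ≥0∞ := fun x h u => if ‖u - x‖ ≤ 2 * ‖h‖ then 1 else 0 with hI
  set L : Spc m → Spc m → Spc m → ℝ≥0∞ := fun h u v => if ‖u - v‖ / 4 ≤ ‖h‖ then H (u, v) else 0 with hL
  set Ψ : Spc m → Spc m → ℝ≥0∞ := fun h u => ∫⁻ v in K, L h u v with hΨ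
  have mI : Measurable (fun z : (Spc m × Spc m) × Spc m => I z.1.1 z.1.2 z.2) := by
    refine Measurable.ite (measurableSet_le ?_ ?_) measurable_const measurable_const <;> fun_prop
  have mL : Measurable (fun z : (Spc m × Spc m) × Spc m => L z.1.1 z.1.2 z.2) := by
    refine Measurable.ite (measurableSet_le ?_ ?_) ?_ measurable_const <;> fun_prop
  have mΨ : Measurable (fun z : Spc m × Spc m => Ψ z.1 z.2) := Measurable.lintegral_prod_right' mL
  have s1 : ∀ x h : Spc m, ∫⁻ u in K ∩ Metric.closedBall x (2 * ‖h‖), ∫⁻ v in K ∩ Metric.closedBall x (2 * ‖h‖), H (u, v)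
      ≤ ∫⁻ u in K, I x h u * Ψ h u := by
    intro x h
    have hB : MeasurableSet (Metric.closedBall x (2 * ‖h‖)) := measurableSet_closedBall
    rw [inter_comm, ← Measure.restrict_restrict hB, ← lintegral_indicator hB]
    refine lintegral_mono fun u => ?_
    by_cases hu : u ∈ Metric.closedBall x (2 * ‖h‖)
    · rw [indicator_of_mem hu]
      have hu' := hu
      rw [Metric.mem_closedBall, dist_eq_norm] at hu'
      simp only [hI, if_pos hu', one_mul]
      rw [← lintegral_indicator hB]
      refine lintegral_mono fun v => ?_
      by_cases hv : v ∈ Metric.closedBall x (2 * ‖h‖)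
      · rw [indicator_of_mem hv]
        rw [Metric.mem_closedBall, dist_eq_norm] at hv
        have : ‖u - v‖ ≤ ‖u - x‖ + ‖x - v‖ := norm_sub_le_norm_sub_add_norm_sub _ _ _
        rw [norm_sub_rev x v] at this
        simp only [hL]
        rw [if_pos (by linarith)]
      · rw [indicator_of_notMem hv]; exact zero_le
    · rw [indicator_of_notMem hu]; exact zero_le
  calc _ ≤ ∫⁻ x : Spc m, ∫⁻ h : Spc m, w h * ∫⁻ u in K, I x h u * Ψ h u :=
        lintegral_mono fun x => lintegral_mono fun h => mul_le_mul_right (s1 x h) _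
    _ = ∫⁻ h : Spc m, ∫⁻ x : Spc m, w h * ∫⁻ u in K, I x h u * Ψ h u := by
        rw [lintegral_lintegral_swap]
        have : Measurable (fun z : Spc m × Spc m => ∫⁻ u in K, I z.1 z.2 u * Ψ z.2 u) := by
          refine Measurable.lintegral_prod_right' (f := fun z : (Spc m × Spc m) × Spc m => I z.1.1 z.1.2 z.2 * Ψ z.1.2 z.2) (mI.mul ?_)
          exact mΨ.comp ((measurable_snd.comp measurable_fst).prodMk measurable_snd)
        exact ((hw.comp measurable_snd).mul this).aemeasurable
    _ = ∫⁻ h : Spc m, w h * ∫⁻ u in K, Ψ h u * ENNReal.ofReal ((4 * ‖h‖)^(m+1)) := by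
        refine lintegral_congr fun h => ?_
        have m2 : Measurable (fun z : Spc m × Spc m => I z.1 h z.2 * Ψ h z.2) := by
          refine Measurable.mul ?_ ?_
          · exact mI.comp ((measurable_fst.prodMk measurable_const).prodMk measurable_snd)
          · exact mΨ.comp (measurable_const.prodMk measurable_snd)
        rw [lintegral_const_mul _ (Measurable.lintegral_prod_right' m2), lintegral_lintegral_swap m2.aemeasurable]
        congr 1
        refine lintegral_congr fun u => ?_
        have m3 : Measurable (fun x : Spc m => I x h u) := mI.comp ((measurable_id.prodMk measurable_const).prodMk measurable_const)
        change ∫⁻ x, I x h u * Ψ h u = _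
        rw [lintegral_mul_const _ m3, mul_comm]
        congr 1
        have : (fun x : Spc m => I x h u) = (Metric.closedBall u (2 * ‖h‖)).indicator (fun _ => 1) := by
          funext x
          simp only [hI, indicator, Metric.mem_closedBall, dist_eq_norm, norm_sub_rev u x]
        rw [this, lintegral_indicator measurableSet_closedBall, setLIntegral_one, cball_eq _ (by positivity)]
        congr 2; ring
    _ = ∫⁻ h : Spc m, ∫⁻ u in K, w h * (Ψ h u * ENNReal.ofReal ((4 * ‖h‖)^(m+1))) := by
        refine lintegral_congr fun h => ?_
        rw [lintegral_const_mul]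
        exact (mΨ.comp (measurable_const.prodMk measurable_id)).mul_const _
    _ = ∫⁻ u in K, ∫⁻ h : Spc m, w h * (Ψ h u * ENNReal.ofReal ((4 * ‖h‖)^(m+1))) := by
        rw [lintegral_lintegral_swap]
        have : Measurable (fun h : Spc m => ENNReal.ofReal ((4 * ‖h‖)^(m+1))) := by fun_prop
        exact ((hw.comp measurable_fst).mul (mΨ.mul (this.comp measurable_fst))).aemeasurable
    _ = ∫⁻ u in K, ∫⁻ h : Spc m, ∫⁻ v in K, w h * ENNReal.ofReal ((4 * ‖h‖)^(m+1)) * L h u v := by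
        refine lintegral_congr fun u => lintegral_congr fun h => ?_
        rw [lintegral_const_mul]
        · simp only [hΨ]; ring
        · exact mL.comp ((measurable_const.prodMk measurable_const).prodMk measurable_id)
    _ = ∫⁻ u in K, ∫⁻ v in K, ∫⁻ h : Spc m, w h * ENNReal.ofReal ((4 * ‖h‖)^(m+1)) * L h u v := by
        refine lintegral_congr fun u => ?_
        rw [lintegral_lintegral_swap]
        have : Measurable (fun h : Spc m => w h * ENNReal.ofReal ((4 * ‖h‖)^(m+1))) := by fun_prop
        refine ((this.comp measurable_fst).mul ?_).aemeasurable
        exact mL.comp ((measurable_fst.prodMk measurable_const).prodMk measurable_snd)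
    _ = _ := by
        refine lintegral_congr fun u => lintegral_congr fun v => ?_
        rw [← lintegral_const_mul]
        · refine lintegral_congr fun h => ?_
          simp only [hL]
          split_ifs
          · ring
          · simp
        · refine hw.mul (ENNReal.measurable_ofReal.comp ?_)
          refine Measurable.ite (measurableSet_le ?_ ?_) ?_ measurable_const <;> fun_prop

/-- periodic near energy -/
def PN {m : ℕ} {W : Type*} [NormedAddCommGroup W] (p q ε : ℝ) (g : Spc m → W) : ℝ≥0∞ :=
  ∫⁻ x in Kc 0 1, ∫⁻ h in Metric.ball (0 : Spc m) ε, Hk p q g x (x + h)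

/-- index set -/
def SL (m : ℕ) : Finset (Lx m) := Finset.Icc (-1 : ℤ) 2 ×ˢ Finset.Icc (-1 : Fin m → ℤ) 2

lemma fl_mem {m : ℕ} (y : Spc m) (h : (-1 ≤ y.1 ∧ y.1 ≤ 2) ∧ ∀ i, -1 ≤ y.2 i ∧ y.2 i ≤ 2) :
    fl y ∈ SL m := by
  have key : ∀ t : ℝ, -1 ≤ t → t ≤ 2 → -1 ≤ ⌊t⌋ ∧ ⌊t⌋ ≤ 2 := by
    intro t h1 h2
    constructor
    · rw [Int.le_floor]; push_cast; exact h1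
    · have := Int.floor_le t
      have : (⌊t⌋ : ℝ) ≤ 2 := by linarith
      exact_mod_cast this
  rw [SL, Finset.mem_product, Finset.mem_Icc, Finset.mem_Icc]
  exact ⟨key _ h.1.1 h.1.2, ⟨fun i => (key _ (h.2 i).1 (h.2 i).2).1, fun i => (key _ (h.2 i).1 (h.2 i).2).2⟩⟩

lemma meas_JB {m : ℕ} (f : Spc m → ℝ) (p q' : ℝ) (w : Spc m → ℝ≥0∞) (mw : Measurable w) (k : Lx m) :
    Measurable (fun z : Spc m × Spc m => w z.2 * Jq p q' (grd f) (Kc (lz k) 1 ∩ Metric.closedBall z.1 (2 * ‖z.2‖))) := by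
  set H : Spc m × Spc m → ℝ≥0∞ := fun z => Hk p q' (grd f) z.1 z.2 with hH
  have mH : Measurable H := measurable_Hk p q' (measurable_grd f)
  refine (mw.comp measurable_snd).mul ?_
  have hB : ∀ z : Spc m × Spc m, MeasurableSet (Metric.closedBall z.1 (2 * ‖z.2‖)) := fun z => measurableSet_closedBall
  have e : ∀ z : Spc m × Spc m, Jq p q' (grd f) (Kc (lz k) 1 ∩ Metric.closedBall z.1 (2 * ‖z.2‖)) =
      ∫⁻ u in Kc (lz k) 1, ∫⁻ v in Kc (lz k) 1, if ‖u - z.1‖ ≤ 2 * ‖z.2‖ ∧ ‖v - z.1‖ ≤ 2 * ‖z.2‖ then H (u, v) else 0 := by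
    intro z
    unfold Jq
    rw [inter_comm, ← Measure.restrict_restrict (hB z), ← lintegral_indicator (hB z)]
    refine lintegral_congr fun u => ?_
    by_cases hu : u ∈ Metric.closedBall z.1 (2 * ‖z.2‖)
    · rw [indicator_of_mem hu, ← lintegral_indicator (hB z)]
      refine lintegral_congr fun v => ?_
      rw [Metric.mem_closedBall, dist_eq_norm] at hu
      simp only [hu, true_and, indicator, Metric.mem_closedBall, dist_eq_norm, hH]
    · rw [indicator_of_notMem hu]
      rw [Metric.mem_closedBall, dist_eq_norm] at hu
      simp [hu]
  simp_rw [e]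
  refine Measurable.lintegral_prod_right' (f := fun y : (Spc m × Spc m) × Spc m => ∫⁻ v in Kc (lz k) 1, if ‖y.2 - y.1.1‖ ≤ 2 * ‖y.1.2‖ ∧ ‖v - y.1.1‖ ≤ 2 * ‖y.1.2‖ then H (y.2, v) else 0) ?_
  refine Measurable.lintegral_prod_right' (f := fun y : ((Spc m × Spc m) × Spc m) × Spc m => if ‖y.1.2 - y.1.1.1‖ ≤ 2 * ‖y.1.1.2‖ ∧ ‖y.2 - y.1.1.1‖ ≤ 2 * ‖y.1.1.2‖ then H (y.1.2, y.2) else 0) ?_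
  have hs : MeasurableSet ({y : ((Spc m × Spc m) × Spc m) × Spc m | ‖y.1.2 - y.1.1.1‖ ≤ 2 * ‖y.1.1.2‖} ∩ {y | ‖y.2 - y.1.1.1‖ ≤ 2 * ‖y.1.1.2‖}) := by
    refine MeasurableSet.inter (measurableSet_le ?_ ?_) (measurableSet_le ?_ ?_) <;> fun_prop
  refine Measurable.ite hs ?_ measurable_const
  exact mH.comp ((measurable_snd.comp measurable_fst).prodMk measurable_snd)

lemma sum_aux {m : ℕ} {ι : Type*} (S : Finset ι) (A : ι → Spc m → Spc m → ℝ≥0∞) (B : Spc m → Spc m → ℝ≥0∞)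
    (hB : ∀ x ∈ Kc (0 : Spc m) 1, ∀ h ∈ Metric.ball (0 : Spc m) 1, B x h ≤ ∑ k ∈ S, A k x h)
    (mA : ∀ k, Measurable (fun z : Spc m × Spc m => A k z.1 z.2))
    (fin1 : ∀ k, ∫⁻ x, ∫⁻ h, A k x h < ⊤) : ∫⁻ x in Kc (0 : Spc m) 1, ∫⁻ h in Metric.ball (0 : Spc m) 1, B x h < ⊤ := by
  have m1 : ∀ k x, Measurable (A k x) := fun k x => (mA k).comp (measurable_const.prodMk measurable_id)
  have m2 : ∀ k, Measurable (fun x => ∫⁻ h, A k x h) := fun k => Measurable.lintegral_prod_right' (mA k)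
  calc _ ≤ ∫⁻ x in Kc 0 1, ∫⁻ h in Metric.ball (0 : Spc m) 1, ∑ k ∈ S, A k x h := by
        refine setLIntegral_mono' (measurableSet_Kc _ _) fun x hx => setLIntegral_mono' measurableSet_ball fun h hh => hB x hx h hh
    _ ≤ ∫⁻ x : Spc m, ∫⁻ h : Spc m, ∑ k ∈ S, A k x h :=
        (setLIntegral_le_lintegral _ _).trans (lintegral_mono fun x => setLIntegral_le_lintegral _ _)
    _ = ∑ k ∈ S, ∫⁻ x : Spc m, ∫⁻ h : Spc m, A k x h := by
        rw [← lintegral_finsetSum S (fun k _ => m2 k)]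
        refine lintegral_congr fun x => ?_
        rw [lintegral_finsetSum S (fun k _ => m1 k x)]
    _ < ⊤ := by
        rw [ENNReal.sum_lt_top]
        exact fun k _ => fin1 k

lemma PN_fin {m : ℕ} (f : Spc m → ℝ) (hper : Per f) (hd : Differentiable ℝ f) (p q : ℝ) (hp : 1 ≤ p)
    (hq : 2 * ((m:ℝ) + 1) < q) (hi : IntegrableOn (grd f) (Kc 0 1)) (hJ : Jq p q (grd f) (Kc 0 1) < ⊤) :
    PN p q 1 (grd f) < ⊤ := by
  have hp0 : 0 < p := by linarith
  set q' := (2 * ((m:ℝ) + 1) + q) / 2 with hq'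
  have hq1 : 2 * ((m:ℝ) + 1) < q' := by rw [hq']; linarith
  have hq2 : q' < q := by rw [hq']; linarith
  have hCM := CM_pos m hp hq1
  set D : ℝ := 2 * (2 ^ p * CM m p q') with hD
  have hD0 : 0 < D := by positivity
  set κ : ℝ := q + 2 * ((m:ℝ) + 1) - q' with hκ
  set w : Spc m → ℝ≥0∞ := fun h => ENNReal.ofReal (D * ‖h‖ ^ (-κ)) with hw
  have mw : Measurable w := by
    simp only [hw]
    exact ENNReal.measurable_ofReal.comp ((Measurable.pow_const measurable_norm _).const_mul _)
  set H : Spc m × Spc m → ℝ≥0∞ := fun z => Hk p q' (grd f) z.1 z.2 with hH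
  have mH : Measurable H := measurable_Hk p q' (measurable_grd f)
  set S := SL m with hS
  have step1 : ∀ x ∈ Kc (0 : Spc m) 1, ∀ h ∈ Metric.ball (0 : Spc m) 1, Hk p q (grd f) x (x + h) ≤
      ∑ k ∈ S, w h * Jq p q' (grd f) (Kc (lz k) 1 ∩ Metric.closedBall x (2 * ‖h‖)) := by
    intro x hx h hh
    rw [mem_ball_zero_iff] at hh
    have e : ‖x - (x + h)‖ = ‖h‖ := by rw [sub_add_cancel_left, norm_neg]
    by_cases h0 : h = 0
    · simp [h0, Hk, hp0.ne']
    have hr0 : 0 < ‖h‖ := norm_pos_iff.2 h0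
    rw [mem_Kc] at hx
    simp only [Prod.fst_zero, Prod.snd_zero, Pi.zero_apply, zero_add] at hx
    have hh1 := (nrm_le zero_le_one).1 hh.le
    simp only [abs_le] at hh1
    have k1 : fl x ∈ S := fl_mem x ⟨⟨by linarith [hx.1.1], by linarith [hx.1.2]⟩, fun i => ⟨by linarith [(hx.2 i).1], by linarith [(hx.2 i).2]⟩⟩
    have k2 : fl (x + h) ∈ S := by
      refine fl_mem _ ?_
      simp only [Prod.fst_add, Prod.snd_add, Pi.add_apply]
      exact ⟨⟨by linarith [hx.1.1, hh1.1.1], by linarith [hx.1.2, hh1.1.2]⟩, fun i => ⟨by linarith [(hx.2 i).1, (hh1.2 i).1], by linarith [(hx.2 i).2, (hh1.2 i).2]⟩⟩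
    have h5 := osc f hd p q' hp hq1 (intOn_per hper hi) x (x + h) (by rwa [e])
    rw [e] at h5
    set J : Lx m → ℝ≥0∞ := fun k => Jq p q' (grd f) (Kc (lz k) 1 ∩ Metric.closedBall x (2 * ‖h‖)) with hJd
    have h6 : J (fl x) + J (fl (x + h)) ≤ 2 * ∑ k ∈ S, J k := by
      rw [two_mul]
      exact add_le_add (Finset.single_le_sum (f := J) (fun _ _ => zero_le) k1) (Finset.single_le_sum (f := J) (fun _ _ => zero_le) k2)
    have h7 := h5.trans (mul_le_mul_right h6 _)
    rw [← Finset.mul_sum]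
    have e2 : Hk p q (grd f) x (x + h) = ENNReal.ofReal (‖h‖ ^ (-q)) * ENNReal.ofReal (‖grd f x - grd f (x + h)‖ ^ p) := by
      rw [Hk, e, ← ENNReal.ofReal_mul (by positivity), Real.rpow_neg hr0.le, div_eq_mul_inv, mul_comm]
    rw [e2]
    refine (mul_le_mul_right h7 _).trans (le_of_eq ?_)
    have e3 : w h = ENNReal.ofReal (‖h‖ ^ (-q)) * (ENNReal.ofReal (2 ^ p * CM m p q' * ‖h‖ ^ (q' - 2 * ((m:ℝ) + 1))) * 2) := by
      have : (2:ℝ≥0∞) = ENNReal.ofReal 2 := by simp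
      rw [this, ← ENNReal.ofReal_mul (by positivity), ← ENNReal.ofReal_mul (by positivity)]
      simp only [hw]
      congr 1
      have : -κ = -q + (q' - 2 * ((m:ℝ) + 1)) := by rw [hκ]; ring
      rw [this, Real.rpow_add hr0, hD]; ring
    rw [e3]; ring
  obtain ⟨C, hC0, hC⟩ := tail_lint m (a := (m:ℝ) + 1 + (q - q')) (by linarith)
  have fin1 : ∀ k : Lx m, ∫⁻ x : Spc m, ∫⁻ h : Spc m, w h * Jq p q' (grd f) (Kc (lz k) 1 ∩ Metric.closedBall x (2 * ‖h‖)) < ⊤ := by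
    intro k
    refine (four H mH (Kc (lz k) 1) (measurableSet_Kc _ _) w mw).trans_lt ?_
    set E := D * 4 ^ (m + 1) * C * 4 ^ (q - q') with hE
    have hE0 : 0 ≤ E := by positivity
    have s2 : ∀ u v : Spc m, H (u, v) * ∫⁻ h : Spc m, w h * ENNReal.ofReal (if ‖u - v‖/4 ≤ ‖h‖ then (4 * ‖h‖)^(m+1) else 0)
        ≤ ENNReal.ofReal E * Hk p q (grd f) u v := by
      intro u v
      by_cases huv : u = v
      · simp [hH, Hk, huv, hp0.ne']
      have hr : 0 < ‖u - v‖ := norm_pos_iff.2 (sub_ne_zero.2 huv)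
      have s3 : ∫⁻ h : Spc m, w h * ENNReal.ofReal (if ‖u - v‖/4 ≤ ‖h‖ then (4 * ‖h‖)^(m+1) else 0) ≤
          ENNReal.ofReal (D * 4 ^ (m+1)) * ENNReal.ofReal (C * (‖u - v‖/4) ^ ((m:ℝ) + 1 - ((m:ℝ) + 1 + (q - q')))) := by
        refine le_trans ?_ (mul_le_mul_right (hC _ (by positivity)) _)
        rw [← lintegral_const_mul' _ _ ENNReal.ofReal_ne_top]
        refine lintegral_mono fun h => ?_
        simp only [hw]
        rw [← ENNReal.ofReal_mul (by positivity), ← ENNReal.ofReal_mul (by positivity)]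
        apply ENNReal.ofReal_le_ofReal
        split_ifs with hc
        · have hh0 : 0 < ‖h‖ := lt_of_lt_of_le (by positivity) hc
          have : -((m:ℝ) + 1 + (q - q')) = -κ + ((m + 1 : ℕ) : ℝ) := by rw [hκ]; push_cast; ring
          rw [this, Real.rpow_add hh0, Real.rpow_natCast, mul_pow]
          apply le_of_eq; ring
        · simp
      refine (mul_le_mul_right s3 _).trans (le_of_eq ?_)
      simp only [hH, Hk]
      rw [← ENNReal.ofReal_mul (by positivity), ← ENNReal.ofReal_mul (by positivity), ← ENNReal.ofReal_mul hE0]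
      congr 1
      have : (m:ℝ) + 1 - ((m:ℝ) + 1 + (q - q')) = -(q - q') := by ring
      rw [this, Real.div_rpow hr.le (by norm_num), Real.rpow_neg hr.le, Real.rpow_neg (by norm_num : (0:ℝ) ≤ 4), hE]
      have : ‖u - v‖ ^ q = ‖u - v‖ ^ q' * ‖u - v‖ ^ (q - q') := by rw [← Real.rpow_add hr]; congr 1; ring
      rw [this]
      field_simp
    refine lt_of_le_of_lt (lintegral_mono fun u => lintegral_mono fun v => s2 u v) ?_
    simp_rw [lintegral_const_mul' _ _ ENNReal.ofReal_ne_top]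
    refine ENNReal.mul_lt_top ENNReal.ofReal_lt_top ?_
    have := Jq_per p q (grd f) (per_grd hper) k
    unfold Jq at this hJ
    rwa [this]
  have mJ := fun k : Lx m => meas_JB f p q' w mw k
  clear_value S w H
  exact sum_aux S (fun k x h => w h * Jq p q' (grd f) (Kc (lz k) 1 ∩ Metric.closedBall x (2 * ‖h‖))) _ step1 mJ fin1

lemma small_set1 {α : Type*} [MeasurableSpace α] (μ : Measure α) [SFinite μ] {m : ℕ} [IsFiniteMeasure μ] (φ : α × Spc m → ℝ≥0∞) (hφ : Measurable φ)
    (hfin : ∫⁻ x, ∫⁻ h in Metric.ball (0 : Spc m) 1, φ (x, h) ∂volume ∂μ < ⊤) (η : ℝ≥0∞) (hη : 0 < η) :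
    ∃ ε : ℝ, 0 < ε ∧ ε ≤ 1 ∧ ∫⁻ x, ∫⁻ h in Metric.ball (0 : Spc m) ε, φ (x, h) ∂volume ∂μ < η := by
  set ν : Measure (α × Spc m) := μ.prod (volume.restrict (Metric.ball (0 : Spc m) 1)) with hν
  have h0 : ∫⁻ z, φ z ∂ν ≠ ⊤ := by
    rw [hν, lintegral_prod _ hφ.aemeasurable]; exact hfin.ne
  set e : ℕ → ℝ := fun j => 1 / ((j:ℝ) + 1) with he
  have ht : Tendsto (ν ∘ fun j : ℕ => (univ : Set α) ×ˢ Metric.ball (0 : Spc m) (e j)) atTop (nhds 0) := by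
    have hb : ∀ j : ℕ, (ν ∘ fun j : ℕ => (univ : Set α) ×ˢ Metric.ball (0 : Spc m) (e j)) j ≤ μ univ * ENNReal.ofReal ((2 * e j) ^ (m+1)) := by
      intro j
      simp only [Function.comp, hν, Measure.prod_prod]
      refine mul_le_mul_right ((Measure.restrict_apply_le _ _).trans ?_) _
      rw [← cball_eq (0 : Spc m) (by simp only [he]; positivity)]
      exact measure_mono Metric.ball_subset_closedBall
    have hl : Tendsto (fun j : ℕ => μ univ * ENNReal.ofReal ((2 * e j) ^ (m+1))) atTop (nhds 0) := by
      have h1 : Tendsto (fun j : ℕ => (2 * e j) ^ (m+1)) atTop (nhds 0) := by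
        have := ((tendsto_one_div_add_atTop_nhds_zero_nat (𝕜 := ℝ)).const_mul 2).pow (m+1)
        simpa [he] using this
      have h2 := ENNReal.tendsto_ofReal h1
      have h3 := ENNReal.Tendsto.const_mul (a := μ univ) h2 (Or.inr (measure_ne_top _ _))
      simpa using h3
    exact tendsto_of_tendsto_of_tendsto_of_le_of_le tendsto_const_nhds hl (fun _ => zero_le) hb
  have h1 := tendsto_setLIntegral_zero h0 ht
  obtain ⟨j, hj⟩ := (h1.eventually (gt_mem_nhds hη)).exists
  have he0 : 0 < e j := by simp only [he]; positivity
  have he1 : e j ≤ 1 := by simp only [he]; rw [div_le_one (by positivity)]; linarith [Nat.cast_nonneg (α := ℝ) j]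
  refine ⟨e j, he0, he1, ?_⟩
  have e2 : ν.restrict ((univ : Set α) ×ˢ Metric.ball (0 : Spc m) (e j)) = μ.prod (volume.restrict (Metric.ball (0 : Spc m) (e j))) := by
    rw [hν, ← Measure.prod_restrict, Measure.restrict_univ, Measure.restrict_restrict measurableSet_ball,
      inter_eq_left.2 (Metric.ball_subset_ball he1)]
  rw [e2, lintegral_prod _ hφ.aemeasurable] at hj
  exact hj

section
variable {m : ℕ} {W : Type*} [NormedAddCommGroup W] [NormedSpace ℝ W] [CompleteSpace W] [MeasurableSpace W] [BorelSpace W]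
    [SecondCountableTopology W]

lemma meas_PNi (p q : ℝ) {g : Spc m → W} (hg : Measurable g) :
    Measurable (fun z : Spc m × Spc m => Hk p q g z.1 (z.1 + z.2)) := by
  unfold Hk; fun_prop

lemma finK (a : Spc m) : IsFiniteMeasure (volume.restrict (Kc a 1)) := ⟨by rw [Measure.restrict_apply_univ, vol_Kc a zero_le_one]; simp⟩

lemma PN_small (p q : ℝ) {g : Spc m → W} (hg : Measurable g) (hfin : PN p q 1 g < ⊤) (η : ℝ≥0∞) (hη : 0 < η) :
    ∃ ε : ℝ, 0 < ε ∧ ε ≤ 1 ∧ PN p q ε g < η := by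
  have := finK (0 : Spc m)
  exact small_set1 (volume.restrict (Kc (0 : Spc m) 1)) (fun z => Hk p q g z.1 (z.1 + z.2)) (meas_PNi p q hg) hfin η hη

lemma PN_mono (p q : ℝ) (g : Spc m → W) {ε ε' : ℝ} (h : ε ≤ ε') : PN p q ε g ≤ PN p q ε' g :=
  lintegral_mono fun x => lintegral_mono_set (Metric.ball_subset_ball h)


lemma PN_per (p q ε : ℝ) {g : Spc m → W} (hg : Per g) : Per (fun x => ∫⁻ h in Metric.ball (0 : Spc m) ε, Hk p q g x (x + h)) := by
  intro x k
  refine lintegral_congr fun h => ?_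
  simp only [Hk]
  rw [add_right_comm, hg, hg, add_sub_add_right_eq_sub]
end

lemma lint_cover {m : ℕ} (φ : Spc m → ℝ≥0∞) (hφ : Per φ) (a : Spc m) :
    ∫⁻ x in Kc a 1, φ x ≤ (SL m).card * ∫⁻ x in Kc 0 1, φ x := by
  have h1 := lint_shift φ (a - lz (fl a)) (lz (fl a)) 1
  rw [sub_add_cancel] at h1
  rw [h1]
  simp_rw [hφ _ (fl a)]
  have ha := mem_Kc_fl a
  rw [mem_Kc] at ha
  have hsub : Kc (a - lz (fl a)) 1 ⊆ ⋃ k : {k // k ∈ SL m}, Kc (lz k.1) 1 := by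
    intro x hx
    rw [mem_Kc] at hx
    simp only [Prod.fst_sub, Prod.snd_sub, Pi.sub_apply] at hx
    simp only [mem_iUnion]
    refine ⟨⟨fl x, fl_mem x ?_⟩, mem_Kc_fl x⟩
    exact ⟨⟨by linarith [hx.1.1, ha.1.1], by linarith [hx.1.2, ha.1.2]⟩, fun i => ⟨by linarith [(hx.2 i).1, (ha.2 i).1], by linarith [(hx.2 i).2, (ha.2 i).2]⟩⟩
  refine (lintegral_mono_set hsub).trans ?_
  refine (lintegral_iUnion_le _ _).trans ?_
  simp_rw [lint_per φ hφ]
  rw [tsum_fintype]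
  simp

section
variable {m : ℕ} {W : Type*} [NormedAddCommGroup W] [NormedSpace ℝ W] [CompleteSpace W] [MeasurableSpace W] [BorelSpace W]
    [SecondCountableTopology W]

lemma PN_shift (p q ε : ℝ) {g : Spc m → W} (hg : Per g) (z : Spc m) :
    PN p q ε (fun x => g (x - z)) ≤ (SL m).card * PN p q ε g := by
  refine le_trans (le_of_eq ?_) (lint_cover _ (PN_per p q ε hg) (-z))
  have := lint_shift (fun x => ∫⁻ h in Metric.ball (0 : Spc m) ε, Hk p q g x (x + h)) 0 (-z) 1
  rw [zero_add] at this
  rw [this]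
  refine lintegral_congr fun x => lintegral_congr fun h => ?_
  simp only [Hk]
  rw [show x + -z + h = x + h - z by abel, show x + -z - (x + h - z) = x - (x + h) by abel, ← sub_eq_add_neg]

lemma Hk_le_add {p q : ℝ} (hp : 0 < p) (g1 g2 : Spc m → W) (x y : Spc m) :
    Hk p q (fun x => g1 x + g2 x) x y ≤ ENNReal.ofReal (2 ^ p) * (Hk p q g1 x y + Hk p q g2 x y) := by
  simp only [Hk]
  rw [← ENNReal.ofReal_add (by positivity) (by positivity), ← ENNReal.ofReal_mul (by positivity)]
  apply ENNReal.ofReal_le_ofReal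
  rw [← add_div, mul_div_assoc']
  gcongr
  have h3 : ‖g1 x + g2 x - (g1 y + g2 y)‖ ≤ ‖g1 x - g1 y‖ + ‖g2 x - g2 y‖ := by
    rw [add_sub_add_comm]; exact norm_add_le _ _
  set A := ‖g1 x - g1 y‖
  set B := ‖g2 x - g2 y‖
  have hA : 0 ≤ A := norm_nonneg _
  have hB : 0 ≤ B := norm_nonneg _
  calc _ ≤ (2 * max A B) ^ p := Real.rpow_le_rpow (norm_nonneg _) (by linarith [le_max_left A B, le_max_right A B]) hp.le
    _ = 2 ^ p * (max A B) ^ p := Real.mul_rpow (by norm_num) (le_max_of_le_left hA)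
    _ ≤ _ := by
      gcongr
      rcases max_cases A B with h | h <;> rw [h.1]
      · linarith [Real.rpow_nonneg hB p]
      · linarith [Real.rpow_nonneg hA p]

lemma PN_add {p q : ℝ} (hp : 0 < p) (ε : ℝ) {g1 g2 : Spc m → W} (h1 : Measurable g1) (h2 : Measurable g2) :
    PN p q ε (fun x => g1 x + g2 x) ≤ ENNReal.ofReal (2 ^ p) * (PN p q ε g1 + PN p q ε g2) := by
  unfold PN
  have m1 := meas_PNi p q h1
  have hs : ∀ x : Spc m, Measurable fun h : Spc m => Hk p q g1 x (x + h) := fun x => by unfold Hk; fun_prop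
  have hs' : Measurable fun x : Spc m => ∫⁻ h in Metric.ball (0 : Spc m) ε, Hk p q g1 x (x + h) := by
    exact Measurable.lintegral_prod_right' (f := fun z : Spc m × Spc m => Hk p q g1 z.1 (z.1 + z.2)) m1
  rw [← lintegral_add_left hs', ← lintegral_const_mul' _ _ ENNReal.ofReal_ne_top]
  refine lintegral_mono fun x => ?_
  rw [← lintegral_add_left (hs x), ← lintegral_const_mul' _ _ ENNReal.ofReal_ne_top]
  exact lintegral_mono fun h => Hk_le_add hp _ _ _ _

lemma PN_neg (p q ε : ℝ) (g : Spc m → W) : PN p q ε (fun x => - g x) = PN p q ε g := by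
  unfold PN Hk
  have e : ∀ a b : W, ‖-a - -b‖ = ‖a - b‖ := fun a b => by rw [neg_sub_neg, norm_sub_rev]
  simp_rw [e]

lemma Jq_le {p q : ℝ} (hp : 0 < p) (hq : 0 ≤ q) {ε S : ℝ} (hε : 0 < ε) (hS : 0 ≤ S) {g : Spc m → W} (hg : Measurable g) (hb : ∀ x, ‖g x‖ ≤ S) :
    Jq p q g (Kc 0 1) ≤ PN p q ε g + ENNReal.ofReal ((2 * S) ^ p * ε ^ (-q)) := by
  have := finK (0 : Spc m)
  have hv : (volume : Measure (Spc m)).restrict (Kc 0 1) univ = 1 := by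
    rw [Measure.restrict_apply_univ, vol_Kc _ zero_le_one]; simp
  have key : ∀ x : Spc m, ∫⁻ y in Kc 0 1, Hk p q g x y ≤ (∫⁻ h in Metric.ball (0 : Spc m) ε, Hk p q g x (x + h)) + ENNReal.ofReal ((2 * S) ^ p * ε ^ (-q)) := by
    intro x
    have h1 : ∀ y : Spc m, Hk p q g x y ≤ (Metric.ball x ε).indicator (fun y => Hk p q g x y) y + ENNReal.ofReal ((2 * S) ^ p * ε ^ (-q)) := by
      intro y
      by_cases hy : y ∈ Metric.ball x ε
      · rw [indicator_of_mem hy]; exact le_self_add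
      · rw [indicator_of_notMem hy, zero_add]
        rw [Metric.mem_ball, dist_eq_norm, norm_sub_rev, not_lt] at hy
        unfold Hk
        apply ENNReal.ofReal_le_ofReal
        rw [Real.rpow_neg hε.le, ← div_eq_mul_inv]
        have : ‖g x - g y‖ ≤ 2 * S := (norm_sub_le _ _).trans (by linarith [hb x, hb y])
        gcongr
    have hm : Measurable fun y : Spc m => Hk p q g x y := by unfold Hk; fun_prop
    refine (lintegral_mono h1).trans ?_
    rw [lintegral_add_right _ measurable_const, lintegral_const, hv, mul_one]
    refine add_le_add ?_ le_rfl
    refine (setLIntegral_le_lintegral _ _).trans (le_of_eq ?_)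
    rw [← lintegral_add_left_eq_self (μ := (volume : Measure (Spc m))) _ x, ← lintegral_indicator measurableSet_ball]
    refine lintegral_congr fun h => ?_
    simp only [indicator, Metric.mem_ball, dist_eq_norm, add_sub_cancel_left, sub_zero]
  unfold Jq PN
  refine (lintegral_mono key).trans ?_
  rw [lintegral_add_right _ measurable_const, lintegral_const, hv, mul_one]

lemma PN_holder {p q α A : ℝ} (hp : 0 < p) (hα : q - α * p < m + 1) (hA : 0 ≤ A) (η : ℝ≥0∞) (hη : 0 < η) :
    ∃ ε : ℝ, 0 < ε ∧ ε ≤ 1 ∧ ∀ g : Spc m → W, (∀ x y, ‖x - y‖ < 1 → ‖g x - g y‖ ≤ A * ‖x - y‖ ^ α) → PN p q ε g < η := by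
  have := finK (0 : Spc m)
  set φ : Spc m × Spc m → ℝ≥0∞ := fun z => ENNReal.ofReal (A ^ p * ‖z.2‖ ^ (-(q - α * p))) with hφ
  have hm : Measurable φ := ENNReal.measurable_ofReal.comp (((Measurable.pow_const measurable_norm _).comp measurable_snd).const_mul _)
  obtain ⟨ε, h0, h1, h2⟩ := small_set1 (volume.restrict (Kc (0 : Spc m) 1)) φ hm (by
    simp only [hφ]
    rw [lintegral_const]
    refine ENNReal.mul_lt_top ?_ (measure_lt_top _ _)
    have := ((near_int m (r := 1) hα).const_mul (A ^ p)).lintegral_lt_top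
    exact this) η hη
  refine ⟨ε, h0, h1, fun g hg => lt_of_le_of_lt ?_ h2⟩
  unfold PN
  refine lintegral_mono fun x => setLIntegral_mono' measurableSet_ball fun h hh => ?_
  rw [mem_ball_zero_iff] at hh
  simp only [Hk, hφ]
  apply ENNReal.ofReal_le_ofReal
  have e : ‖x - (x + h)‖ = ‖h‖ := by rw [sub_add_cancel_left, norm_neg]
  have h3 := hg x (x + h) (by rw [e]; linarith)
  rw [e] at h3 ⊢
  by_cases hz : h = 0
  · simp [hz, hp.ne']; positivity
  have hr : 0 < ‖h‖ := norm_pos_iff.2 hz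
  rw [div_le_iff₀ (by positivity), mul_assoc, ← Real.rpow_add hr]
  have := Real.rpow_le_rpow (norm_nonneg _) h3 hp.le
  rw [Real.mul_rpow hA (by positivity), ← Real.rpow_mul hr.le] at this
  have e2 : -(q - α * p) + q = α * p := by ring
  rw [e2]; exact this

lemma PN_jensen {p q : ℝ} (hp : 1 ≤ p) (ε : ℝ) {g : Spc m → W} (hg : Per g) (hm : Measurable g) (S : ℝ) (hS : ∀ x, ‖g x‖ ≤ S)
    (γ : Measure (Spc m)) [IsProbabilityMeasure γ] (lam : ℝ) :
    PN p q ε (fun x => ∫ w, g (x - lam • w) ∂γ) ≤ (SL m).card * PN p q ε g := by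
  have hp0 : 0 < p := by linarith
  have hint : ∀ x, Integrable (fun w => g (x - lam • w)) γ := fun x => by
    refine Integrable.mono' (integrable_const S) ?_ (ae_of_all _ fun w => hS _)
    have : Measurable fun w => g (x - lam • w) := by fun_prop
    exact this.aestronglyMeasurable
  have pt : ∀ x y, Hk p q (fun x => ∫ w, g (x - lam • w) ∂γ) x y ≤ ∫⁻ w, Hk p q (fun x => g (x - lam • w)) x y ∂γ := by
    intro x y
    simp only [Hk]
    rw [← integral_sub (hint x) (hint y)]
    have h1 := enorm_integral_le_lintegral_enorm (μ := γ) (fun w => g (x - lam • w) - g (y - lam • w))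
    have hm2 : Measurable fun w => g (x - lam • w) - g (y - lam • w) := by fun_prop
    have h2 := (ENNReal.rpow_le_rpow h1 hp0.le).trans (jensen γ p hp _ hm2.enorm.aemeasurable)
    have e : ∀ v : W, ENNReal.ofReal (‖v‖ ^ p / ‖x - y‖ ^ q) = ENNReal.ofReal ((‖x - y‖ ^ q)⁻¹) * ‖v‖ₑ ^ p := by
      intro v
      rw [← ofReal_norm, ENNReal.ofReal_rpow_of_nonneg (norm_nonneg _) hp0.le, ← ENNReal.ofReal_mul (by positivity), div_eq_inv_mul]
    simp_rw [e]
    rw [lintegral_const_mul' _ _ ENNReal.ofReal_ne_top]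
    exact mul_le_mul_right h2 _
  have mj : Measurable fun z : (Spc m × Spc m) × Spc m => Hk p q (fun x => g (x - lam • z.2)) z.1.1 (z.1.1 + z.1.2) := by
    unfold Hk; fun_prop
  calc _ ≤ ∫⁻ x in Kc 0 1, ∫⁻ h in Metric.ball (0 : Spc m) ε, ∫⁻ w, Hk p q (fun x => g (x - lam • w)) x (x + h) ∂γ :=
        lintegral_mono fun x => lintegral_mono fun h => pt _ _
    _ = ∫⁻ x in Kc 0 1, ∫⁻ w, ∫⁻ h in Metric.ball (0 : Spc m) ε, Hk p q (fun x => g (x - lam • w)) x (x + h) ∂volume ∂γ := by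
        refine lintegral_congr fun x => ?_
        rw [lintegral_lintegral_swap]
        refine Measurable.aemeasurable ?_
        simp only [Function.uncurry_def]
        unfold Hk; fun_prop
    _ = ∫⁻ w, ∫⁻ x in Kc 0 1, ∫⁻ h in Metric.ball (0 : Spc m) ε, Hk p q (fun x => g (x - lam • w)) x (x + h) ∂volume ∂volume ∂γ := by
        rw [lintegral_lintegral_swap]
        refine Measurable.aemeasurable ?_
        simp only [Function.uncurry_def]
        refine Measurable.lintegral_prod_right' (f := fun y : (Spc m × Spc m) × Spc m => Hk p q (fun x => g (x - lam • y.1.2)) y.1.1 (y.1.1 + y.2)) ?_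
        unfold Hk; fun_prop
    _ ≤ ∫⁻ w, (SL m).card * PN p q ε g ∂γ := lintegral_mono fun w => PN_shift p q ε hg (lam • w)
    _ = _ := by simp
end

section gauss
variable {m : ℕ}

def pri (m : ℕ) (i : Fin m) : Du m := (ContinuousLinearMap.proj i).comp (ContinuousLinearMap.snd ℝ ℝ (Fin m → ℝ))
def prf (m : ℕ) : Du m := ContinuousLinearMap.fst ℝ ℝ (Fin m → ℝ)
def Bq (m : ℕ) : Spc m →L[ℝ] Du m :=
  (2 : ℝ) • ((prf m).smulRight (prf m) + ∑ i, (pri m i).smulRight (pri m i))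

lemma fd_sq (L : Du m) (w : Spc m) : HasFDerivAt (fun z => L z ^ 2) ((2 : ℝ) • (L w • L)) w := by
  have := (L.hasFDerivAt (x := w)).pow 2
  refine this.congr_fderiv ?_
  rw [smul_smul]; simp

lemma fd_qd (w : Spc m) : HasFDerivAt (fun z : Spc m => qd z) (Bq m w) w := by
  have h : HasFDerivAt (fun z : Spc m => prf m z ^ 2 + ∑ i, pri m i z ^ 2) ((2 : ℝ) • (prf m w • prf m) + ∑ i, (2 : ℝ) • (pri m i w • pri m i)) w :=
    (fd_sq _ w).add (HasFDerivAt.fun_sum fun i _ => fd_sq _ w)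
  refine HasFDerivAt.congr_fderiv (f := fun z : Spc m => qd z) h ?_
  simp only [Bq, _root_.smul_apply, _root_.add_apply, ContinuousLinearMap.smulRight_apply, _root_.sum_apply, smul_add, Finset.smul_sum]

def Gs (m : ℕ) (w : Spc m) : ℝ := Real.pi ^ (-((m : ℝ) + 1) / 2) * Real.exp (-qd w)
def G1 (m : ℕ) (w : Spc m) : Du m := -(Gs m w • Bq m w)

lemma Gs_pos (w : Spc m) : 0 < Gs m w := by unfold Gs; positivity

lemma fd_Gs (w : Spc m) : HasFDerivAt (Gs m) (G1 m w) w := by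
  have h := ((fd_qd w).neg.exp).const_mul (Real.pi ^ (-((m : ℝ) + 1) / 2))
  unfold G1
  refine h.congr_fderiv ?_
  simp only [Gs, smul_neg, smul_smul, Pi.neg_apply]

def G2 (m : ℕ) (w k : Spc m) : Du m := -(Gs m w • Bq m k + (G1 m w k) • (Bq m w))

lemma line_d (w k : Spc m) (s : ℝ) : HasDerivAt (fun s : ℝ => w + s • k) k s := by
  simpa using ((hasDerivAt_id s).smul_const k).const_add w

lemma hd_Gs (w k : Spc m) (s : ℝ) : HasDerivAt (fun s : ℝ => Gs m (w + s • k)) (G1 m (w + s • k) k) s :=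
  HasFDerivAt.comp_hasDerivAt (f := fun s : ℝ => w + s • k) (l := Gs m) s (fd_Gs (w + s • k)) (line_d w k s)

lemma hd_G1 (w k : Spc m) (s : ℝ) : HasDerivAt (fun s : ℝ => G1 m (w + s • k)) (G2 m (w + s • k) k) s := by
  have h : HasDerivAt (fun s : ℝ => Bq m (w + s • k)) (Bq m k) s :=
    ((Bq m).hasFDerivAt (x := w + s • k)).comp_hasDerivAt s (line_d w k s)
  exact ((hd_Gs w k s).smul h).neg

lemma cont_Gs : Continuous (Gs m) := continuous_iff_continuousAt.2 fun w => (fd_Gs w).continuousAt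
lemma cont_G1 : Continuous (G1 m) := by
  have h := (cont_Gs (m := m)).smul (Bq m).continuous
  exact h.neg
lemma cont_G2 (k : Spc m) : Continuous fun w => G2 m w k := by
  have h := (cont_Gs (m := m))
  have h1 : Continuous fun w => G1 m w k := (ContinuousLinearMap.apply ℝ ℝ k).continuous.comp cont_G1
  have h2 := (Bq m).continuous
  exact ((h.smul continuous_const).add (h1.smul h2)).neg

lemma int_exp (b : ℝ) (hb : 0 < b) : Integrable (fun w : Spc m => Real.exp (-b * qd w)) ∧ ∫ w : Spc m, Real.exp (-b * qd w) = √(Real.pi / b) ^ (m + 1) := by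
  have h1 : Integrable fun x : ℝ => Real.exp (-b * x ^ 2) := integrable_exp_neg_mul_sq hb
  have h2 : Integrable (fun y : Fin m → ℝ => ∏ i, Real.exp (-b * y i ^ 2)) := by
    exact Integrable.fintype_prod (f := fun _ x => Real.exp (-b * x ^ 2)) (μ := fun _ : Fin m => volume) fun _ => h1
  have e : ∀ w : Spc m, Real.exp (-b * qd w) = Real.exp (-b * w.1 ^ 2) * ∏ i, Real.exp (-b * w.2 i ^ 2) := by
    intro w
    rw [← Real.exp_sum, ← Real.exp_add, qd, mul_add, Finset.mul_sum]
  simp_rw [e]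
  refine ⟨h1.mul_prod h2, ?_⟩
  rw [Measure.volume_eq_prod, integral_prod_mul (fun x : ℝ => Real.exp (-b * x ^ 2)) (fun y : Fin m → ℝ => ∏ i, Real.exp (-b * y i ^ 2)), integral_gaussian]
  have := integral_fintype_prod_volume_eq_prod (ι := Fin m) (f := fun _ (x : ℝ) => Real.exp (-b * x ^ 2))
  rw [this]
  rw [Finset.prod_const, integral_gaussian, Finset.card_univ, Fintype.card_fin, pow_succ, mul_comm]

lemma int_Gs : Integrable (Gs m) := by
  have := (int_exp (m := m) 1 one_pos).1.const_mul (Real.pi ^ (-((m : ℝ) + 1) / 2))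
  simp only [neg_mul, one_mul] at this
  exact this

lemma integral_Gs : ∫ w, Gs m w = 1 := by
  have := (int_exp (m := m) 1 one_pos).2
  simp only [Gs]
  rw [integral_const_mul]
  simp only [neg_mul, one_mul, div_one] at this
  rw [this, Real.sqrt_eq_rpow, ← Real.rpow_natCast, ← Real.rpow_mul Real.pi_pos.le, ← Real.rpow_add Real.pi_pos]
  push_cast
  have : -((m : ℝ) + 1) / 2 + 1 / 2 * (m + 1) = 0 := by ring
  rw [this, Real.rpow_zero]

lemma nsq_le (w : Spc m) : ‖w‖ ^ 2 ≤ qd w := by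
  have h0 : 0 ≤ qd w := by unfold qd; positivity
  have : ‖w‖ ≤ √(qd w) := by
    rw [nrm_le (Real.sqrt_nonneg _)]
    have hs : 0 ≤ ∑ i, w.2 i ^ 2 := by positivity
    refine ⟨Real.abs_le_sqrt (by unfold qd; linarith), fun i => Real.abs_le_sqrt ?_⟩
    have := Finset.single_le_sum (f := fun i => w.2 i ^ 2) (fun i _ => sq_nonneg _) (Finset.mem_univ i)
    unfold qd
    have := sq_nonneg w.1
    linarith
  calc ‖w‖ ^ 2 ≤ √(qd w) ^ 2 := by gcongr
    _ = _ := Real.sq_sqrt h0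

lemma G1_le (w : Spc m) : ‖G1 m w‖ ≤ Real.pi ^ (-((m : ℝ) + 1) / 2) * ‖Bq m‖ * Real.exp (-(1/2) * qd w) := by
  have hq := nsq_le w
  have h1 : ‖G1 m w‖ ≤ Gs m w * (‖Bq m‖ * ‖w‖) := by
    rw [G1, norm_neg, norm_smul, Real.norm_of_nonneg (Gs_pos w).le]
    gcongr
    · exact (Gs_pos w).le
    · exact (Bq m).le_opNorm w
  have h2 : ‖w‖ ≤ Real.exp (qd w / 2) := by
    have := Real.add_one_le_exp (qd w / 2)
    nlinarith [sq_nonneg (‖w‖ - 1)]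
  have e : Real.exp (-(1/2) * qd w) = Real.exp (-qd w) * Real.exp (qd w / 2) := by rw [← Real.exp_add]; ring_nf
  have hp : 0 < Real.pi ^ (-((m : ℝ) + 1) / 2) := by positivity
  rw [e]
  calc _ ≤ _ := h1
    _ ≤ Gs m w * (‖Bq m‖ * Real.exp (qd w / 2)) := by have := (Gs_pos w).le; gcongr
    _ = _ := by unfold Gs; ring

def b2 (m : ℕ) (w : Spc m) : ℝ := Real.pi ^ (-((m : ℝ) + 1) / 2) * (‖Bq m‖ + 2 * ‖Bq m‖ ^ 2) * Real.exp (-(1/2) * qd w)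

lemma G2_le (w k : Spc m) : ‖G2 m w k‖ ≤ b2 m w * ‖k‖ := by
  have hq := nsq_le w
  have hg := (Gs_pos w).le
  have h1 : ‖G1 m w‖ ≤ Gs m w * (‖Bq m‖ * ‖w‖) := by
    rw [G1, norm_neg, norm_smul, Real.norm_of_nonneg (Gs_pos w).le]
    gcongr
    exact (Bq m).le_opNorm w
  have h2 : ‖w‖ ^ 2 ≤ 2 * Real.exp (qd w / 2) := by
    have := Real.add_one_le_exp (qd w / 2)
    nlinarith
  have h3 : 1 ≤ Real.exp (qd w / 2) := Real.one_le_exp (by nlinarith [sq_nonneg ‖w‖])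
  have e : Real.exp (-(1/2) * qd w) = Real.exp (-qd w) * Real.exp (qd w / 2) := by rw [← Real.exp_add]; ring_nf
  have hp : 0 < Real.pi ^ (-((m : ℝ) + 1) / 2) := by positivity
  rw [b2, e, G2, norm_neg]
  calc _ ≤ Gs m w * ‖Bq m k‖ + (‖G1 m w‖ * ‖k‖) * ‖Bq m w‖ := by
        refine (norm_add_le _ _).trans ?_
        rw [norm_smul, Real.norm_of_nonneg hg, norm_smul]
        gcongr
        exact (G1 m w).le_opNorm k
    _ ≤ Gs m w * (‖Bq m‖ * ‖k‖) + (Gs m w * (‖Bq m‖ * ‖w‖) * ‖k‖) * (‖Bq m‖ * ‖w‖) := by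
        gcongr
        · exact (Bq m).le_opNorm k
        · exact (Bq m).le_opNorm w
    _ = Gs m w * (‖Bq m‖ * 1 + ‖Bq m‖ ^ 2 * ‖w‖ ^ 2) * ‖k‖ := by ring
    _ ≤ Gs m w * (‖Bq m‖ * Real.exp (qd w / 2) + ‖Bq m‖ ^ 2 * (2 * Real.exp (qd w / 2))) * ‖k‖ := by gcongr
    _ = _ := by unfold Gs; ring

lemma int_b2 : Integrable (b2 m) := (int_exp (m := m) (1/2) (by norm_num)).1.const_mul _
lemma cont_qd : Continuous (qd (m := m)) := continuous_iff_continuousAt.2 fun w => (fd_qd w).continuousAt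
lemma cont_b2 : Continuous (b2 m) := by
  have := cont_qd (m := m)
  unfold b2; fun_prop

lemma int_G1 : Integrable (G1 m) :=
  ((int_exp (m := m) (1/2) (by norm_num)).1.const_mul _).mono' cont_G1.aestronglyMeasurable (ae_of_all _ G1_le)

end gauss

section gauss2
variable {m : ℕ} {W : Type*} [NormedAddCommGroup W] [NormedSpace ℝ W] [CompleteSpace W]

lemma avg_bd {r : Spc m → ℝ≥0∞} (ρ : Spc m → ℝ → ℝ≥0∞) (hm : Measurable (Function.uncurry ρ)) {B : ℝ≥0∞}
    (hr : ∀ w, r w ≤ ∫⁻ s in Ioc (0:ℝ) 1, ρ w s) (hB : ∀ s ∈ Ioc (0:ℝ) 1, ∫⁻ w, ρ w s ≤ B) : ∫⁻ w, r w ≤ B := by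
  calc _ ≤ ∫⁻ w, ∫⁻ s in Ioc (0:ℝ) 1, ρ w s := lintegral_mono hr
    _ = ∫⁻ s in Ioc (0:ℝ) 1, ∫⁻ w, ρ w s := lintegral_lintegral_swap hm.aemeasurable
    _ ≤ ∫⁻ s in Ioc (0:ℝ) 1, B := setLIntegral_mono' measurableSet_Ioc hB
    _ = B := by simp

lemma ftc_bd (h h' : ℝ → W) (hd : ∀ s, HasDerivAt h (h' s) s) (hc : Continuous h') :
    ‖h 1 - h 0‖ₑ ≤ ∫⁻ s in Ioc (0:ℝ) 1, ‖h' s‖ₑ := by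
  rw [← intervalIntegral.integral_eq_sub_of_hasDerivAt (fun s _ => hd s) (hc.intervalIntegrable _ _), intervalIntegral.integral_of_le zero_le_one]
  exact enorm_integral_le_lintegral_enorm _

def I1 (m : ℕ) : ℝ := ∫ w, ‖G1 m w‖
def I2 (m : ℕ) : ℝ := ∫ w, b2 m w

lemma b2_nn (w : Spc m) : 0 ≤ b2 m w := by unfold b2; positivity
lemma I1_nn : 0 ≤ I1 m := integral_nonneg fun _ => norm_nonneg _
lemma I2_nn : 0 ≤ I2 m := integral_nonneg fun _ => b2_nn _

lemma lint_G1 : ∫⁻ w, ‖G1 m w‖ₑ = ENNReal.ofReal (I1 m) := by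
  rw [I1, ofReal_integral_norm_eq_lintegral_enorm int_G1]

lemma K2a (k : Spc m) : ∫⁻ w, ‖G1 m (w + k) - G1 m w‖ₑ ≤ ENNReal.ofReal (I2 m * ‖k‖) := by
  have c2 := cont_b2 (m := m)
  refine avg_bd (fun w s => ENNReal.ofReal (b2 m (w + s • k) * ‖k‖)) ?_ ?_ ?_
  · have : Continuous fun z : Spc m × ℝ => ENNReal.ofReal (b2 m (z.1 + z.2 • k) * ‖k‖) := ENNReal.continuous_ofReal.comp (by fun_prop)
    exact this.measurable
  · intro w
    have h := ftc_bd (fun s => G1 m (w + s • k)) (fun s => G2 m (w + s • k) k) (hd_G1 w k) ((cont_G2 k).comp (by fun_prop))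
    simp only [one_smul, zero_smul, add_zero] at h
    refine h.trans (lintegral_mono fun s => ?_)
    rw [← ofReal_norm]
    exact ENNReal.ofReal_le_ofReal (G2_le _ _)
  · intro s _
    rw [lintegral_add_right_eq_self (fun w => ENNReal.ofReal (b2 m w * ‖k‖)) (s • k), ← ofReal_integral_eq_lintegral_ofReal (int_b2.mul_const _) (ae_of_all _ fun w => mul_nonneg (b2_nn w) (norm_nonneg k)), integral_mul_const, I2]

lemma K2b (k : Spc m) : ∫⁻ w, ‖G1 m (w + k) - G1 m w‖ₑ ≤ ENNReal.ofReal (2 * I1 m) := by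
  have hm : Measurable fun w => ‖G1 m w‖ₑ := cont_G1.enorm.measurable
  calc _ ≤ ∫⁻ w, (‖G1 m (w + k)‖ₑ + ‖G1 m w‖ₑ) := lintegral_mono fun w => enorm_sub_le
    _ = _ := by
      rw [lintegral_add_right _ hm, lintegral_add_right_eq_self (fun w => ‖G1 m w‖ₑ) k, lint_G1, ← ENNReal.ofReal_add I1_nn I1_nn, two_mul]

def C2 (m : ℕ) : ℝ := I2 m + 2 * I1 m
lemma C2_nn : 0 ≤ C2 m := by have := I1_nn (m := m); have := I2_nn (m := m); unfold C2; linarith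

lemma K2 {α : ℝ} (h0 : 0 ≤ α) (h1 : α ≤ 1) (k : Spc m) : ∫⁻ w, ‖G1 m (w + k) - G1 m w‖ₑ ≤ ENNReal.ofReal (C2 m * ‖k‖ ^ α) := by
  have i1 := I1_nn (m := m)
  have i2 := I2_nn (m := m)
  have hk := norm_nonneg k
  have hka := Real.rpow_nonneg hk α
  unfold C2
  rcases le_total ‖k‖ 1 with h | h
  · refine (K2a k).trans (ENNReal.ofReal_le_ofReal ?_)
    have : ‖k‖ ≤ ‖k‖ ^ α := by
      rcases hk.eq_or_lt with e | e
      · rw [← e]; positivity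
      · simpa using Real.rpow_le_rpow_of_exponent_ge e h h1
    nlinarith [mul_nonneg i1 hka, mul_le_mul_of_nonneg_left this i2]
  · refine (K2b k).trans (ENNReal.ofReal_le_ofReal ?_)
    have : 1 ≤ ‖k‖ ^ α := Real.one_le_rpow h h0
    nlinarith [mul_nonneg i2 hka, mul_le_mul_of_nonneg_left this i1]

lemma K3 {α : ℝ} (h0 : 0 ≤ α) (h1 : α ≤ 1) (k : Spc m) : ∫⁻ w, ‖Gs m (w + k) - Gs m w - G1 m w k‖ₑ ≤ ENNReal.ofReal (C2 m * ‖k‖ ^ α * ‖k‖) := by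
  have c1 := cont_G1 (m := m)
  refine avg_bd (fun w s => ‖G1 m (w + s • k) - G1 m w‖ₑ * ENNReal.ofReal ‖k‖) ?_ ?_ ?_
  · have : Continuous fun z : Spc m × ℝ => G1 m (z.1 + z.2 • k) - G1 m z.1 := by fun_prop
    exact (this.enorm.measurable).mul_const _
  · intro w
    have h := ftc_bd (fun s => Gs m (w + s • k) - s * G1 m w k) (fun s => G1 m (w + s • k) k - G1 m w k)
      (fun s => (hd_Gs w k s).sub (by simpa using (hasDerivAt_id s).mul_const (G1 m w k)))
      (((ContinuousLinearMap.apply ℝ ℝ k).continuous.comp (c1.comp (by fun_prop : Continuous fun s : ℝ => w + s • k))).sub continuous_const)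
    have e : (Gs m (w + (1:ℝ) • k) - 1 * G1 m w k) - (Gs m (w + (0:ℝ) • k) - 0 * G1 m w k) = Gs m (w + k) - Gs m w - G1 m w k := by
      simp only [one_smul, zero_smul, add_zero]; ring
    rw [e] at h
    refine h.trans (lintegral_mono fun s => ?_)
    have := (G1 m (w + s • k) - G1 m w).le_opNorm k
    rw [← ofReal_norm, ← ofReal_norm, ← ENNReal.ofReal_mul (norm_nonneg _)]
    exact ENNReal.ofReal_le_ofReal this
  · intro s hs
    rw [lintegral_mul_const' _ _ ENNReal.ofReal_ne_top]
    have hk := norm_nonneg k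
    rw [ENNReal.ofReal_mul (mul_nonneg C2_nn (by positivity))]
    gcongr
    refine (K2 h0 h1 _).trans (ENNReal.ofReal_le_ofReal ?_)
    have := C2_nn (m := m)
    gcongr
    rw [norm_smul, Real.norm_of_nonneg hs.1.le]
    nlinarith [hs.2]

lemma nb_of_lint {X : Type*} [MeasurableSpace X] {μ : Measure X} {V : Type*} [NormedAddCommGroup V] [NormedSpace ℝ V] (f : X → V) (k : X → W)
    {A B : ℝ} (hA : 0 ≤ A) (hB : 0 ≤ B) (h : ∀ w, ‖f w‖ ≤ A * ‖k w‖) (hk : ∫⁻ w, ‖k w‖ₑ ∂μ ≤ ENNReal.ofReal B) : ‖∫ w, f w ∂μ‖ ≤ A * B := by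
  have h1 : ‖∫ w, f w ∂μ‖ₑ ≤ ENNReal.ofReal (A * B) := by
    refine (enorm_integral_le_lintegral_enorm _).trans ?_
    calc _ ≤ ∫⁻ w, ENNReal.ofReal A * ‖k w‖ₑ ∂μ := lintegral_mono fun w => by
          rw [← ofReal_norm, ← ofReal_norm, ← ENNReal.ofReal_mul hA]; exact ENNReal.ofReal_le_ofReal (h w)
      _ ≤ _ := by
        rw [lintegral_const_mul' _ _ ENNReal.ofReal_ne_top, ENNReal.ofReal_mul hA]; gcongr
  rw [← ofReal_norm] at h1
  exact (ENNReal.ofReal_le_ofReal_iff (mul_nonneg hA hB)).1 h1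

end gauss2

section top
variable {m : ℕ} {W : Type*} [NormedAddCommGroup W] [NormedSpace ℝ W] [CompleteSpace W] [SecondCountableTopology W]

def lamb (β τ : ℝ) : ℝ := 2 * √(τ / β)

lemma cont_lamb (β : ℝ) : Continuous (lamb β) := by unfold lamb; fun_prop

def Inn (β : ℝ) (k : Spc m → W) (F : ℝ → Spc m → ℝ) (t θ : ℝ) (x : Spc m) : W :=
  ∫ w, F (t * (1 - θ)) (x - lamb β (t * θ) • w) • k w

def TO (β : ℝ) (om : ℝ → ℝ) (k : Spc m → W) (F : ℝ → Spc m → ℝ) (t : ℝ) (x : Spc m) : W :=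
  ∫ θ in Ioc (0:ℝ) 1, om θ • Inn β k F t θ x

structure BC (F : ℝ → Spc m → ℝ) (B : ℝ) : Prop where
  c : Continuous fun z : ℝ × Spc m => F z.1 z.2
  b : ∀ t x, |F t x| ≤ B

lemma BC.cx {F : ℝ → Spc m → ℝ} {B : ℝ} (h : BC F B) (s : ℝ) : Continuous (F s) := h.c.comp (by fun_prop : Continuous fun x : Spc m => (s, x))

variable {β : ℝ} {k : Spc m → W} {F F' : ℝ → Spc m → ℝ} {B B' : ℝ} {om : ℝ → ℝ}

lemma Inn_integrable (hk : Continuous k) (hki : Integrable k) (hF : BC F B) (s l : ℝ) (x : Spc m) :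
    Integrable fun w => F s (x - l • w) • k w := by
  have := hF.cx s
  refine Integrable.mono' (hki.norm.const_mul B) ?_ (ae_of_all _ fun w => ?_)
  · have : Continuous fun w => F s (x - l • w) • k w := by fun_prop
    exact this.aestronglyMeasurable
  · rw [norm_smul]; exact mul_le_mul_of_nonneg_right (hF.b _ _) (norm_nonneg _)

lemma Inn_cont (hk : Continuous k) (hki : Integrable k) (hF : BC F B) :
    Continuous fun z : ℝ × ℝ × Spc m => Inn β k F z.1 z.2.1 z.2.2 := by
  have hl := cont_lamb β
  have h2 : ∀ w, Continuous fun z : ℝ × ℝ × Spc m => F (z.1 * (1 - z.2.1)) (z.2.2 - lamb β (z.1 * z.2.1) • w) • k w := fun w => by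
    have : Continuous fun z : ℝ × ℝ × Spc m => (z.1 * (1 - z.2.1), z.2.2 - lamb β (z.1 * z.2.1) • w) := by fun_prop
    exact (hF.c.comp this).smul continuous_const
  refine continuous_of_dominated (bound := fun w => B * ‖k w‖) (fun z => (Inn_integrable hk hki hF _ _ _).aestronglyMeasurable) (fun z => ae_of_all _ fun w => ?_) (hki.norm.const_mul B) (ae_of_all _ h2)
  rw [norm_smul]; exact mul_le_mul_of_nonneg_right (hF.b _ _) (norm_nonneg _)

lemma Inn_le (hki : Integrable k) {b t θ : ℝ} (x : Spc m) (hb : ∀ x, |F (t * (1 - θ)) x| ≤ b) : ‖Inn β k F t θ x‖ ≤ b * ∫ w, ‖k w‖ := by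
  rw [← integral_const_mul]
  refine norm_integral_le_of_norm_le (hki.norm.const_mul b) (ae_of_all _ fun w => ?_)
  rw [norm_smul]; exact mul_le_mul_of_nonneg_right (hb _) (norm_nonneg _)

lemma Inn_contθ (hk : Continuous k) (hki : Integrable k) (hF : BC F B) (t : ℝ) (x : Spc m) : Continuous fun θ => Inn β k F t θ x :=
  (Inn_cont hk hki hF).comp (by fun_prop : Continuous fun θ : ℝ => (t, θ, x))

lemma TO_integrable (ho : IntegrableOn om (Ioc 0 1)) (hk : Continuous k) (hki : Integrable k) (hF : BC F B) (t : ℝ) (x : Spc m) :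
    IntegrableOn (fun θ => om θ • Inn β k F t θ x) (Ioc 0 1) := by
  refine Integrable.mono' (ho.norm.mul_const (B * ∫ w, ‖k w‖)) ?_ (ae_of_all _ fun θ => ?_)
  · exact ho.aestronglyMeasurable.smul (Inn_contθ hk hki hF t x).aestronglyMeasurable
  · rw [norm_smul]; exact mul_le_mul_of_nonneg_left (Inn_le hki x (hF.b _)) (norm_nonneg _)

lemma TO_cont (ho : IntegrableOn om (Ioc 0 1)) (hk : Continuous k) (hki : Integrable k) (hF : BC F B) :
    Continuous fun z : ℝ × Spc m => TO β om k F z.1 z.2 := by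
  refine continuous_of_dominated (bound := fun θ => ‖om θ‖ * (B * ∫ w, ‖k w‖)) (fun z => (TO_integrable ho hk hki hF _ _).aestronglyMeasurable) (fun z => ae_of_all _ fun θ => ?_) (ho.norm.mul_const _) (ae_of_all _ fun θ => ?_)
  · rw [norm_smul]; exact mul_le_mul_of_nonneg_left (Inn_le hki _ (hF.b _)) (norm_nonneg _)
  · exact ((Inn_cont hk hki hF).comp (by fun_prop : Continuous fun z : ℝ × Spc m => (z.1, θ, z.2))).const_smul _

lemma TO_le (hki : Integrable k) {b : ℝ → ℝ} {t : ℝ} (x : Spc m) (hb : ∀ θ ∈ Ioc (0:ℝ) 1, ∀ x, |F (t * (1 - θ)) x| ≤ b θ)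
    (hbi : IntegrableOn (fun θ => |om θ| * b θ) (Ioc 0 1)) : ‖TO β om k F t x‖ ≤ (∫ θ in Ioc (0:ℝ) 1, |om θ| * b θ) * ∫ w, ‖k w‖ := by
  rw [← integral_mul_const]
  refine norm_integral_le_of_norm_le (hbi.mul_const _) ?_
  refine (ae_restrict_iff' measurableSet_Ioc).2 (ae_of_all _ fun θ hθ => ?_)
  rw [norm_smul, mul_assoc]; exact mul_le_mul_of_nonneg_left (Inn_le hki x (hb θ hθ)) (norm_nonneg _)

lemma TO_sub (ho : IntegrableOn om (Ioc 0 1)) (hk : Continuous k) (hki : Integrable k) (hF : BC F B) (hF' : BC F' B') (t : ℝ) (x : Spc m) :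
    TO β om k F t x - TO β om k F' t x = TO β om k (fun s y => F s y - F' s y) t x := by
  unfold TO
  rw [← integral_sub (TO_integrable ho hk hki hF t x) (TO_integrable ho hk hki hF' t x)]
  refine integral_congr_ae (ae_of_all _ fun θ => ?_)
  simp only [Inn]
  rw [← smul_sub, ← integral_sub (Inn_integrable hk hki hF _ _ _) (Inn_integrable hk hki hF' _ _ _)]
  simp only [sub_smul]

lemma TO_per (h : ∀ s, Per (F s)) (t : ℝ) : Per (TO β om k F t) := by
  intro x j
  unfold TO Inn
  refine integral_congr_ae (ae_of_all _ fun θ => ?_)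
  simp only
  congr 1
  refine integral_congr_ae (ae_of_all _ fun w => ?_)
  simp only
  rw [add_sub_right_comm, h]

lemma Inn_shift (t θ : ℝ) (x h : Spc m) (hl : lamb β (t * θ) ≠ 0) :
    Inn β k F t θ (x + h) = ∫ w, F (t * (1 - θ)) (x - lamb β (t * θ) • w) • k (w + (lamb β (t * θ))⁻¹ • h) := by
  unfold Inn
  rw [← integral_add_right_eq_self _ ((lamb β (t * θ))⁻¹ • h)]
  congr 1; ext w
  congr 2
  rw [smul_add, smul_inv_smul₀ hl]; abel

lemma Inn_hold (hk : Continuous k) (hki : Integrable k) (hF : BC F B) (hB0 : 0 ≤ B) {C α : ℝ} (hC : 0 ≤ C) (h : Spc m) (t θ : ℝ) (x : Spc m)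
    (hl : 0 < lamb β (t * θ)) (hK : ∀ k' : Spc m, ∫⁻ w, ‖k (w + k') - k w‖ₑ ≤ ENNReal.ofReal (C * ‖k'‖ ^ α)) :
    ‖Inn β k F t θ (x + h) - Inn β k F t θ x‖ ≤ B * C * ‖h‖ ^ α * lamb β (t * θ) ^ (-α) := by
  rw [Inn_shift t θ x h hl.ne']
  have i1 : Integrable fun w => F (t * (1 - θ)) (x - lamb β (t * θ) • w) • k (w + (lamb β (t * θ))⁻¹ • h) :=
    Inn_integrable (k := fun w => k (w + (lamb β (t * θ))⁻¹ • h)) (by fun_prop) (hki.comp_add_right _) hF _ _ _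
  unfold Inn
  rw [← integral_sub i1 (Inn_integrable hk hki hF _ _ _)]
  refine (nb_of_lint _ (fun w => k (w + (lamb β (t * θ))⁻¹ • h) - k w) hB0 (mul_nonneg hC (by positivity)) (fun w => ?_) (hK _)).trans (le_of_eq ?_)
  · rw [← smul_sub, norm_smul]; exact mul_le_mul_of_nonneg_right (hF.b _ _) (norm_nonneg _)
  · rw [norm_smul, norm_inv, Real.norm_of_nonneg hl.le, Real.mul_rpow (by positivity) (norm_nonneg _), Real.inv_rpow hl.le, Real.rpow_neg hl.le]; ring

end top

section duh
variable {m : ℕ}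

def DU (β : ℝ) (F : ℝ → Spc m → ℝ) (t : ℝ) (x : Spc m) : ℝ := t * TO β (fun _ => 1) (Gs m) F t x
def omh (θ : ℝ) : ℝ := θ ^ (-(1/2) : ℝ)
def DGk {W : Type*} [NormedAddCommGroup W] [NormedSpace ℝ W] (β : ℝ) (k : Spc m → W) (F : ℝ → Spc m → ℝ) (t : ℝ) (x : Spc m) : W := (√(t * β) / 2) • TO β omh k F t x
def DG (β : ℝ) (F : ℝ → Spc m → ℝ) (t : ℝ) (x : Spc m) : Du m := DGk β (G1 m) F t x

lemma int_pw {r : ℝ} (hr : -1 < r) : IntegrableOn (fun θ : ℝ => θ ^ r) (Ioc 0 1) :=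
  (intervalIntegrable_iff_integrableOn_Ioc_of_le zero_le_one).1 (intervalIntegral.intervalIntegrable_rpow' hr)

lemma val_pw {r : ℝ} (hr : -1 < r) : ∫ θ in Ioc (0:ℝ) 1, θ ^ r = 1 / (r + 1) := by
  rw [← intervalIntegral.integral_of_le zero_le_one, integral_rpow (Or.inl hr), Real.one_rpow, Real.zero_rpow (by linarith)]; simp

lemma int_omh : IntegrableOn omh (Ioc 0 1) := int_pw (by norm_num)
lemma int_one : IntegrableOn (fun _ : ℝ => (1:ℝ)) (Ioc 0 1) := by simp

lemma lamb_eq {β τ : ℝ} (hβ : 0 < β) (hτ : 0 < τ) : lamb β τ = (4 / β * τ) ^ (1/2 : ℝ) := by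
  rw [lamb, ← Real.sqrt_eq_rpow, show 4 / β * τ = 2 ^ 2 * (τ / β) by ring, Real.sqrt_mul (by positivity), Real.sqrt_sq (by norm_num)]

lemma lamb_pos {β τ : ℝ} (hβ : 0 < β) (hτ : 0 < τ) : 0 < lamb β τ := by
  unfold lamb; positivity

def cb (β a : ℝ) : ℝ := (4 / β) ^ (-((1 + a) / 2))

lemma lamb_pw {β t θ a : ℝ} (hβ : 0 < β) (ht : 0 < t) (ht1 : t ≤ 1) (hθ : 0 < θ) (ha : a ≤ 1) :
    t * lamb β (t * θ) ^ (-(1 + a)) ≤ cb β a * θ ^ (-((1 + a) / 2)) := by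
  have h4 : 0 < 4 / β := by positivity
  rw [lamb_eq hβ (by positivity), ← Real.rpow_mul (by positivity), show 1/2 * (-(1 + a)) = -((1 + a)/2) by ring, Real.mul_rpow h4.le (by positivity), Real.mul_rpow ht.le hθ.le]
  have : t * t ^ (-((1 + a) / 2)) ≤ 1 := by
    nth_rewrite 1 [← Real.rpow_one t]
    rw [← Real.rpow_add ht]
    exact Real.rpow_le_one ht.le ht1 (by linarith)
  unfold cb
  calc _ = (t * t ^ (-((1 + a) / 2))) * ((4 / β) ^ (-((1 + a) / 2)) * θ ^ (-((1 + a) / 2))) := by ring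
    _ ≤ 1 * _ := by gcongr
    _ = _ := one_mul _

lemma pre_eq {β t θ : ℝ} (hβ : 0 < β) (ht : 0 < t) (hθ : 0 < θ) : √(t * β) / 2 * omh θ = t * (lamb β (t * θ))⁻¹ := by
  have h1 : omh θ = (√θ)⁻¹ := by rw [omh, Real.rpow_neg hθ.le, Real.sqrt_eq_rpow]
  rw [h1, lamb, show t * θ / β = t * (θ / β) by ring, Real.sqrt_mul ht.le, Real.sqrt_mul ht.le, Real.sqrt_div hθ.le]
  have := Real.mul_self_sqrt ht.le
  have h2 := Real.sqrt_pos.2 ht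
  have h3 := Real.sqrt_pos.2 hθ
  have h4 := Real.sqrt_pos.2 hβ
  field_simp
  nlinarith

variable {β : ℝ} {F F' : ℝ → Spc m → ℝ} {B B' : ℝ}

lemma heat_rep (hβ : 0 < β) {τ : ℝ} (hτ : 0 ≤ τ) (f : Spc m → ℝ) (x : Spc m) :
    heatSG β τ f x = ∫ w, f (x - lamb β τ • w) * Gs m w := by
  unfold heatSG
  rcases hτ.eq_or_lt with h | h
  · subst h
    simp [lamb, integral_const_mul, integral_Gs]
  rw [if_neg (not_le.2 h)]
  have hl := lamb_pos hβ h
  set l := lamb β τ with hle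
  have hl2 : l ^ 2 = 4 * (τ / β) := by
    rw [hle, lamb, mul_pow, Real.sq_sqrt (by positivity)]; norm_num
  rw [← integral_sub_left_eq_self _ volume x]
  have := Measure.integral_comp_smul (volume : Measure (Spc m)) (fun z => (4 * Real.pi * (τ / β)) ^ (-((m : ℝ) + 1) / 2) * Real.exp (-qd (x - (x - z)) / (4 * (τ / β))) * f (x - z)) l
  rw [finrank_Spc, abs_of_pos (by positivity), smul_eq_mul, eq_comm, inv_mul_eq_iff_eq_mul₀ (by positivity)] at this
  rw [this, ← integral_const_mul]
  congr 1; ext w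
  have e1 : (4 * Real.pi * (τ / β)) ^ (-((m : ℝ) + 1) / 2) = (l ^ (m + 1))⁻¹ * Real.pi ^ (-((m : ℝ) + 1) / 2) := by
    rw [show 4 * Real.pi * (τ / β) = l ^ 2 * Real.pi by rw [hl2]; ring, Real.mul_rpow (by positivity) Real.pi_pos.le, ← Real.rpow_natCast l 2, ← Real.rpow_mul hl.le, ← Real.rpow_natCast l (m+1), ← Real.rpow_neg hl.le]
    congr 2; push_cast; ring
  have e2 : -qd (x - (x - l • w)) / (4 * (τ / β)) = -qd w := by
    rw [show x - (x - l • w) = l • w by abel, ← hl2]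
    have : qd (l • w) = l ^ 2 * qd w := by
      simp only [qd, Prod.smul_fst, Prod.smul_snd, Pi.smul_apply, smul_eq_mul, mul_pow, mul_add, Finset.mul_sum]
    rw [this]; field_simp
  rw [e1, e2, Gs]
  field_simp

lemma DU_eq (hβ : 0 < β) {t : ℝ} (ht : 0 ≤ t) (x : Spc m) :
    ∫ s in Ioc (0:ℝ) t, heatSG β (t - s) (F s) x = DU β F t x := by
  have h1 : ∫ s in Ioc (0:ℝ) t, heatSG β (t - s) (F s) x = ∫ s in Ioc (0:ℝ) t, ∫ w, F s (x - lamb β (t - s) • w) * Gs m w := by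
    refine setIntegral_congr_fun measurableSet_Ioc fun s hs => ?_
    exact heat_rep hβ (by linarith [hs.2]) _ _
  rw [h1, ← intervalIntegral.integral_of_le ht]
  have h2 := intervalIntegral.mul_integral_comp_sub_mul (a := 0) (b := 1) (f := fun s => ∫ w, F s (x - lamb β (t - s) • w) * Gs m w) t t
  simp only [mul_one, mul_zero, sub_self, sub_zero] at h2
  rw [← h2, intervalIntegral.integral_of_le zero_le_one, DU, TO]
  congr 1
  refine integral_congr_ae (ae_of_all _ fun θ => ?_)
  simp only [Inn, smul_eq_mul, one_mul]
  refine integral_congr_ae (ae_of_all _ fun w => ?_)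
  simp only
  rw [show t - t * θ = t * (1 - θ) by ring, show t - t * (1 - θ) = t * θ by ring]

lemma DU_le {b t : ℝ} (ht : 0 ≤ t) (x : Spc m) (hb : ∀ s x, 0 ≤ s → s ≤ t → |F s x| ≤ b) : |DU β F t x| ≤ t * b := by
  have := TO_le (β := β) (F := F) (om := fun _ => 1) (int_Gs (m := m)) (b := fun _ => b) (t := t) x (fun θ hθ x => hb _ _ (by nlinarith [hθ.1, hθ.2]) (by nlinarith [hθ.1, hθ.2])) (by simp)
  have e : ∫ w, ‖Gs m w‖ = 1 := by
    rw [← integral_Gs (m := m)]; congr 1; ext w; exact Real.norm_of_nonneg (Gs_pos w).le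
  rw [e] at this
  simp at this
  rw [DU, abs_mul, abs_of_nonneg ht]
  gcongr

section gen
variable {W : Type*} [NormedAddCommGroup W] [NormedSpace ℝ W] [CompleteSpace W] [SecondCountableTopology W] {k : Spc m → W}
lemma DGk_norm {t : ℝ} {x : Spc m} : ‖DGk β k F t x‖ = √(t * β) / 2 * ‖TO β omh k F t x‖ := by
  rw [DGk, norm_smul, Real.norm_of_nonneg (by positivity)]
lemma DGk_cont (hk : Continuous k) (hki : Integrable k) (hF : BC F B) : Continuous fun z : ℝ × Spc m => DGk β k F z.1 z.2 :=
  Continuous.smul (f := fun z : ℝ × Spc m => √(z.1 * β) / 2) (by fun_prop) (TO_cont int_omh hk hki hF)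
lemma DGk_sub (hk : Continuous k) (hki : Integrable k) (hF : BC F B) (hF' : BC F' B') (t : ℝ) (x : Spc m) : DGk β k F t x - DGk β k F' t x = DGk β k (fun s y => F s y - F' s y) t x := by
  unfold DGk; rw [← smul_sub, TO_sub int_omh hk hki hF hF']
lemma DGk_per (h : ∀ s, Per (F s)) (t : ℝ) : Per (DGk β k F t) := fun x j => by unfold DGk; rw [TO_per h]

lemma DGk_hold {α C : ℝ} (hk : Continuous k) (hki : Integrable k) (hc : 0 ≤ C) (hK : ∀ k' : Spc m, ∫⁻ w, ‖k (w + k') - k w‖ₑ ≤ ENNReal.ofReal (C * ‖k'‖ ^ α)) (hβ : 0 < β) (hF : BC F B) (hB0 : 0 ≤ B) (h0 : 0 ≤ α) (h1 : α < 1) {t : ℝ} (ht : 0 ≤ t) (ht1 : t ≤ 1) (x y : Spc m) :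
    ‖DGk β k F t x - DGk β k F t y‖ ≤ (B * C * (cb β α * (1 / (-((1 + α) / 2) + 1)))) * ‖x - y‖ ^ α := by
  have hcb : 0 ≤ cb β α := by unfold cb; positivity
  rcases ht.eq_or_lt with h | h
  · subst h
    simp only [DGk, zero_mul, Real.sqrt_zero, zero_div, zero_smul, sub_self, norm_zero]
    have : 0 < -((1 + α) / 2) + 1 := by linarith
    positivity
  obtain ⟨d, rfl⟩ : ∃ d, x = y + d := ⟨x - y, by abel⟩
  rw [add_sub_cancel_left, ← val_pw (by linarith)]
  unfold DGk TO
  rw [← smul_sub, ← integral_sub (TO_integrable int_omh hk hki hF _ _) (TO_integrable int_omh hk hki hF _ _), ← integral_smul]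
  have hi : IntegrableOn (fun θ : ℝ => (B * C * cb β α * ‖d‖ ^ α) * θ ^ (-((1 + α) / 2))) (Ioc 0 1) := (int_pw (by linarith)).const_mul _
  refine (norm_integral_le_of_norm_le hi ?_).trans (le_of_eq ?_)
  · refine (ae_restrict_iff' measurableSet_Ioc).2 (ae_of_all _ fun θ hθ => ?_)
    have hl := lamb_pos hβ (mul_pos h hθ.1)
    have e1 := Inn_hold hk hki hF hB0 hc d t θ y hl hK
    rw [← smul_sub, smul_smul, pre_eq hβ h hθ.1, norm_smul, Real.norm_of_nonneg (by positivity)]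
    have e2 := lamb_pw hβ h ht1 hθ.1 h1.le
    rw [neg_add, Real.rpow_add hl, Real.rpow_neg_one] at e2
    calc _ ≤ t * (lamb β (t * θ))⁻¹ * (B * C * ‖d‖ ^ α * lamb β (t * θ) ^ (-α)) := by gcongr
      _ = B * C * ‖d‖ ^ α * (t * ((lamb β (t * θ))⁻¹ * lamb β (t * θ) ^ (-α))) := by ring
      _ ≤ B * C * ‖d‖ ^ α * (cb β α * θ ^ (-((1 + α) / 2))) := by gcongr
      _ = _ := by ring
  · rw [integral_const_mul]; ring

end gen

lemma DG_le' {b : ℝ → ℝ} {t : ℝ} (ht : 0 ≤ t) (x : Spc m) (hb : ∀ θ ∈ Ioc (0:ℝ) 1, ∀ x, |F (t * (1 - θ)) x| ≤ b θ) (hbi : IntegrableOn (fun θ => omh θ * b θ) (Ioc 0 1)) :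
    ‖DG β F t x‖ ≤ √(t * β) / 2 * ((∫ θ in Ioc (0:ℝ) 1, omh θ * b θ) * I1 m) := by
  have ea : ∀ θ ∈ Ioc (0:ℝ) 1, |omh θ| * b θ = omh θ * b θ := fun θ hθ => by rw [abs_of_nonneg (show 0 ≤ omh θ from Real.rpow_nonneg hθ.1.le _)]
  have := TO_le (β := β) (F := F) (om := omh) (int_G1 (m := m)) (b := b) (t := t) x hb ((integrableOn_congr_fun ea measurableSet_Ioc).2 hbi)
  rw [setIntegral_congr_fun measurableSet_Ioc ea] at this
  have h2 : ‖DG β F t x‖ = √(t * β) / 2 * ‖TO β omh (G1 m) F t x‖ := DGk_norm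
  rw [h2]
  exact mul_le_mul_of_nonneg_left this (by positivity)

lemma DG_le {b t : ℝ} (ht : 0 ≤ t) (x : Spc m) (hb : ∀ s x, 0 ≤ s → s ≤ t → |F s x| ≤ b) : ‖DG β F t x‖ ≤ √(t * β) * I1 m * b := by
  refine (DG_le' (b := fun _ => b) ht x (fun θ hθ x => hb _ _ (by nlinarith [hθ.1, hθ.2]) (by nlinarith [hθ.1, hθ.2])) (int_omh.mul_const b)).trans (le_of_eq ?_)
  rw [integral_mul_const]
  unfold omh
  rw [val_pw (by norm_num)]; ring

lemma DU_cont (hF : BC F B) : Continuous fun z : ℝ × Spc m => DU β F z.1 z.2 :=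
  continuous_fst.mul (TO_cont int_one cont_Gs int_Gs hF)
lemma DG_cont (hF : BC F B) : Continuous fun z : ℝ × Spc m => DG β F z.1 z.2 :=
  DGk_cont cont_G1 int_G1 hF

lemma DU_sub (hF : BC F B) (hF' : BC F' B') (t : ℝ) (x : Spc m) : DU β F t x - DU β F' t x = DU β (fun s y => F s y - F' s y) t x := by
  unfold DU; rw [← mul_sub, TO_sub int_one cont_Gs int_Gs hF hF']
lemma DG_sub (hF : BC F B) (hF' : BC F' B') (t : ℝ) (x : Spc m) : DG β F t x - DG β F' t x = DG β (fun s y => F s y - F' s y) t x := by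
  exact DGk_sub cont_G1 int_G1 hF hF' t x

lemma DU_per (h : ∀ s, Per (F s)) (t : ℝ) : Per (DU β F t) := fun x j => by unfold DU; rw [TO_per h]
lemma DG_per (h : ∀ s, Per (F s)) (t : ℝ) : Per (DG β F t) := DGk_per h t

lemma DG_hold (hβ : 0 < β) (hF : BC F B) (hB0 : 0 ≤ B) {α : ℝ} (h0 : 0 ≤ α) (h1 : α < 1) {t : ℝ} (ht : 0 ≤ t) (ht1 : t ≤ 1) (x y : Spc m) :
    ‖DG β F t x - DG β F t y‖ ≤ (B * C2 m * (cb β α * (1 / (-((1 + α) / 2) + 1)))) * ‖x - y‖ ^ α :=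
  DGk_hold cont_G1 int_G1 C2_nn (K2 h0 h1.le) hβ hF hB0 h0 h1 ht ht1 x y

end duh

section der
lemma sub3 {X : Type*} [MeasurableSpace X] {μ : Measure X} {f g h : X → ℝ} (hf : Integrable f μ) (hg : Integrable g μ) (hh : Integrable h μ) :
    ∫ x, f x ∂μ - ∫ x, g x ∂μ - ∫ x, h x ∂μ = ∫ x, (f x - g x - h x) ∂μ := by
  have h1 : Integrable (fun x => f x - g x) μ := hf.sub hg
  rw [← integral_sub hf hg, ← integral_sub h1 hh]

variable {m : ℕ} {β : ℝ} {F F' : ℝ → Spc m → ℝ} {B B' : ℝ}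

lemma Inn_apply (hF : BC F B) (t θ : ℝ) (x h : Spc m) :
    Inn β (G1 m) F t θ x h = ∫ w, F (t * (1 - θ)) (x - lamb β (t * θ) • w) * G1 m w h := by
  unfold Inn
  rw [ContinuousLinearMap.integral_apply (Inn_integrable cont_G1 int_G1 hF _ _ _)]
  rfl

lemma int_G1h (h : Spc m) : Integrable fun w => G1 m w h := by
  exact int_G1.apply_continuousLinearMap h

lemma Inn_rem (hF : BC F B) (hB0 : 0 ≤ B) (t θ : ℝ) (x h : Spc m) (hl : 0 < lamb β (t * θ)) :
    |Inn β (Gs m) F t θ (x + h) - Inn β (Gs m) F t θ x - (lamb β (t * θ))⁻¹ * Inn β (G1 m) F t θ x h| ≤ B * (C2 m * ‖(lamb β (t * θ))⁻¹ • h‖ ^ (1/2 : ℝ) * ‖(lamb β (t * θ))⁻¹ • h‖) := by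
  rw [Inn_apply hF, ← integral_const_mul, Inn_shift t θ x h hl.ne']
  set k := (lamb β (t * θ))⁻¹ • h with hk
  have i1 : Integrable fun w => F (t * (1 - θ)) (x - lamb β (t * θ) • w) • Gs m (w + k) :=
    Inn_integrable (k := fun w => Gs m (w + k)) (cont_Gs.comp (by fun_prop)) (int_Gs.comp_add_right _) hF _ _ _
  have i2 := Inn_integrable cont_Gs int_Gs hF (t * (1 - θ)) (lamb β (t * θ)) x
  have i3 : Integrable fun w => F (t * (1 - θ)) (x - lamb β (t * θ) • w) • G1 m w h :=
    Inn_integrable (k := fun w => G1 m w h) ((ContinuousLinearMap.apply ℝ ℝ h).continuous.comp cont_G1) (int_G1h h) hF _ _ _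
  unfold Inn
  have i4 := i3.const_mul (lamb β (t * θ))⁻¹
  simp only [smul_eq_mul] at i1 i2 i4 ⊢
  rw [sub3 i1 i2 i4, ← Real.norm_eq_abs]
  refine nb_of_lint _ (fun w => Gs m (w + k) - Gs m w - G1 m w k) hB0 (mul_nonneg (mul_nonneg C2_nn (by positivity)) (by positivity)) (fun w => ?_) (K3 (α := 1/2) (by norm_num) (by norm_num) k)
  have e : G1 m w k = (lamb β (t * θ))⁻¹ * G1 m w h := by rw [hk, map_smul]; rfl
  rw [e]
  calc _ = ‖F (t * (1 - θ)) (x - lamb β (t * θ) • w) * (Gs m (w + k) - Gs m w - (lamb β (t * θ))⁻¹ * G1 m w h)‖ := by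
        congr 1; ring
    _ ≤ _ := by rw [norm_mul]; exact mul_le_mul_of_nonneg_right (hF.b _ _) (norm_nonneg _)

lemma DG_apply (hF : BC F B) (t : ℝ) (x h : Spc m) :
    DG β F t x h = ∫ θ in Ioc (0:ℝ) 1, (√(t * β) / 2) * (omh θ * Inn β (G1 m) F t θ x h) := by
  rw [integral_const_mul]
  have : TO β omh (G1 m) F t x h = ∫ θ in Ioc (0:ℝ) 1, (omh θ * Inn β (G1 m) F t θ x h) := by
    unfold TO
    rw [ContinuousLinearMap.integral_apply (TO_integrable int_omh cont_G1 int_G1 hF _ _)]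
    rfl
  rw [← this]; rfl

lemma DU_rem (hβ : 0 < β) (hF : BC F B) (hB0 : 0 ≤ B) {t : ℝ} (ht : 0 < t) (ht1 : t ≤ 1) (x h : Spc m) :
    |DU β F t (x + h) - DU β F t x - DG β F t x h| ≤ (B * C2 m * cb β (1/2) * 4) * ‖h‖ ^ (3/2 : ℝ) := by
  have hcb : 0 ≤ cb β (1/2) := by unfold cb; positivity
  have hc := C2_nn (m := m)
  have j1 := TO_integrable (β := β) int_one cont_Gs int_Gs hF t (x + h)
  have j2 := TO_integrable (β := β) int_one cont_Gs int_Gs hF t x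
  have j3 : IntegrableOn (fun θ => (√(t * β) / 2) * (omh θ * Inn β (G1 m) F t θ x h)) (Ioc 0 1) := by
    have := (TO_integrable (β := β) int_omh cont_G1 int_G1 hF t x).apply_continuousLinearMap h
    exact Integrable.const_mul this _
  rw [DG_apply hF]
  unfold DU TO
  rw [← integral_const_mul, ← integral_const_mul, sub3 (j1.const_mul t) (j2.const_mul t) j3]
  have hi : IntegrableOn (fun θ : ℝ => (B * C2 m * cb β (1/2) * ‖h‖ ^ (3/2 : ℝ)) * θ ^ (-((1 + 1/2) / 2) : ℝ)) (Ioc 0 1) := (int_pw (by norm_num)).const_mul _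
  rw [← Real.norm_eq_abs]
  refine (norm_integral_le_of_norm_le hi ?_).trans (le_of_eq ?_)
  · refine (ae_restrict_iff' measurableSet_Ioc).2 (ae_of_all _ fun θ hθ => ?_)
    have hl := lamb_pos hβ (mul_pos ht hθ.1)
    have e1 := Inn_rem hF hB0 t θ x h hl
    have e2 := lamb_pw (a := 1/2) hβ ht ht1 hθ.1 (by norm_num)
    have e3 : ‖(lamb β (t * θ))⁻¹ • h‖ ^ (1/2 : ℝ) * ‖(lamb β (t * θ))⁻¹ • h‖ = lamb β (t * θ) ^ (-(1 + 1/2) : ℝ) * ‖h‖ ^ (3/2 : ℝ) := by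
      have : ‖(lamb β (t * θ))⁻¹ • h‖ ^ (1/2 : ℝ) * ‖(lamb β (t * θ))⁻¹ • h‖ = ‖(lamb β (t * θ))⁻¹ • h‖ ^ (3/2 : ℝ) := by
        rcases (norm_nonneg ((lamb β (t * θ))⁻¹ • h)).eq_or_lt with z | z
        · rw [← z, Real.zero_rpow (by norm_num), Real.zero_rpow (by norm_num), zero_mul]
        · rw [← Real.rpow_add_one z.ne']; norm_num
      rw [this, norm_smul, norm_inv, Real.norm_of_nonneg hl.le, Real.mul_rpow (by positivity) (norm_nonneg _), Real.inv_rpow hl.le, Real.rpow_neg hl.le]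
      norm_num
    have e4 : t * ((1:ℝ) • Inn β (Gs m) F t θ (x + h)) - t * ((1:ℝ) • Inn β (Gs m) F t θ x) - √(t * β) / 2 * (omh θ * Inn β (G1 m) F t θ x h)
        = t * (Inn β (Gs m) F t θ (x + h) - Inn β (Gs m) F t θ x - (lamb β (t * θ))⁻¹ * Inn β (G1 m) F t θ x h) := by
      rw [← mul_assoc (√(t * β) / 2), pre_eq hβ ht hθ.1]
      simp only [one_smul]; ring
    rw [e4, norm_mul, Real.norm_of_nonneg ht.le]
    calc _ ≤ t * (B * (C2 m * ‖(lamb β (t * θ))⁻¹ • h‖ ^ (1/2 : ℝ) * ‖(lamb β (t * θ))⁻¹ • h‖)) := by gcongr; exact e1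
      _ = B * C2 m * ‖h‖ ^ (3/2 : ℝ) * (t * lamb β (t * θ) ^ (-(1 + 1/2) : ℝ)) := by rw [mul_assoc (C2 m), e3]; ring
      _ ≤ B * C2 m * ‖h‖ ^ (3/2 : ℝ) * (cb β (1/2) * θ ^ (-((1 + 1/2) / 2) : ℝ)) := by gcongr
      _ = _ := by ring
  · rw [integral_const_mul, val_pw (by norm_num)]; norm_num; ring

lemma DU_deriv (hβ : 0 < β) (hF : BC F B) (hB0 : 0 ≤ B) {t : ℝ} (ht : 0 ≤ t) (ht1 : t ≤ 1) (x : Spc m) :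
    HasFDerivAt (DU β F t) (DG β F t x) x := by
  rcases ht.eq_or_lt with h | h
  · subst h
    have e1 : DU β F 0 = fun _ : Spc m => (0:ℝ) := by ext; simp [DU]
    have e2 : DG β F 0 x = 0 := by refine ContinuousLinearMap.ext fun v => ?_; rw [DG_apply hF]; simp
    rw [e1, e2]; exact hasFDerivAt_const _ _
  rw [hasFDerivAt_iff_isLittleO_nhds_zero]
  have h1 : (fun d : Spc m => DU β F t (x + d) - DU β F t x - DG β F t x d) =O[nhds 0] fun d : Spc m => ‖d‖ ^ (3/2 : ℝ) := by
    refine Asymptotics.IsBigO.of_bound (B * C2 m * cb β (1/2) * 4) (Eventually.of_forall fun d => ?_)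
    rw [Real.norm_of_nonneg (show (0:ℝ) ≤ ‖d‖ ^ (3/2 : ℝ) by positivity)]
    exact DU_rem hβ hF hB0 h ht1 x d
  refine h1.trans_isLittleO ?_
  rw [← Asymptotics.isLittleO_norm_right]
  refine Asymptotics.isLittleO_of_tendsto' (Eventually.of_forall fun d hd => by rw [hd]; simp) ?_
  have h2 : Tendsto (fun d : Spc m => ‖d‖ ^ (1/2 : ℝ)) (nhds 0) (nhds 0) := by
    have : Continuous fun d : Spc m => ‖d‖ ^ (1/2 : ℝ) := continuous_norm.rpow_const fun _ => Or.inr (by norm_num)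
    simpa using this.tendsto 0
  refine h2.congr fun d => ?_
  rcases (norm_nonneg d).eq_or_lt with z | z
  · rw [← z]; norm_num
  · rw [show (3/2 : ℝ) = 1/2 + 1 by norm_num, Real.rpow_add_one z.ne']; field_simp

end der

section heat
variable {m : ℕ} {W : Type*} [NormedAddCommGroup W] [NormedSpace ℝ W] [CompleteSpace W] [SecondCountableTopology W]

def HU (β : ℝ) (f : Spc m → W) (t : ℝ) (x : Spc m) : W := ∫ w, Gs m w • f (x - lamb β t • w)

variable {β S : ℝ} {f : Spc m → W}

lemma HU_int (hf : Continuous f) (hS : ∀ x, ‖f x‖ ≤ S) (l : ℝ) (x : Spc m) : Integrable fun w => Gs m w • f (x - l • w) := by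
  have hg := cont_Gs (m := m)
  refine Integrable.mono' (int_Gs.mul_const S) ?_ (ae_of_all _ fun w => ?_)
  · exact Continuous.aestronglyMeasurable (by fun_prop)
  · rw [norm_smul, Real.norm_of_nonneg (Gs_pos w).le]; exact mul_le_mul_of_nonneg_left (hS _) (Gs_pos w).le

lemma HU_cont (hf : Continuous f) (hS : ∀ x, ‖f x‖ ≤ S) : Continuous fun z : ℝ × Spc m => HU β f z.1 z.2 := by
  have hl := cont_lamb β
  refine continuous_of_dominated (bound := fun w => Gs m w * S) (fun z => (HU_int hf hS _ _).aestronglyMeasurable) (fun z => ae_of_all _ fun w => ?_) (int_Gs.mul_const S) (ae_of_all _ fun w => by fun_prop)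
  rw [norm_smul, Real.norm_of_nonneg (Gs_pos w).le]; exact mul_le_mul_of_nonneg_left (hS _) (Gs_pos w).le

lemma HU_le (hS : ∀ x, ‖f x‖ ≤ S) (t : ℝ) (x : Spc m) : ‖HU β f t x‖ ≤ S := by
  have := norm_integral_le_of_norm_le (int_Gs.mul_const S) (ae_of_all volume fun w : Spc m => show ‖Gs m w • f (x - lamb β t • w)‖ ≤ Gs m w * S by
    rw [norm_smul, Real.norm_of_nonneg (Gs_pos w).le]; exact mul_le_mul_of_nonneg_left (hS _) (Gs_pos w).le)
  rwa [integral_mul_const, integral_Gs, one_mul] at this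

lemma HU_zero (x : Spc m) : HU β f 0 x = f x := by
  unfold HU lamb
  simp [integral_smul_const, integral_Gs]

lemma HU_per (h : Per f) (t : ℝ) : Per (HU β f t) := by
  intro x j
  unfold HU
  refine integral_congr_ae (ae_of_all _ fun w => ?_)
  simp only
  rw [add_sub_right_comm, h]

lemma heat_HU (hβ : 0 < β) {t : ℝ} (ht : 0 ≤ t) {f : Spc m → ℝ} (hf : Continuous f) (hS : ∀ x, ‖f x‖ ≤ S) (x : Spc m) :
    heatSG β t (fun y => f y - 1) x = HU β f t x - 1 := by
  rw [heat_rep hβ ht]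
  have h1 := HU_int hf hS (lamb β t) x
  unfold HU
  rw [← integral_Gs (m := m), ← integral_sub h1 int_Gs]
  refine integral_congr_ae (ae_of_all _ fun w => ?_)
  simp only [smul_eq_mul]; ring_nf
  simp [integral_Gs]

lemma HU_deriv {f : Spc m → ℝ} (hf : Differentiable ℝ f) (hg : Continuous (grd f)) (hS : ∀ x, ‖f x‖ ≤ S) {S' : ℝ} (hS' : ∀ x, ‖grd f x‖ ≤ S') (t : ℝ) (x : Spc m) :
    HasFDerivAt (HU β f t) (HU β (grd f) t x) x := by
  have key := hasFDerivAt_integral_of_dominated_of_fderiv_le (μ := (volume : Measure (Spc m))) (𝕜 := ℝ) (F := fun x w => Gs m w • f (x - lamb β t • w)) (F' := fun x w => Gs m w • grd f (x - lamb β t • w)) (x₀ := x) (s := univ) (bound := fun w => Gs m w * S') univ_mem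
    (Eventually.of_forall fun y => (HU_int hf.continuous hS _ _).aestronglyMeasurable) (HU_int hf.continuous hS _ _) (HU_int hg hS' _ _).aestronglyMeasurable (ae_of_all _ fun w y _ => ?_) (int_Gs.mul_const S') (ae_of_all _ fun w y _ => ?_)
  · exact key
  · rw [norm_smul, Real.norm_of_nonneg (Gs_pos w).le]; exact mul_le_mul_of_nonneg_left (hS' _) (Gs_pos w).le
  · have h1 : HasFDerivAt (fun y => f (y - lamb β t • w)) (grd f (y - lamb β t • w)) y := by
      have := (hf (y - lamb β t • w)).hasFDerivAt
      have h2 : HasFDerivAt (fun y : Spc m => y - lamb β t • w) (ContinuousLinearMap.id ℝ (Spc m)) y := (hasFDerivAt_id y).sub_const _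
      exact (HasFDerivAt.comp y (f := fun y : Spc m => y - lamb β t • w) this h2)
    have h3 := h1.const_mul (Gs m w)
    exact h3

def gam (m : ℕ) : Measure (Spc m) := volume.withDensity fun w => ENNReal.ofReal (Gs m w)

instance prob_gam : IsProbabilityMeasure (gam m) := by
  constructor
  rw [gam, withDensity_apply _ MeasurableSet.univ, Measure.restrict_univ, ← ofReal_integral_eq_lintegral_ofReal int_Gs (ae_of_all _ fun w => (Gs_pos w).le), integral_Gs, ENNReal.ofReal_one]

lemma HU_gam (t : ℝ) (x : Spc m) : HU β f t x = ∫ w, f (x - lamb β t • w) ∂(gam m) := by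
  rw [gam, integral_withDensity_eq_integral_toReal_smul (show Measurable fun w => ENNReal.ofReal (Gs m w) from ENNReal.measurable_ofReal.comp cont_Gs.measurable) (ae_of_all _ fun w => ENNReal.ofReal_lt_top)]
  unfold HU
  congr 1; ext w
  rw [ENNReal.toReal_ofReal (Gs_pos w).le]

lemma HU_PN [MeasurableSpace W] [BorelSpace W] {p q : ℝ} (hp : 1 ≤ p) (ε : ℝ) (hf : Per f) (hm : Measurable f) (hS : ∀ x, ‖f x‖ ≤ S) (t : ℝ) :
    PN p q ε (HU β f t) ≤ (SL m).card * PN p q ε f := by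
  have e : HU β f t = fun x => ∫ w, f (x - lamb β t • w) ∂(gam m) := by ext x; exact HU_gam t x
  rw [e]
  exact PN_jensen hp ε hf hm S hS (gam m) (lamb β t)

end heat

section nl
variable {m : ℕ}

structure Adm (R c : ℝ) (u : Spc m → ℝ) (g : Spc m → Du m) : Prop where
  cu : Continuous u
  cg : Continuous g
  bu : ∀ x, |u x| ≤ R
  bg : ∀ x, ‖g x‖ ≤ R
  mg : ∀ x1, c ≤ marg u x1

abbrev Qt (m : ℕ) := (Spc m → ℝ) → (Spc m → Du m) → Spc m → ℝ

def GoodB (R c B : ℝ) (Q : Qt m) : Prop := 0 ≤ B ∧ (∀ u g, Adm R c u g → ∀ x, |Q u g x| ≤ B) ∧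
  ∀ u g u' g' d, Adm R c u g → Adm R c u' g' → 0 ≤ d → (∀ y, |u y - u' y| ≤ d) → (∀ y, ‖g y - g' y‖ ≤ d) → ∀ x, |Q u g x - Q u' g' x| ≤ B * d

def GoodC (R c : ℝ) (Q : Qt m) : Prop := ∀ (u : ℝ → Spc m → ℝ) (g : ℝ → Spc m → Du m), (∀ t, Adm R c (u t) (g t)) →
  (Continuous fun z : ℝ × Spc m => u z.1 z.2) → (Continuous fun z : ℝ × Spc m => g z.1 z.2) → Continuous fun z : ℝ × Spc m => Q (u z.1) (g z.1) z.2

def Good (R c : ℝ) (Q : Qt m) : Prop := (∃ B, GoodB R c B Q) ∧ GoodC R c Q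

variable {R c : ℝ} {Q Q1 Q2 : Qt m}

lemma Good.add (h1 : Good R c Q1) (h2 : Good R c Q2) : Good R c (fun u g x => Q1 u g x + Q2 u g x) := by
  obtain ⟨⟨B1, n1, b1, l1⟩, c1⟩ := h1
  obtain ⟨⟨B2, n2, b2, l2⟩, c2⟩ := h2
  refine ⟨⟨B1 + B2, by linarith, fun u g h x => (abs_add_le _ _).trans (add_le_add (b1 u g h x) (b2 u g h x)), fun u g u' g' d a a' hd h h' x => ?_⟩, fun u g a hu hg => (c1 u g a hu hg).add (c2 u g a hu hg)⟩
  have e1 := l1 u g u' g' d a a' hd h h' x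
  have e2 := l2 u g u' g' d a a' hd h h' x
  rw [show Q1 u g x + Q2 u g x - (Q1 u' g' x + Q2 u' g' x) = (Q1 u g x - Q1 u' g' x) + (Q2 u g x - Q2 u' g' x) by ring]
  refine (abs_add_le _ _).trans ?_
  linarith

lemma Good.mul (h1 : Good R c Q1) (h2 : Good R c Q2) : Good R c (fun u g x => Q1 u g x * Q2 u g x) := by
  obtain ⟨⟨B1, n1, b1, l1⟩, c1⟩ := h1
  obtain ⟨⟨B2, n2, b2, l2⟩, c2⟩ := h2
  refine ⟨⟨2 * (B1 * B2), by positivity, fun u g h x => ?_, fun u g u' g' d a a' hd h h' x => ?_⟩, fun u g a hu hg => (c1 u g a hu hg).mul (c2 u g a hu hg)⟩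
  · rw [abs_mul]
    have := mul_le_mul (b1 u g h x) (b2 u g h x) (abs_nonneg _) n1
    nlinarith [mul_nonneg n1 n2]
  have e1 := l1 u g u' g' d a a' hd h h' x
  have e2 := l2 u g u' g' d a a' hd h h' x
  rw [show Q1 u g x * Q2 u g x - (Q1 u' g' x * Q2 u' g' x) = (Q1 u g x - Q1 u' g' x) * Q2 u g x + Q1 u' g' x * (Q2 u g x - Q2 u' g' x) by ring]
  refine (abs_add_le _ _).trans ?_
  rw [abs_mul, abs_mul]
  have f1 := mul_le_mul e1 (b2 u g a x) (abs_nonneg _) (by positivity)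
  have f2 := mul_le_mul (b1 u' g' a' x) e2 (abs_nonneg _) (by positivity)
  linarith

lemma Good.const {f : Spc m → ℝ} (hf : Continuous f) {K : ℝ} (hK : ∀ x, |f x| ≤ K) : Good R c (fun _ _ x => f x) := by
  have : 0 ≤ K := (abs_nonneg _).trans (hK 0)
  exact ⟨⟨K, this, fun _ _ _ x => hK x, fun _ _ _ _ d _ _ hd _ _ x => by simp; positivity⟩, fun u g a hu hg => hf.comp continuous_snd⟩

lemma Good.neg (h1 : Good R c Q1) : Good R c (fun u g x => - Q1 u g x) := by
  have := (Good.const (R := R) (c := c) (f := fun _ : Spc m => (-1 : ℝ)) continuous_const (K := 1) (by simp)).mul h1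
  simpa using this

lemma Good.sum {ι : Type*} (s : Finset ι) (Q : ι → Qt m) (h : ∀ i, Good R c (Q i)) : Good R c (fun u g x => ∑ i ∈ s, Q i u g x) := by
  classical
  induction s using Finset.induction_on with
  | empty => simpa using Good.const (R := R) (c := c) (f := fun _ : Spc m => (0 : ℝ)) continuous_const (K := 0) (by simp)
  | insert a s ha ih =>
    simp only [Finset.sum_insert ha]
    exact (h a).add ih

lemma Good.u (hR : 0 ≤ R) : Good R c (fun (u : Spc m → ℝ) _ x => u x) :=
  ⟨⟨R + 1, by linarith, fun u g h x => by have := h.bu x; linarith, fun u g u' g' d a a' hd h h' x => by have := h x; nlinarith⟩, fun u g a hu hg => hu⟩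

lemma Good.g (hR : 0 ≤ R) (v : Spc m) : Good R c (fun _ (g : Spc m → Du m) x => g x v) := by
  refine ⟨⟨(R + 1) * ‖v‖, by positivity, fun u g h x => ?_, fun u g u' g' d a a' hd h h' x => ?_⟩, fun u g a hu hg => ?_⟩
  · have := (g x).le_opNorm v
    rw [Real.norm_eq_abs] at this
    have h2 := mul_le_mul_of_nonneg_right (h.bg x) (norm_nonneg v)
    nlinarith [norm_nonneg v]
  · have := (g x - g' x).le_opNorm v
    rw [Real.norm_eq_abs] at this
    have h2 := mul_le_mul_of_nonneg_right (h' x) (norm_nonneg v)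
    have h3 : 0 ≤ R * ‖v‖ * d := by positivity
    have : |g x v - g' x v| ≤ d * ‖v‖ := this.trans h2
    nlinarith
  · exact (ContinuousLinearMap.apply ℝ ℝ v).continuous.comp hg

lemma fin_cube1 : IsFiniteMeasure (volume.restrict (cube1 m)) := ⟨by rw [Measure.restrict_apply_univ, vol_cube1]; simp⟩

lemma Good.cx (h : Good R c Q) {u : Spc m → ℝ} {g : Spc m → Du m} (a : Adm R c u g) : Continuous (Q u g) := by
  have := h.2 (fun _ => u) (fun _ => g) (fun _ => a) (a.cu.comp continuous_snd) (a.cg.comp continuous_snd)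
  exact this.comp (by fun_prop : Continuous fun x : Spc m => ((0:ℝ), x))

lemma Good.intg (h : Good R c Q) {u : Spc m → ℝ} {g : Spc m → Du m} (a : Adm R c u g) (x1 : ℝ) : IntegrableOn (fun y => Q u g (x1, y)) (cube1 m) := by
  obtain ⟨B, n, b, l⟩ := h.1
  have := fin_cube1 (m := m)
  refine Integrable.mono' (integrable_const B) ?_ (ae_of_all _ fun y => b u g a _)
  exact ((h.cx a).comp (by fun_prop : Continuous fun y : Fin m → ℝ => (x1, y))).aestronglyMeasurable

lemma Good.marg (h : Good R c Q) : Good R c (fun u g x => ∫ y in cube1 m, Q u g (x.1, y)) := by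
  have hh := h
  obtain ⟨⟨B, n, b, l⟩, cc⟩ := h
  have := fin_cube1 (m := m)
  have hv : (volume : Measure (Fin m → ℝ)).real (cube1 m) = 1 := by rw [measureReal_def, vol_cube1]; simp
  have hbd : ∀ (f : (Fin m → ℝ) → ℝ) (D : ℝ), (∀ y, |f y| ≤ D) → |∫ y in cube1 m, f y| ≤ D := by
    intro f D hf
    have := norm_integral_le_of_norm_le_const (μ := volume.restrict (cube1 m)) (f := f) (C := D) (ae_of_all _ fun y => by rw [Real.norm_eq_abs]; exact hf y)
    rwa [measureReal_restrict_apply MeasurableSet.univ, univ_inter, hv, mul_one, Real.norm_eq_abs] at this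
  refine ⟨⟨B, n, fun u g a x => hbd _ _ fun y => b u g a _, fun u g u' g' d a a' hd h h' x => ?_⟩, fun u g a hu hg => ?_⟩
  · rw [← integral_sub (hh.intg a _) (hh.intg a' _)]
    exact hbd _ _ fun y => l u g u' g' d a a' hd h h' _
  · refine continuous_of_dominated (bound := fun _ => B) (fun z => (hh.intg (a z.1) _).aestronglyMeasurable) (fun z => ae_of_all _ fun y => b _ _ (a z.1) _) (integrable_const B) (ae_of_all _ fun y => ?_)
    exact (cc u g a hu hg).comp (by fun_prop : Continuous fun z : ℝ × Spc m => (z.1, ((z.2.1, y) : Spc m)))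

lemma Good.inv (h : Good R c Q) (hc : 0 < c) (hl : ∀ u g, Adm R c u g → ∀ x, c ≤ Q u g x) : Good R c (fun u g x => (Q u g x)⁻¹) := by
  obtain ⟨⟨B, n, b, l⟩, cc⟩ := h
  refine ⟨⟨c⁻¹ + B * c⁻¹ ^ 2, by positivity, fun u g a x => ?_, fun u g u' g' d a a' hd h h' x => ?_⟩, fun u g a hu hg => ?_⟩
  · have h1 := hl u g a x
    rw [abs_of_pos (inv_pos.2 (hc.trans_le h1))]
    have : (Q u g x)⁻¹ ≤ c⁻¹ := inv_anti₀ hc h1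
    have : 0 ≤ B * c⁻¹ ^ 2 := by positivity
    linarith
  · have h1 := hl u g a x
    have h2 := hl u' g' a' x
    have p1 := hc.trans_le h1
    have p2 := hc.trans_le h2
    have e := l u g u' g' d a a' hd h h' x
    rw [inv_sub_inv p1.ne' p2.ne', abs_div, abs_sub_comm, div_eq_mul_inv, abs_of_pos (mul_pos p1 p2), mul_inv]
    have i1 : (Q u g x)⁻¹ ≤ c⁻¹ := inv_anti₀ hc h1
    have i2 : (Q u' g' x)⁻¹ ≤ c⁻¹ := inv_anti₀ hc h2
    calc _ ≤ B * d * (c⁻¹ * c⁻¹) := by gcongr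
      _ ≤ _ := by
        have : 0 ≤ c⁻¹ * d := by positivity
        nlinarith
  · exact (cc u g a hu hg).inv₀ fun z => (hc.trans_le (hl _ _ (a z.1) _)).ne'

end nl

section ft
variable {m : ℕ}

lemma cpt_Kc (a : Spc m) (r : ℝ) : IsCompact (Kc a r) := isCompact_Icc

lemma per_red (x : Spc m) : ∃ y ∈ Kc (0 : Spc m) 1, ∃ k : Lx m, x = y + lz k := by
  refine ⟨x - lz (fl x), ?_, fl x, by abel⟩
  have := mem_Kc_fl x
  rw [mem_Kc] at this ⊢
  obtain ⟨⟨a, b⟩, h⟩ := this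
  refine ⟨⟨by simp; linarith, by simp; linarith⟩, fun i => ?_⟩
  have := h i
  constructor <;> simp <;> linarith

lemma per_bd {W : Type*} [NormedAddCommGroup W] {g : Spc m → W} (h : Per g) (hc : Continuous g) : ∃ C, 0 ≤ C ∧ ∀ x, ‖g x‖ ≤ C := by
  obtain ⟨C, hC⟩ := (cpt_Kc (0 : Spc m) 1).exists_bound_of_continuousOn hc.continuousOn
  have h2 : ∀ x, ‖g x‖ ≤ C := by
    intro x
    obtain ⟨y, hy, k, rfl⟩ := per_red x
    rw [h y k]; exact hC y hy
  exact ⟨C, (norm_nonneg _).trans (h2 0), h2⟩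

lemma per_unif {W : Type*} [NormedAddCommGroup W] {F : ℝ → Spc m → W} (hc : Continuous fun z : ℝ × Spc m => F z.1 z.2) (h : ∀ t, Per (F t)) (t0 : ℝ) {ε : ℝ} (hε : 0 < ε) :
    ∃ δ > 0, ∀ t, |t - t0| < δ → ∀ x, ‖F t x - F t0 x‖ < ε := by
  have hcp : IsCompact (Icc (t0 - 1) (t0 + 1) ×ˢ Kc (0 : Spc m) 1) := isCompact_Icc.prod (cpt_Kc _ _)
  have := hcp.uniformContinuousOn_of_continuous hc.continuousOn
  rw [Metric.uniformContinuousOn_iff] at this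
  obtain ⟨δ, hδ, H⟩ := this ε hε
  refine ⟨min δ 1, by positivity, fun t ht x => ?_⟩
  obtain ⟨y, hy, k, rfl⟩ := per_red x
  rw [h t y k, h t0 y k, ← dist_eq_norm]
  have ht1 := ht.trans_le (min_le_left _ _)
  have ht2 := ht.trans_le (min_le_right _ _)
  rw [abs_lt] at ht2
  refine H (t, y) ⟨⟨by simp; linarith, by simp; linarith⟩, hy⟩ (t0, y) ⟨⟨by simp, by simp⟩, hy⟩ ?_
  rw [Prod.dist_eq, dist_self, max_eq_left dist_nonneg, Real.dist_eq]
  exact ht1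

def Im (f : Spc m → ℝ) (x : Spc m) : ℝ := ∫ y in cube1 m, f (x.1, y)

lemma Im_per {f : Spc m → ℝ} (h : Per f) : Per (Im f) := by
  intro x k
  unfold Im
  refine integral_congr_ae (ae_of_all _ fun y => ?_)
  have := h (x.1, y) (k.1, 0)
  show f ((x + lz k).1, y) = f (x.1, y)
  rw [← this]
  congr 1
  ext <;> simp [lz]

def FT (V : Spc m → ℝ) : Qt m := fun u g x =>
  (pd (e1 m) V x * g x (e1 m) + ∑ i, pd (eC m i) V x * g x (eC m i)) + lap V x * u x +
  -(Im (fun z => pd (e1 m) V z * u z) x * (Im u x)⁻¹ * g x (e1 m) +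
    (Im (fun z => pd (e1 m) (pd (e1 m) V) z * u z + pd (e1 m) V z * g z (e1 m)) x * (Im u x)⁻¹ +
     -(Im (fun z => pd (e1 m) V z * u z) x * (Im u x)⁻¹ * (Im (fun z => g z (e1 m)) x * (Im u x)⁻¹))) * u x)

variable {V : Spc m → ℝ}

lemma pd_per {f : Spc m → ℝ} (h : Per f) (v : Spc m) : Per (pd v f) := by
  intro x k
  have := per_grd h x k
  unfold grd at this
  unfold pd
  rw [this]

lemma pd_cd (hV : ContDiff ℝ 2 V) (v : Spc m) : ContDiff ℝ 1 (pd v V) := by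
  unfold pd
  exact (hV.fderiv_right (m := 1) (by norm_num)).clm_apply contDiff_const

lemma pd_c {f : Spc m → ℝ} (hf : ContDiff ℝ 1 f) (v : Spc m) : Continuous (pd v f) := by
  unfold pd
  exact (hf.continuous_fderiv (by norm_num)).clm_apply continuous_const

lemma lap_per (h : Per V) : Per (lap V) := by
  intro x k
  unfold lap
  rw [pd_per (pd_per h _) _ x k]
  congr 1
  exact Finset.sum_congr rfl fun i _ => pd_per (pd_per h _) _ x k

lemma lap_c (hV : ContDiff ℝ 2 V) : Continuous (lap V) := by
  unfold lap
  exact (pd_c (pd_cd hV _) _).add (continuous_finsetSum _ fun i _ => pd_c (pd_cd hV _) _)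

lemma Good.per {R c : ℝ} {f : Spc m → ℝ} (hf : Continuous f) (hp : Per f) : Good R c (fun _ _ x => f x) := by
  obtain ⟨C, _, h⟩ := per_bd hp hf
  exact Good.const hf h

lemma FT_good (hV : ContDiff ℝ 2 V) (hp : Per V) {R c : ℝ} (hR : 0 ≤ R) (hc : 0 < c) : Good R c (FT V) := by
  have gV : ∀ v, Good R c (fun _ _ x => pd v V x) := fun v => Good.per (pd_cd hV v).continuous (pd_per hp v)
  have gL : Good R c (fun _ _ x => lap V x) := Good.per (lap_c hV) (lap_per hp)
  have gVV : Good R c (fun _ _ x => pd (e1 m) (pd (e1 m) V) x) := Good.per (pd_c (pd_cd hV _) _) (pd_per (pd_per hp _) _)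
  have gg := fun v : Spc m => Good.g (c := c) hR v
  have gu := Good.u (m := m) (c := c) hR
  have gM : Good R c (fun (u : Spc m → ℝ) _ x => Im u x) := gu.marg
  have gMi : Good R c (fun (u : Spc m → ℝ) _ x => (Im u x)⁻¹) := gM.inv hc fun u g a x => a.mg x.1
  have gN : Good R c (fun (u : Spc m → ℝ) _ x => Im (fun z => pd (e1 m) V z * u z) x) := ((gV (e1 m)).mul gu).marg
  have gN' : Good R c (fun (u : Spc m → ℝ) g x => Im (fun z => pd (e1 m) (pd (e1 m) V) z * u z + pd (e1 m) V z * g z (e1 m)) x) := ((gVV.mul gu).add ((gV (e1 m)).mul (gg _))).marg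
  have gM' : Good R c (fun (u : Spc m → ℝ) g x => Im (fun z => g z (e1 m)) x) := (gg (e1 m)).marg
  exact ((((gV (e1 m)).mul (gg _)).add (Good.sum _ _ fun i => (gV (eC m i)).mul (gg _))).add (gL.mul gu)).add
    ((((gN.mul gMi).mul (gg _)).add (((gN'.mul gMi).add ((gN.mul gMi).mul (gM'.mul gMi)).neg).mul gu)).neg)

lemma FT_per (hp : Per V) {u : Spc m → ℝ} {g : Spc m → Du m} (hu : Per u) (hg : Per g) : Per (FT V u g) := by
  have hpd := fun v => pd_per hp v
  have i1 := Im_per hu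
  have i2 : Per (Im (fun z => pd (e1 m) V z * u z)) := Im_per fun x k => by simp only [hpd _ x k, hu x k]
  have i3 : Per (Im (fun z => pd (e1 m) (pd (e1 m) V) z * u z + pd (e1 m) V z * g z (e1 m))) := Im_per fun x k => by
    simp only [hpd _ x k, hu x k, hg x k, pd_per (hpd _) _ x k]
  have i4 : Per (Im (fun z => g z (e1 m))) := Im_per fun x k => by simp only [hg x k]
  intro x k
  unfold FT
  simp only [i1 x k, i2 x k, i3 x k, i4 x k, hu x k, hg x k, hpd _ x k, lap_per hp x k]

lemma Im_deriv {h h' : Spc m → ℝ} (hc : Continuous h) (hc' : Continuous h') {K : ℝ} (hb : ∀ x, |h x| ≤ K) (hb' : ∀ x, |h' x| ≤ K)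
    (hd : ∀ s y, HasDerivAt (fun s => h (s, y)) (h' (s, y)) s) (x : Spc m) : HasDerivAt (fun s => ∫ y in cube1 m, h (s, y)) (Im h' x) x.1 := by
  have := fin_cube1 (m := m)
  have ms : ∀ {f : Spc m → ℝ}, Continuous f → ∀ s, AEStronglyMeasurable (fun y => f (s, y)) (volume.restrict (cube1 m)) := fun hf s =>
    (hf.comp (by fun_prop : Continuous fun y : Fin m → ℝ => (s, y))).aestronglyMeasurable
  exact (hasDerivAt_integral_of_dominated_loc_of_deriv_le (μ := volume.restrict (cube1 m)) (F := fun s y => h (s, y)) (F' := fun s y => h' (s, y)) (bound := fun _ => K)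
    univ_mem (Eventually.of_forall fun s => ms hc s) (Integrable.mono' (integrable_const K) (ms hc _) (ae_of_all _ fun y => hb _)) (ms hc' _)
    (ae_of_all _ fun y s _ => hb' _) (integrable_const K) (ae_of_all _ fun y s _ => hd s y)).2

lemma sl_deriv {f : Spc m → ℝ} (hf : Differentiable ℝ f) (s : ℝ) (y : Fin m → ℝ) : HasDerivAt (fun s => f (s, y)) (pd (e1 m) f (s, y)) s := by
  have h1 : HasDerivAt (fun s : ℝ => ((s, y) : Spc m)) (e1 m) s := (hasDerivAt_id s).prodMk (hasDerivAt_const s y)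
  exact (hf (s, y)).hasFDerivAt.comp_hasDerivAt s h1

lemma Fop_eq (hV : ContDiff ℝ 2 V) (hp : Per V) {R c : ℝ} (hR : 0 ≤ R) (hc : 0 < c) {ψ : Spc m → ℝ} (hd : Differentiable ℝ ψ) (ha : Adm R c ψ (grd ψ)) :
    Fop V ψ = FT V ψ (grd ψ) := by
  funext x
  obtain ⟨C1, n1, b1⟩ := per_bd (pd_per hp (e1 m)) (pd_cd hV _).continuous
  obtain ⟨C2, n2, b2⟩ := per_bd (pd_per (pd_per hp (e1 m)) (e1 m)) (pd_c (pd_cd hV _) _)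
  have bg : ∀ z, |pd (e1 m) ψ z| ≤ R * ‖e1 m‖ := fun z => by
    have := (grd ψ z).le_opNorm (e1 m)
    exact this.trans (mul_le_mul_of_nonneg_right (ha.bg z) (norm_nonneg _))
  have cg : Continuous (pd (e1 m) ψ) := ha.cg.clm_apply continuous_const
  have bu := ha.bu
  have cu := ha.cu
  have hM : HasDerivAt (fun s => ∫ y in cube1 m, ψ (s, y)) (Im (pd (e1 m) ψ) x) x.1 :=
    Im_deriv cu cg (K := R + R * ‖e1 m‖) (fun z => by have := bu z; have : 0 ≤ R * ‖e1 m‖ := by positivity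
                                                      linarith) (fun z => by have := bg z; linarith) (fun s y => sl_deriv hd s y) x
  have hN : HasDerivAt (fun s => ∫ y in cube1 m, pd (e1 m) V (s, y) * ψ (s, y)) (Im (fun z => pd (e1 m) (pd (e1 m) V) z * ψ z + pd (e1 m) V z * pd (e1 m) ψ z) x) x.1 := by
    refine Im_deriv (h := fun z => pd (e1 m) V z * ψ z) ((pd_cd hV _).continuous.mul cu) (((pd_c (pd_cd hV _) _).mul cu).add ((pd_cd hV _).continuous.mul cg)) (K := C1 * R + C2 * R + C1 * (R * ‖e1 m‖)) (fun z => ?_) (fun z => ?_) (fun s y => ?_) x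
    · rw [abs_mul]
      have := mul_le_mul (b1 z) (bu z) (abs_nonneg _) n1
      rw [Real.norm_eq_abs] at this
      have : 0 ≤ C2 * R := by positivity
      have : 0 ≤ C1 * (R * ‖e1 m‖) := by positivity
      linarith
    · refine (abs_add_le _ _).trans ?_
      simp only [Pi.mul_apply, abs_mul]
      have h1 := mul_le_mul (b2 z) (bu z) (abs_nonneg _) n2
      have h2 := mul_le_mul (b1 z) (bg z) (abs_nonneg _) n1
      rw [Real.norm_eq_abs] at h1 h2
      have : 0 ≤ C1 * R := by positivity
      linarith
    · exact (sl_deriv ((pd_cd hV _).differentiable (by norm_num)) s y).mul (sl_deriv hd s y)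
  have hpos : 0 < ∫ y in cube1 m, ψ (x.1, y) := hc.trans_le (ha.mg x.1)
  have hφ := hN.div hM hpos.ne'
  have hφ2 : HasFDerivAt (fun z : Spc m => phiF V ψ z.1) _ x := hφ.hasFDerivAt.comp x (hasFDerivAt_fst (𝕜 := ℝ) (p := x))
  have hprod := (hφ2.mul (hd x).hasFDerivAt).fderiv
  have hpd : pd (e1 m) (fun z => phiF V ψ z.1 * ψ z) x = phiF V ψ x.1 * pd (e1 m) ψ x + ψ x * ((Im (fun z => pd (e1 m) (pd (e1 m) V) z * ψ z + pd (e1 m) V z * pd (e1 m) ψ z) x * Im ψ x - Im (fun z => pd (e1 m) V z * ψ z) x * Im (pd (e1 m) ψ) x) / Im ψ x ^ 2) := by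
    have := DFunLike.congr_fun hprod (e1 m)
    refine Eq.trans this ?_
    simp only [_root_.add_apply, _root_.smul_apply, ContinuousLinearMap.comp_apply, ContinuousLinearMap.toSpanSingleton_apply]
    simp [e1, Im, pd]
  have e1' : phiF V ψ x.1 = Im (fun z => pd (e1 m) V z * ψ z) x / Im ψ x := rfl
  have hpos' : 0 < Im ψ x := hpos
  unfold Fop
  rw [hpd, e1']
  change gradDot V ψ x + _ - _ = gradDot V ψ x + lap V x * ψ x + -(_ * (Im ψ x)⁻¹ * pd (e1 m) ψ x + (Im (fun z => pd (e1 m) (pd (e1 m) V) z * ψ z + pd (e1 m) V z * pd (e1 m) ψ z) x * (Im ψ x)⁻¹ + -(_ * (Im ψ x)⁻¹ * (Im (pd (e1 m) ψ) x * (Im ψ x)⁻¹))) * ψ x)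
  field_simp
  ring
end ft

section fx

lemma fixpt {Z W : Type*} [TopologicalSpace Z] [NormedAddCommGroup W] [CompleteSpace W] (P : (Z → W) → Prop) (Φ : (Z → W) → Z → W)
    (f0 : Z → W) (h0 : P f0) (hc : ∀ f, P f → Continuous f) (hb : ∀ f, P f → ∃ C, ∀ z, ‖f z‖ ≤ C)
    (hcl : ∀ (f : ℕ → Z → W) (g : Z → W), Continuous g → (∀ n, P (f n)) → (∀ z, Tendsto (fun n => f n z) atTop (nhds (g z))) → P g)
    (hmap : ∀ f, P f → P (Φ f))
    (hlip : ∀ f f' d, P f → P f' → 0 ≤ d → (∀ z, ‖f z - f' z‖ ≤ d) → ∀ z, ‖Φ f z - Φ f' z‖ ≤ d / 2) : ∃ f, P f ∧ Φ f = f := by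
  let K : Set (BoundedContinuousFunction Z W) := {f | P f}
  have hK : IsClosed K := by
    refine IsSeqClosed.isClosed fun f g hf hg => ?_
    refine hcl (fun n => f n) g g.continuous hf fun z => ?_
    exact ((continuous_eval_const (F := BoundedContinuousFunction Z W) z).tendsto g).comp hg
  have : CompleteSpace K := hK.completeSpace_coe
  choose C hC using hb
  let mk : ∀ f, P f → BoundedContinuousFunction Z W := fun f hf => BoundedContinuousFunction.ofNormedAddCommGroup f (hc f hf) (C f hf) (hC f hf)
  have hmk : ∀ f hf z, mk f hf z = f z := fun f hf z => rfl
  have hmk' : ∀ f hf, (mk f hf : Z → W) = f := fun f hf => rfl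
  let Ψ : K → K := fun f => ⟨mk (Φ f.1) (hmap _ f.2), by show P _; rw [hmk']; exact hmap _ f.2⟩
  have : Nonempty K := ⟨⟨mk f0 h0, by show P _; rw [hmk']; exact h0⟩⟩
  have hΨ : ContractingWith (1/2) Ψ := by
    refine ⟨by norm_num, LipschitzWith.of_dist_le_mul fun f g => ?_⟩
    rw [Subtype.dist_eq, Subtype.dist_eq]
    have e : ((1/2 : NNReal) : ℝ) * dist f.1 g.1 = dist f.1 g.1 / 2 := by push_cast; ring
    rw [e]
    rw [BoundedContinuousFunction.dist_le (by positivity)]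
    intro z
    rw [dist_eq_norm]
    exact hlip f.1 g.1 _ f.2 g.2 dist_nonneg (fun z => by rw [← dist_eq_norm]; exact BoundedContinuousFunction.dist_coe_le_dist z) z
  refine ⟨hΨ.fixedPoint.1, hΨ.fixedPoint.2, ?_⟩
  have := hΨ.fixedPoint_isFixedPt
  have h2 : (Ψ hΨ.fixedPoint).1 = hΨ.fixedPoint.1 := congrArg Subtype.val this
  exact congrArg (fun f : BoundedContinuousFunction Z W => (f : Z → W)) h2

lemma exists_delta {K ρ : ℝ} (b : ℝ) (hρ : 0 < ρ) {d1 : ℝ} (hd : 0 < d1) : ∃ δ, 0 < δ ∧ δ < d1 ∧ δ ≤ 1 ∧ ∀ t, 0 ≤ t → t ≤ δ → t * b ≤ ρ ∧ √(t * K) * b ≤ ρ := by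
  have h1 : Continuous fun t : ℝ => t * b := by fun_prop
  have h2 : Continuous fun t : ℝ => √(t * K) * b := by fun_prop
  have e1 := (h1.tendsto 0).eventually (gt_mem_nhds (show (0:ℝ) * b < ρ by simpa))
  have e2 := (h2.tendsto 0).eventually (gt_mem_nhds (show √((0:ℝ) * K) * b < ρ by simpa))
  obtain ⟨r, hr, H⟩ := Metric.eventually_nhds_iff.1 (e1.and e2)
  refine ⟨min (r / 2) (min (d1/2) 1), by positivity, ?_, ?_, fun t h0 ht => ?_⟩
  · exact ((min_le_right _ _).trans (min_le_left _ _)).trans_lt (by linarith)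
  · exact (min_le_right _ _).trans (min_le_right _ _)
  · have := @H t (by rw [Real.dist_eq, sub_zero, abs_of_nonneg h0]; exact (ht.trans (min_le_left _ _)).trans_lt (by linarith))
    exact ⟨this.1.le, this.2.le⟩

variable {m : ℕ}

lemma marg_close {u u' : Spc m → ℝ} (hu : Continuous u) (hu' : Continuous u') {R : ℝ} (bu : ∀ x, |u x| ≤ R) (bu' : ∀ x, |u' x| ≤ R) {ρ : ℝ} (h : ∀ x, |u x - u' x| ≤ ρ) (x1 : ℝ) : marg u' x1 - ρ ≤ marg u x1 := by
  have := fin_cube1 (m := m)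
  have hv : (volume : Measure (Fin m → ℝ)).real (cube1 m) = 1 := by rw [measureReal_def, vol_cube1]; simp
  have hi : ∀ {u : Spc m → ℝ}, Continuous u → (∀ x, |u x| ≤ R) → IntegrableOn (fun y => u (x1, y)) (cube1 m) := fun hu bu =>
    Integrable.mono' (integrable_const R) (hu.comp (by fun_prop : Continuous fun y : Fin m → ℝ => (x1, y))).aestronglyMeasurable (ae_of_all _ fun y => bu _)
  have : marg u' x1 - ρ = ∫ y in cube1 m, (u' (x1, y) - ρ) := by
    rw [integral_sub (hi hu' bu') (integrable_const _), setIntegral_const, hv]; simp [marg]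
  rw [this]
  refine integral_mono ((hi hu' bu').sub (integrable_const _)) (hi hu bu) fun y => ?_
  have := (abs_le.1 (h (x1, y))).1
  show _ - _ ≤ _
  linarith

def cl (δ t : ℝ) : ℝ := max 0 (min δ t)
lemma cl_cont (δ : ℝ) : Continuous (cl δ) := by unfold cl; fun_prop
lemma cl_nn (δ t : ℝ) : 0 ≤ cl δ t := le_max_left _ _
lemma cl_le {δ : ℝ} (h : 0 ≤ δ) (t : ℝ) : cl δ t ≤ δ := max_le h (min_le_left _ _)
lemma cl_id {δ t : ℝ} (h : 0 ≤ t) (h' : t ≤ δ) : cl δ t = t := by unfold cl; rw [min_eq_right h', max_eq_right h]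

def Fs (V : Spc m → ℝ) (u : ℝ → Spc m → ℝ) (g : ℝ → Spc m → Du m) : ℝ → Spc m → ℝ := fun s => FT V (u s) (g s)

structure Cur (R c : ℝ) (u : ℝ → Spc m → ℝ) (g : ℝ → Spc m → Du m) : Prop where
  a : ∀ t, Adm R c (u t) (g t)
  pu : ∀ t, Per (u t)
  pg : ∀ t, Per (g t)
  cu : Continuous fun z : ℝ × Spc m => u z.1 z.2
  cg : Continuous fun z : ℝ × Spc m => g z.1 z.2

lemma Cur.bc {V : Spc m → ℝ} {R c B : ℝ} {u : ℝ → Spc m → ℝ} {g : ℝ → Spc m → Du m} (h : Cur R c u g) (hG : GoodC R c (FT V)) (hB : GoodB R c B (FT V)) : BC (Fs V u g) B :=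
  ⟨hG u g h.a h.cu h.cg, fun t x => hB.2.1 _ _ (h.a t) x⟩

def Sol (V : Spc m → ℝ) (β δ : ℝ) (ψ0 : Spc m → ℝ) (u : ℝ → Spc m → ℝ) (g : ℝ → Spc m → Du m) : Prop :=
  ∀ t ∈ Icc 0 δ, ∀ x, u t x = HU β ψ0 t x + DU β (Fs V u g) t x ∧ g t x = HU β (grd ψ0) t x + DG β (Fs V u g) t x

lemma cur_exist {V : Spc m → ℝ} {β S c : ℝ} (hV : ContDiff ℝ 2 V) (hp : Per V) (hβ : 0 < β) {ψ0 : Spc m → ℝ} (hc : Continuous ψ0) (hg : Continuous (grd ψ0)) (hS : ∀ x, |ψ0 x| ≤ S) (hS' : ∀ x, ‖grd ψ0 x‖ ≤ S)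
    (hper : Per ψ0) (hc0 : 0 < c) (hm : ∀ x1, 2 * c ≤ marg ψ0 x1) :
    ∃ δ, 0 < δ ∧ δ ≤ 1 ∧ ∃ u g, Cur (S + 1) c u g ∧ Sol V β δ ψ0 u g := by
  have hS0 : 0 ≤ S := (abs_nonneg _).trans (hS 0)
  have hperg := per_grd hper
  obtain ⟨⟨B, hB⟩, hG⟩ := FT_good hV hp (R := S + 1) (c := c) (by linarith) hc0
  have hB0 := hB.1
  set ρ := min c 1 with hρ
  have hρ0 : 0 < ρ := lt_min hc0 one_pos
  have hρ1 : ρ ≤ 1 := min_le_right _ _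
  have hρc : ρ ≤ c := min_le_left _ _
  have HUc := HU_cont (β := β) hc hS
  have HUg := HU_cont (β := β) hg hS'
  obtain ⟨d1, hd1, H1⟩ := per_unif HUc (HU_per hper) 0 (half_pos hρ0)
  obtain ⟨d2, hd2, H2⟩ := per_unif HUg (HU_per hperg) 0 (half_pos hρ0)
  obtain ⟨δ, hδ, hδd, hδ1, H⟩ := exists_delta (K := β) (B * (1 + I1 m)) (half_pos hρ0) (lt_min hd1 hd2)
  have hI := I1_nn (m := m)
  have HB : ∀ t, 0 ≤ t → t ≤ δ → t * B ≤ ρ/2 ∧ √(t * β) * I1 m * B ≤ ρ/2 := fun t h0 h1 => by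
    obtain ⟨a, b⟩ := H t h0 h1
    have := Real.sqrt_nonneg (t * β)
    constructor
    · have : 0 ≤ t * (B * I1 m) := by positivity
      nlinarith
    · have : 0 ≤ √(t * β) * B := by positivity
      nlinarith
  let P : (ℝ × Spc m → ℝ × Du m) → Prop := fun f => Continuous f ∧ (∀ z, |(f z).1 - ψ0 z.2| ≤ ρ) ∧ (∀ z, ‖(f z).2 - grd ψ0 z.2‖ ≤ ρ) ∧ ∀ t x k, f (t, x + lz k) = f (t, x)
  have hcur : ∀ f, P f → Cur (S + 1) c (fun t x => (f (t, x)).1) (fun t x => (f (t, x)).2) := by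
    intro f ⟨h1, h2, h3, h4⟩
    have hc1 : ∀ t, Continuous fun x : Spc m => (f (t, x)).1 := fun t => by fun_prop
    have hb1 : ∀ t x, |(f (t, x)).1| ≤ S + 1 := fun t x => by
      have a := h2 (t, x)
      have b := hS x
      simp only [abs_le] at a b ⊢
      constructor <;> linarith [a.1, a.2, b.1, b.2]
    refine ⟨fun t => ⟨hc1 t, by fun_prop, hb1 t, fun x => ?_, fun x1 => ?_⟩, fun t x k => by simp only [h4], fun t x k => by simp only [h4], by fun_prop, by fun_prop⟩
    · have a := h3 (t, x)
      have b := hS' x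
      calc _ = ‖((f (t, x)).2 - grd ψ0 x) + grd ψ0 x‖ := by rw [sub_add_cancel]
        _ ≤ _ := (norm_add_le _ _).trans (by simp only at a; linarith)
    · have := marg_close (hc1 t) hc (hb1 t) (fun x => (hS x).trans (by linarith)) (ρ := ρ) (fun x => h2 (t, x)) x1
      linarith [hm x1]
  let FF := fun f : ℝ × Spc m → ℝ × Du m => Fs V (fun t x => (f (t, x)).1) (fun t x => (f (t, x)).2)
  have hbc : ∀ f, P f → BC (FF f) B := fun f hf => (hcur f hf).bc hG hB
  have hfper : ∀ f, P f → ∀ s, Per (FF f s) := fun f hf s => FT_per hp ((hcur f hf).pu s) ((hcur f hf).pg s)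
  let Φ := fun (f : ℝ × Spc m → ℝ × Du m) (z : ℝ × Spc m) => ((HU β ψ0 (cl δ z.1) z.2 + DU β (FF f) (cl δ z.1) z.2, HU β (grd ψ0) (cl δ z.1) z.2 + DG β (FF f) (cl δ z.1) z.2) : ℝ × Du m)
  have ccl : Continuous fun z : ℝ × Spc m => (cl δ z.1, z.2) := ((cl_cont δ).comp continuous_fst).prodMk continuous_snd
  suffices key : ∃ f, P f ∧ Φ f = f by
    obtain ⟨f, hf, hfix⟩ := key
    refine ⟨δ, hδ, hδ1, _, _, hcur f hf, fun t ht x => ?_⟩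
    have := congrFun hfix (t, x)
    simp only [Φ, cl_id ht.1 ht.2] at this
    exact ⟨(congrArg Prod.fst this).symm, (congrArg Prod.snd this).symm⟩
  refine fixpt P Φ (fun z => (ψ0 z.2, grd ψ0 z.2)) ⟨by fun_prop, by simp [hρ0.le], by simp [hρ0.le], fun t x k => by simp only [hper x k, hperg x k]⟩
    (fun f hf => hf.1) (fun f hf => ⟨S + 1, fun z => by
      have := (hcur f hf).a z.1
      exact max_le (this.bu z.2) (this.bg z.2)⟩) ?_ ?_ ?_
  · intro f g hg hf hl
    refine ⟨hg, fun z => ?_, fun z => ?_, fun t x k => ?_⟩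
    · have : Tendsto (fun n => |(f n z).1 - ψ0 z.2|) atTop (nhds |(g z).1 - ψ0 z.2|) := by
        have h := (continuous_fst.tendsto _).comp (hl z)
        exact (h.sub_const _).abs
      exact le_of_tendsto' this fun n => (hf n).2.1 z
    · have : Tendsto (fun n => ‖(f n z).2 - grd ψ0 z.2‖) atTop (nhds ‖(g z).2 - grd ψ0 z.2‖) := by
        have h := (continuous_snd.tendsto _).comp (hl z)
        exact (h.sub_const _).norm
      exact le_of_tendsto' this fun n => (hf n).2.2.1 z
    · refine tendsto_nhds_unique (hl (t, x + lz k)) ?_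
      simp only [(hf _).2.2.2 t x k]
      exact hl _
  · intro f hf
    have hF := hbc f hf
    have ht := fun z : ℝ × Spc m => cl_nn δ z.1
    have ht' := fun z : ℝ × Spc m => cl_le hδ.le z.1
    have hcl : ∀ z : ℝ × Spc m, |cl δ z.1 - 0| < d1 ∧ |cl δ z.1 - 0| < d2 := fun z => by
      rw [sub_zero, abs_of_nonneg (ht z)]
      exact ⟨(ht' z).trans_lt (hδd.trans_le (min_le_left _ _)), (ht' z).trans_lt (hδd.trans_le (min_le_right _ _))⟩
    refine ⟨?_, fun z => ?_, fun z => ?_, fun t x k => ?_⟩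
    · exact ((HUc.comp ccl).add ((DU_cont hF).comp ccl)).prodMk ((HUg.comp ccl).add ((DG_cont hF).comp ccl))
    · have a := H1 _ (hcl z).1 z.2
      rw [HU_zero, Real.norm_eq_abs] at a
      have b := DU_le (β := β) (ht z) z.2 (fun s x _ _ => hF.b s x)
      have d := (HB _ (ht z) (ht' z)).1
      show |HU β ψ0 (cl δ z.1) z.2 + DU β (FF f) (cl δ z.1) z.2 - ψ0 z.2| ≤ ρ
      rw [show HU β ψ0 (cl δ z.1) z.2 + DU β (FF f) (cl δ z.1) z.2 - ψ0 z.2 = (HU β ψ0 (cl δ z.1) z.2 - ψ0 z.2) + DU β (FF f) (cl δ z.1) z.2 by ring]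
      exact (abs_add_le _ _).trans (by linarith)
    · have a := H2 _ (hcl z).2 z.2
      rw [HU_zero] at a
      have b := DG_le (β := β) (ht z) z.2 (fun s x _ _ => hF.b s x)
      have d := (HB _ (ht z) (ht' z)).2
      show ‖HU β (grd ψ0) (cl δ z.1) z.2 + DG β (FF f) (cl δ z.1) z.2 - grd ψ0 z.2‖ ≤ ρ
      rw [show HU β (grd ψ0) (cl δ z.1) z.2 + DG β (FF f) (cl δ z.1) z.2 - grd ψ0 z.2 = (HU β (grd ψ0) (cl δ z.1) z.2 - grd ψ0 z.2) + DG β (FF f) (cl δ z.1) z.2 by abel]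
      exact (norm_add_le _ _).trans (by linarith)
    · have e1 := HU_per (β := β) hper (cl δ t) x k
      have e2 := HU_per (β := β) hperg (cl δ t) x k
      have e3 := DU_per (β := β) (hfper f hf) (cl δ t) x k
      have e4 := DG_per (β := β) (hfper f hf) (cl δ t) x k
      simp only [Φ, e1, e2, e3, e4]
  · intro f f' d hf hf' hd hdist z
    have hF := hbc f hf
    have hF' := hbc f' hf'
    have ht := cl_nn δ z.1
    have ht' := cl_le hδ.le z.1
    have hdf : ∀ s x, |FF f s x - FF f' s x| ≤ B * d := fun s x =>
      hB.2.2 _ _ _ _ d ((hcur f hf).a s) ((hcur f' hf').a s) hd (fun y => (le_max_left _ _).trans (hdist (s, y))) (fun y => (le_max_right _ _).trans (hdist (s, y))) x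
    have hbb := HB _ ht ht'
    have a1 : |DU β (FF f) (cl δ z.1) z.2 - DU β (FF f') (cl δ z.1) z.2| ≤ d / 2 := by
      rw [DU_sub hF hF']
      refine (DU_le ht z.2 fun s x _ _ => hdf s x).trans ?_
      nlinarith [hbb.1]
    have a2 : ‖DG β (FF f) (cl δ z.1) z.2 - DG β (FF f') (cl δ z.1) z.2‖ ≤ d / 2 := by
      rw [DG_sub hF hF']
      refine (DG_le ht z.2 fun s x _ _ => hdf s x).trans ?_
      nlinarith [hbb.2]
    refine max_le ?_ ?_
    · show |(HU β ψ0 (cl δ z.1) z.2 + DU β (FF f) (cl δ z.1) z.2) - (HU β ψ0 (cl δ z.1) z.2 + DU β (FF f') (cl δ z.1) z.2)| ≤ _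
      rw [add_sub_add_left_eq_sub]
      exact a1
    · show ‖(HU β (grd ψ0) (cl δ z.1) z.2 + DG β (FF f) (cl δ z.1) z.2) - (HU β (grd ψ0) (cl δ z.1) z.2 + DG β (FF f') (cl δ z.1) z.2)‖ ≤ _
      rw [add_sub_add_left_eq_sub]
      exact a2
end fx

section un
variable {m : ℕ}

lemma exp_neg_le {x : ℝ} (hx : 0 < x) : Real.exp (-x) ≤ x ^ (-(1/4) : ℝ) := by
  rw [Real.rpow_def_of_pos hx, Real.exp_le_exp]
  have := Real.log_le_sub_one_of_pos hx
  rcases le_or_gt 0 (Real.log x) with h | h <;> linarith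

lemma DU_le' {β : ℝ} {F : ℝ → Spc m → ℝ} {b : ℝ → ℝ} {t : ℝ} (ht : 0 ≤ t) (x : Spc m) (hb : ∀ θ ∈ Ioc (0:ℝ) 1, ∀ x, |F (t * (1 - θ)) x| ≤ b θ) (hbi : IntegrableOn b (Ioc 0 1)) :
    |DU β F t x| ≤ t * ∫ θ in Ioc (0:ℝ) 1, b θ := by
  have := TO_le (β := β) (F := F) (om := fun _ => 1) (int_Gs (m := m)) (b := b) (t := t) x hb (by simpa using hbi)
  have e : ∫ w, ‖Gs m w‖ = 1 := by
    rw [← integral_Gs (m := m)]; congr 1; ext w; exact Real.norm_of_nonneg (Gs_pos w).le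
  rw [e] at this
  simp at this
  rw [DU, abs_mul, abs_of_nonneg ht]
  gcongr

lemma wt_bound {β : ℝ} {F : ℝ → Spc m → ℝ} {A k t : ℝ} (hA : 0 ≤ A) (hk : 0 < k) (ht : 0 ≤ t) (ht1 : t ≤ 1)
    (hF : ∀ s x, 0 ≤ s → s ≤ t → |F s x| ≤ A * Real.exp (k * s)) (x : Spc m) :
    |DU β F t x| ≤ A * Real.exp (k * t) * (k ^ (-(1/4) : ℝ) * (2 + 2 * (√β * I1 m))) ∧
    ‖DG β F t x‖ ≤ A * Real.exp (k * t) * (k ^ (-(1/4) : ℝ) * (2 + 2 * (√β * I1 m))) := by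
  have hI := I1_nn (m := m)
  rcases ht.eq_or_lt with rfl | h0
  · have hb : ∀ s (x : Spc m), 0 ≤ s → s ≤ 0 → |F s x| ≤ A := fun s x h1 h2 => by
      have := hF s x h1 h2
      rw [le_antisymm h2 h1] at this ⊢
      simpa using this
    have a := DU_le (β := β) le_rfl x hb
    have b := DG_le (β := β) le_rfl x hb
    simp only [zero_mul, Real.sqrt_zero] at a b
    have : 0 ≤ A * Real.exp (k * 0) * (k ^ (-(1/4) : ℝ) * (2 + 2 * (√β * I1 m))) := by positivity
    exact ⟨a.trans this, b.trans this⟩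
  set Q := A * Real.exp (k * t) * (k * t) ^ (-(1/4) : ℝ) with hQ
  have hQ0 : 0 ≤ Q := by positivity
  have hb : ∀ θ ∈ Ioc (0:ℝ) 1, ∀ x, |F (t * (1 - θ)) x| ≤ Q * θ ^ (-(1/4) : ℝ) := by
    intro θ hθ x
    refine (hF _ x (by nlinarith [hθ.1, hθ.2]) (by nlinarith [hθ.1, hθ.2])).trans ?_
    rw [show k * (t * (1 - θ)) = k * t + -(k * t * θ) by ring, Real.exp_add, hQ]
    have := exp_neg_le (x := k * t * θ) (by have := hθ.1; positivity)
    rw [Real.mul_rpow (by positivity) hθ.1.le] at this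
    calc _ = A * Real.exp (k * t) * Real.exp (-(k * t * θ)) := by ring
      _ ≤ A * Real.exp (k * t) * ((k * t) ^ (-(1/4) : ℝ) * θ ^ (-(1/4) : ℝ)) := by gcongr
      _ = _ := by ring
  have i1 : IntegrableOn (fun θ : ℝ => Q * θ ^ (-(1/4) : ℝ)) (Ioc 0 1) := (int_pw (by norm_num)).const_mul Q
  have ea : ∀ θ ∈ Ioc (0:ℝ) 1, omh θ * (Q * θ ^ (-(1/4) : ℝ)) = Q * θ ^ (-(3/4) : ℝ) := fun θ hθ => by
    unfold omh
    rw [show (-(3/4) : ℝ) = -(1/2) + -(1/4) by norm_num, Real.rpow_add hθ.1]; ring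
  have i2 : IntegrableOn (fun θ : ℝ => omh θ * (Q * θ ^ (-(1/4) : ℝ))) (Ioc 0 1) :=
    (integrableOn_congr_fun ea measurableSet_Ioc).2 ((int_pw (by norm_num)).const_mul Q)
  have a := DU_le' (β := β) ht x hb i1
  have b := DG_le' (β := β) ht x hb i2
  rw [setIntegral_congr_fun measurableSet_Ioc ea, integral_const_mul, val_pw (by norm_num)] at b
  rw [integral_const_mul, val_pw (by norm_num)] at a
  have kt : (k * t) ^ (-(1/4) : ℝ) * √t ≤ k ^ (-(1/4) : ℝ) := by
    rw [Real.mul_rpow hk.le ht, mul_assoc, Real.sqrt_eq_rpow, ← Real.rpow_add h0]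
    have : t ^ (-(1/4) + 1/2 : ℝ) ≤ 1 := Real.rpow_le_one ht ht1 (by norm_num)
    have h3 : 0 ≤ k ^ (-(1/4) : ℝ) := by positivity
    nlinarith
  have hst : t ≤ √t := by
    have h1 : √t ≤ 1 := Real.sqrt_le_one.2 ht1
    nlinarith [Real.sq_sqrt ht, Real.sqrt_nonneg t]
  have hQt : Q * √t ≤ A * Real.exp (k * t) * k ^ (-(1/4) : ℝ) := by
    rw [hQ, mul_assoc]; gcongr
  have hE : 0 ≤ √β * I1 m := by positivity
  constructor
  · refine a.trans ?_
    have h1 : t * Q ≤ Q * √t := by nlinarith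
    have h2 : 0 ≤ A * Real.exp (k * t) * k ^ (-(1/4) : ℝ) * (√β * I1 m) := by positivity
    have h3 : 0 ≤ t * Q := by positivity
    norm_num
    nlinarith
  · refine b.trans ?_
    rw [Real.sqrt_mul ht]
    have h1 := mul_le_mul_of_nonneg_right hQt hE
    have h2 : 0 ≤ A * Real.exp (k * t) * k ^ (-(1/4) : ℝ) := by positivity
    norm_num
    nlinarith

lemma exists_k (E : ℝ) : ∃ k : ℝ, 0 < k ∧ E * k ^ (-(1/4) : ℝ) ≤ 1/2 := by
  have h := (tendsto_rpow_neg_atTop (show (0:ℝ) < 1/4 by norm_num)).const_mul E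
  rw [mul_zero] at h
  obtain ⟨k, h1, h2⟩ := ((h.eventually (gt_mem_nhds (show (0:ℝ) < 1/2 by norm_num))).and (eventually_gt_atTop 0)).exists
  exact ⟨k, h2, h1.le⟩

lemma Adm.mono {R R' c c' : ℝ} {u : Spc m → ℝ} {g : Spc m → Du m} (h : Adm R c u g) (hR : R ≤ R') (hc : c' ≤ c) : Adm R' c' u g :=
  ⟨h.cu, h.cg, fun x => (h.bu x).trans hR, fun x => (h.bg x).trans hR, fun x => hc.trans (h.mg x)⟩

lemma Cur.mono {R R' c c' : ℝ} {u : ℝ → Spc m → ℝ} {g : ℝ → Spc m → Du m} (h : Cur R c u g) (hR : R ≤ R') (hc : c' ≤ c) : Cur R' c' u g :=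
  ⟨fun t => (h.a t).mono hR hc, h.pu, h.pg, h.cu, h.cg⟩

lemma cur_unique {V : Spc m → ℝ} {β R c δ : ℝ} (hV : ContDiff ℝ 2 V) (hp : Per V) {ψ0 : Spc m → ℝ} (hδ1 : δ ≤ 1) (hR : 0 ≤ R) (hc : 0 < c)
    {u u' : ℝ → Spc m → ℝ} {g g' : ℝ → Spc m → Du m} (h : Cur R c u g) (h' : Cur R c u' g') (hs : Sol V β δ ψ0 u g) (hs' : Sol V β δ ψ0 u' g') :
    ∀ t ∈ Icc 0 δ, ∀ x, u t x = u' t x := by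
  obtain ⟨⟨B, hB⟩, hG⟩ := FT_good hV hp hR hc
  obtain ⟨k, hk, hkE⟩ := exists_k (B * (2 + 2 * (√β * I1 m)))
  have hF := h.bc hG hB
  have hF' := h'.bc hG hB
  have hB0 := hB.1
  have key : ∀ n : ℕ, ∀ t ∈ Icc 0 δ, ∀ x, |u t x - u' t x| ≤ (2 * R * (1/2)^n) * Real.exp (k * t) ∧ ‖g t x - g' t x‖ ≤ (2 * R * (1/2)^n) * Real.exp (k * t) := by
    intro n
    induction n with
    | zero =>
      intro t ht x
      have he : 1 ≤ Real.exp (k * t) := Real.one_le_exp (mul_nonneg hk.le ht.1)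
      have a1 := (h.a t).bu x
      have a2 := (h'.a t).bu x
      have a3 := (h.a t).bg x
      have a4 := (h'.a t).bg x
      constructor
      · refine (abs_sub _ _).trans ?_
        rw [pow_zero]; nlinarith
      · refine (norm_sub_le _ _).trans ?_
        rw [pow_zero]; nlinarith
    | succ n ih =>
      intro t ht x
      have hd : ∀ s (x : Spc m), 0 ≤ s → s ≤ t → |Fs V u g s x - Fs V u' g' s x| ≤ (B * (2 * R * (1/2)^n)) * Real.exp (k * s) := fun s x h0 h1 => by
        have := ih s ⟨h0, h1.trans ht.2⟩
        have h2 := hB.2.2 _ _ _ _ ((2 * R * (1/2)^n) * Real.exp (k * s)) (h.a s) (h'.a s) (by positivity) (fun y => (this y).1) (fun y => (this y).2) x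
        rw [mul_assoc]; exact h2
      have := wt_bound (β := β) (F := fun s y => Fs V u g s y - Fs V u' g' s y) (by positivity) hk ht.1 (ht.2.trans hδ1) hd x
      rw [← DU_sub hF hF', ← DG_sub hF hF'] at this
      have le : B * (2 * R * (1/2)^n) * Real.exp (k * t) * (k ^ (-(1/4) : ℝ) * (2 + 2 * (√β * I1 m))) ≤ (2 * R * (1/2)^(n+1)) * Real.exp (k * t) := by
        have : 0 ≤ 2 * R * (1/2)^n * Real.exp (k * t) := by positivity
        have h2 := mul_le_mul_of_nonneg_left hkE this
        rw [pow_succ]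
        calc _ = 2 * R * (1/2)^n * Real.exp (k * t) * (B * (2 + 2 * (√β * I1 m)) * k ^ (-(1/4) : ℝ)) := by ring
          _ ≤ _ := h2
          _ = _ := by ring
      obtain ⟨e1, e2⟩ := hs t ht x
      obtain ⟨e3, e4⟩ := hs' t ht x
      rw [e1, e2, e3, e4, add_sub_add_left_eq_sub, add_sub_add_left_eq_sub]
      exact ⟨this.1.trans le, this.2.trans le⟩
  intro t ht x
  have lim : Tendsto (fun n : ℕ => (2 * R * (1/2 : ℝ)^n) * Real.exp (k * t)) atTop (nhds 0) := by
    have := ((tendsto_pow_atTop_nhds_zero_of_lt_one (r := (1/2 : ℝ)) (by norm_num) (by norm_num)).const_mul (2 * R)).mul_const (Real.exp (k * t))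
    simpa using this
  have := ge_of_tendsto' lim fun n => (key n t ht x).1
  have h0 := abs_nonpos_iff.1 this
  linarith
end un

section cw
variable {m : ℕ}

lemma eLp_le {W : Type*} [NormedAddCommGroup W] {p S : ℝ} (hp : 1 ≤ p) {f : Spc m → W} (h : ∀ x, ‖f x‖ ≤ S) : eLpNorm f (ENNReal.ofReal p) (μT m) ≤ ENNReal.ofReal S := by
  have := prob_μT m
  have := eLpNorm_le_of_ae_bound (p := ENNReal.ofReal p) (μ := μT m) (ae_of_all _ h)
  simpa using this

lemma WN_le {σ p : ℝ} (h2 : Hyp2 m σ p) {f : Spc m → ℝ} {S ε : ℝ} (hS : 0 ≤ S) (hε : 0 < ε) (hb : ∀ x, |f x| ≤ S) (hg : ∀ x, ‖grd f x‖ ≤ S) :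
    WNorm σ p f ≤ ENNReal.ofReal S + ENNReal.ofReal S + (PN p (qq m σ p) ε (grd f) + ENNReal.ofReal ((2 * S) ^ p * ε ^ (-(qq m σ p)))) ^ (1/p) := by
  have hp := hyp2_one h2
  have hq := hyp2_q h2
  rw [WNorm_eq h2, gagl_eq, Jq_cube]
  refine add_le_add (add_le_add (eLp_le hp.le hb) (eLp_le hp.le fun x => by rw [norm_norm]; exact hg x)) ?_
  refine ENNReal.rpow_le_rpow ?_ (by positivity)
  exact Jq_le (by linarith) (by have : (0:ℝ) ≤ m := Nat.cast_nonneg m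
                                linarith) hε hS (measurable_grd f) hg

section gen
variable {W : Type*} [NormedAddCommGroup W] [NormedSpace ℝ W] [CompleteSpace W] [SecondCountableTopology W] [MeasurableSpace W] [BorelSpace W]

lemma PN_unif {β : ℝ} {p q α A S : ℝ} (hp : 1 ≤ p) (hα : q - α * p < m + 1) (hA : 0 ≤ A) {g0 : Spc m → W} (hper : Per g0) (hc : Continuous g0) (hS : ∀ x, ‖g0 x‖ ≤ S) (hfin : PN p q 1 g0 < ⊤)
    (D : ℝ → Spc m → W) (hD : ∀ t, 0 ≤ t → t ≤ 1 → Continuous (D t)) (hH : ∀ t, 0 ≤ t → t ≤ 1 → ∀ x y, ‖D t x - D t y‖ ≤ A * ‖x - y‖ ^ α) {η : ℝ≥0∞} (hη : 0 < η) :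
    ∃ ε, 0 < ε ∧ ε ≤ 1 ∧ ∀ t, 0 ≤ t → t ≤ 1 → PN p q ε (fun x => HU β g0 t x + D t x) < η := by
  have hp0 : 0 < p := by linarith
  obtain ⟨η1, hη1, hlt⟩ := ENNReal.exists_nnreal_pos_mul_lt (a := ENNReal.ofReal (2 ^ p) * ((SL m).card + 1)) (b := η) (by finiteness) hη.ne'
  have hη1' : (0 : ℝ≥0∞) < η1 := by exact_mod_cast hη1
  obtain ⟨ε1, h1, h1', H1⟩ := PN_small p q hc.measurable hfin η1 hη1'
  obtain ⟨ε2, h2, h2', H2⟩ := PN_holder (W := W) (m := m) hp0 hα hA η1 hη1'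
  refine ⟨min ε1 ε2, lt_min h1 h2, (min_le_left _ _).trans h1', fun t t0 t1 => ?_⟩
  have cH : Continuous (HU β g0 t) := (HU_cont (β := β) hc hS).comp (by fun_prop : Continuous fun x : Spc m => (t, x))
  refine lt_of_le_of_lt (PN_add hp0 _ cH.measurable (hD t t0 t1).measurable) (lt_of_le_of_lt ?_ hlt)
  have a := HU_PN (β := β) (q := q) hp (min ε1 ε2) hper hc.measurable hS t
  have b := (PN_mono p q g0 (min_le_left ε1 ε2)).trans H1.le
  have c := (PN_mono p q (D t) (min_le_right ε1 ε2)).trans (H2 (D t) fun x y _ => hH t t0 t1 x y).le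
  calc _ ≤ ENNReal.ofReal (2 ^ p) * ((SL m).card * (η1 : ℝ≥0∞) + η1) := by
        gcongr
        exact a.trans (by gcongr)
    _ = _ := by ring

lemma PN_sub {p q ε : ℝ} (hp : 0 < p) {g1 g2 : Spc m → W} (h1 : Measurable g1) (h2 : Measurable g2) {η : ℝ≥0∞} (a1 : PN p q ε g1 ≤ η) (a2 : PN p q ε g2 ≤ η) :
    PN p q ε (fun x => g1 x - g2 x) ≤ ENNReal.ofReal (2 ^ p) * (η + η) := by
  have := PN_add (q := q) hp ε h1 h2.neg
  rw [show (fun x => g1 x - g2 x) = fun x => g1 x + (-g2) x by ext x; simp [sub_eq_add_neg]]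
  refine this.trans ?_
  gcongr
  exact (PN_neg p q ε g2).le.trans a2
end gen

lemma exists_S {p K Y d : ℝ} (hp : 0 < p) (hY : 0 < Y) (hd : 0 < d) : ∃ S, 0 < S ∧ S ≤ d ∧ (2 * S) ^ p * K ≤ Y := by
  have h1 : Continuous fun S : ℝ => (2 * S) ^ p * K := ((continuous_const.mul continuous_id).rpow_const fun _ => Or.inr hp.le).mul_const K
  have e1 := (h1.tendsto 0).eventually (gt_mem_nhds (show (2 * (0:ℝ)) ^ p * K < Y by simpa [Real.zero_rpow hp.ne']))
  obtain ⟨r, hr, H⟩ := Metric.eventually_nhds_iff.1 e1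
  refine ⟨min (r / 2) d, by positivity, min_le_right _ _, ?_⟩
  refine (@H _ ?_).le
  rw [Real.dist_eq, sub_zero, abs_of_pos (by positivity)]
  exact (min_le_left _ _).trans_lt (by linarith)

lemma curve_contW {σ p δ : ℝ} (h2 : Hyp2 m σ p) {R c : ℝ} {u : ℝ → Spc m → ℝ} {g : ℝ → Spc m → Du m} (h : Cur R c u g)
    (hd : ∀ t ∈ Icc 0 δ, ∀ x, HasFDerivAt (u t) (g t x) x)
    (hPN : ∀ η : ℝ≥0∞, 0 < η → ∃ ε, 0 < ε ∧ ε ≤ 1 ∧ ∀ t ∈ Icc 0 δ, PN p (qq m σ p) ε (g t) < η) : ContW σ p (Icc 0 δ) u := by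
  have hp := hyp2_one h2
  have hp0 : 0 < p := by linarith
  intro t ht ε0 hε0
  set Y := (ε0/4) ^ p / 2 with hY
  have hY0 : 0 < Y := by positivity
  obtain ⟨η, hη, hlt⟩ := ENNReal.exists_nnreal_pos_mul_lt (a := ENNReal.ofReal (2 ^ p) * 2) (b := ENNReal.ofReal Y) (by finiteness) (by simpa using hY0)
  obtain ⟨ε, hε, hε1, HP⟩ := hPN η (by exact_mod_cast hη)
  obtain ⟨S, hS, hSd, hSY⟩ := exists_S (K := ε ^ (-(qq m σ p))) hp0 hY0 (show 0 < ε0/8 by positivity)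
  obtain ⟨d1, hd1, H1⟩ := per_unif h.cu h.pu t hS
  obtain ⟨d2, hd2, H2⟩ := per_unif h.cg h.pg t hS
  refine ⟨min d1 d2, lt_min hd1 hd2, fun t' ht' hlt' => ?_⟩
  have hgr : grd (fun x => u t' x - u t x) = fun x => g t' x - g t x := by
    funext x
    exact ((hd t' ht' x).sub (hd t ht x)).fderiv
  have := WN_le h2 (f := fun x => u t' x - u t x) hS.le hε (fun x => (H1 t' (hlt'.trans_le (min_le_left _ _)) x).le) (fun x => by rw [hgr]; exact (H2 t' (hlt'.trans_le (min_le_right _ _)) x).le)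
  refine lt_of_le_of_lt this ?_
  have hPs : PN p (qq m σ p) ε (grd fun x => u t' x - u t x) ≤ ENNReal.ofReal Y := by
    rw [hgr]
    refine (PN_sub hp0 (h.a t').cg.measurable (h.a t).cg.measurable (HP t' ht').le (HP t ht).le).trans (le_trans (le_of_eq ?_) hlt.le)
    ring
  have h3 : (PN p (qq m σ p) ε (grd fun x => u t' x - u t x) + ENNReal.ofReal ((2 * S) ^ p * ε ^ (-(qq m σ p)))) ^ (1/p) ≤ ENNReal.ofReal (ε0/4) := by
    calc _ ≤ (ENNReal.ofReal Y + ENNReal.ofReal Y) ^ (1/p) := by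
          refine ENNReal.rpow_le_rpow (add_le_add hPs (ENNReal.ofReal_le_ofReal hSY)) (by positivity)
      _ = _ := by
          rw [← ENNReal.ofReal_add hY0.le hY0.le, show Y + Y = (ε0/4)^p by rw [hY]; ring, ENNReal.ofReal_rpow_of_nonneg (by positivity) (by positivity), ← Real.rpow_mul (by positivity), mul_one_div_cancel hp0.ne', Real.rpow_one]
  calc _ ≤ ENNReal.ofReal (ε0/8) + ENNReal.ofReal (ε0/8) + ENNReal.ofReal (ε0/4) := by
        gcongr
    _ = ENNReal.ofReal (ε0/2) := by
        rw [← ENNReal.ofReal_add (by positivity) (by positivity), ← ENNReal.ofReal_add (by positivity) (by positivity)]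
        congr 1; ring
    _ < _ := (ENNReal.ofReal_lt_ofReal_iff hε0).2 (by linarith)

lemma curve_memW {σ p δ : ℝ} (h2 : Hyp2 m σ p) {R c : ℝ} (hc : 0 < c) (hR : 0 ≤ R) {u : ℝ → Spc m → ℝ} {g : ℝ → Spc m → Du m} (h : Cur R c u g)
    (hd : ∀ t ∈ Icc 0 δ, ∀ x, HasFDerivAt (u t) (g t x) x)
    (hPN : ∀ η : ℝ≥0∞, 0 < η → ∃ ε, 0 < ε ∧ ε ≤ 1 ∧ ∀ t ∈ Icc 0 δ, PN p (qq m σ p) ε (g t) < η) (t : ℝ) (ht : t ∈ Icc 0 δ) : MemD σ p (u t) := by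
  have hp := hyp2_one h2
  have hp0 : 0 < p := by linarith
  have hgr : grd (u t) = g t := funext fun x => (hd t ht x).fderiv
  refine ⟨⟨(per_iff _).2 (h.pu t), (h.a t).cu.measurable, fun _ x => (hd t ht x).differentiableAt, fun h3 => absurd h2.2.2.2 (not_lt.2 h3), ?_⟩, fun x1 => hc.trans_le ((h.a t).mg x1)⟩
  obtain ⟨ε, hε, hε1, HP⟩ := hPN 1 one_pos
  refine lt_of_le_of_lt (WN_le h2 hR hε (h.a t).bu (fun x => by rw [hgr]; exact (h.a t).bg x)) ?_
  have := HP t ht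
  rw [hgr]
  refine ENNReal.add_lt_top.2 ⟨by finiteness, ENNReal.rpow_lt_top_of_nonneg (by positivity) ?_⟩
  exact (ENNReal.add_lt_top.2 ⟨this.trans one_lt_top, ENNReal.ofReal_lt_top⟩).ne

lemma sol_deriv {V : Spc m → ℝ} {β δ S B : ℝ} (hβ : 0 < β) (hδ1 : δ ≤ 1) {ψ0 : Spc m → ℝ} (hdf : Differentiable ℝ ψ0) (hg : Continuous (grd ψ0)) (hS : ∀ x, |ψ0 x| ≤ S) (hS' : ∀ x, ‖grd ψ0 x‖ ≤ S)
    {u : ℝ → Spc m → ℝ} {g : ℝ → Spc m → Du m} (hB0 : 0 ≤ B) (hF : BC (Fs V u g) B) (hs : Sol V β δ ψ0 u g) :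
    ∀ t ∈ Icc 0 δ, ∀ x, HasFDerivAt (u t) (g t x) x := by
  intro t ht x
  have hu : u t = fun x => HU β ψ0 t x + DU β (Fs V u g) t x := funext fun x => (hs t ht x).1
  rw [(hs t ht x).2, hu]
  exact (HU_deriv hdf hg hS hS' t x).add (DU_deriv hβ hF hB0 ht.1 (ht.2.trans hδ1) x)

lemma sol_mild {V : Spc m → ℝ} {β δ S R c σ p : ℝ} (hV : ContDiff ℝ 2 V) (hp : Per V) (hβ : 0 < β) (hδ1 : δ ≤ 1) (h2 : Hyp2 m σ p) {ψ0 : Spc m → ℝ} (hw : MemW σ p ψ0) (hg : Continuous (grd ψ0)) (hS : ∀ x, |ψ0 x| ≤ S) (hS' : ∀ x, ‖grd ψ0 x‖ ≤ S)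
    {u : ℝ → Spc m → ℝ} {g : ℝ → Spc m → Du m} (hR : 0 ≤ R) (hc : 0 < c) (h : Cur R c u g) (hs : Sol V β δ ψ0 u g) : MildOnIcc V β σ p ψ0 δ u := by
  have hp1 := hyp2_one h2
  have hp0 : 0 < p := by linarith
  have hσ1 : 1 < σ := by
    have := h2.2.2.1
    have : 0 ≤ ((m:ℝ) + 1)/p := by positivity
    linarith
  have hσ2 := h2.2.2.2
  have hdf := hw.2.2.1 hσ1.le
  have hper := (per_iff _).1 hw.1
  obtain ⟨⟨B, hB⟩, hG⟩ := FT_good hV hp hR hc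
  have hF := h.bc hG hB
  have hB0 := hB.1
  have hd := sol_deriv hβ hδ1 hdf hg hS hS' hB0 hF hs
  have hfinJ : eLpNorm (fun x => ‖grd ψ0 x‖) (ENNReal.ofReal p) (μT m) < ⊤ ∧ Jq p (qq m σ p) (grd ψ0) (Kc 0 1) < ⊤ := by
    have := hw.2.2.2.2
    rw [WNorm_eq h2, gagl_eq, Jq_cube] at this
    obtain ⟨a, b⟩ := ENNReal.add_lt_top.1 this
    refine ⟨(ENNReal.add_lt_top.1 a).2, ?_⟩
    exact (ENNReal.rpow_lt_top_iff_of_pos (by positivity)).1 b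
  have hfin : PN p (qq m σ p) 1 (grd ψ0) < ⊤ := PN_fin ψ0 hper hdf p _ hp1.le (hyp2_q h2) (memLp_intOn hp1.le hfinJ.1) hfinJ.2
  have hPN : ∀ η : ℝ≥0∞, 0 < η → ∃ ε, 0 < ε ∧ ε ≤ 1 ∧ ∀ t ∈ Icc 0 δ, PN p (qq m σ p) ε (g t) < η := by
    intro η hη
    have hα0 : 0 ≤ σ/2 := by linarith
    have hα1 : σ/2 < 1 := by linarith
    have hA : ∃ A, 0 ≤ A ∧ ∀ t, 0 ≤ t → t ≤ 1 → ∀ x y, ‖DG β (Fs V u g) t x - DG β (Fs V u g) t y‖ ≤ A * ‖x - y‖ ^ (σ/2) := by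
      refine ⟨max (B * C2 m * (cb β (σ / 2) * (1 / (-((1 + σ / 2) / 2) + 1)))) 0, le_max_right _ 0, fun t t0 t1 x y => (DG_hold hβ hF hB0 hα0 hα1 t0 t1 x y).trans ?_⟩
      gcongr
      exact le_max_left _ _
    obtain ⟨A, hA0, HA⟩ := hA
    obtain ⟨ε, e1, e2, e3⟩ := PN_unif (β := β) (p := p) (q := qq m σ p) (α := σ/2) hp1.le (by unfold qq; nlinarith) hA0 (per_grd hper) hg hS' hfin (DG β (Fs V u g))
      (fun t _ _ => (DG_cont hF).comp (by fun_prop : Continuous fun x : Spc m => (t, x))) HA hη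
    refine ⟨ε, e1, e2, fun t ht => ?_⟩
    have : g t = fun x => HU β (grd ψ0) t x + DG β (Fs V u g) t x := funext fun x => (hs t ht x).2
    rw [this]
    exact e3 t ht.1 (ht.2.trans hδ1)
  refine ⟨curve_memW h2 hc hR h hd hPN, curve_contW h2 h hd hPN, fun t ht => ae_of_all _ fun x => ?_⟩
  rw [heat_HU hβ ht.1 hdf.continuous hS, (hs t ht x).1, ← DU_eq hβ ht.1]
  have : ∀ s ∈ Ioc 0 t, heatSG β (t - s) (Fop V (u s)) x = heatSG β (t - s) (Fs V u g s) x := by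
    intro s hs'
    have hsm : s ∈ Icc 0 δ := ⟨hs'.1.le, hs'.2.trans ht.2⟩
    have hgr : grd (u s) = g s := funext fun x => (hd s hsm x).fderiv
    rw [Fop_eq hV hp hR hc (fun x => (hd s hsm x).differentiableAt) (by rw [hgr]; exact h.a s), hgr]; rfl
  rw [setIntegral_congr_fun measurableSet_Ioc this]
  ring
end cw

section fin
variable {m : ℕ}

lemma joint_cont {W : Type*} [NormedAddCommGroup W] {F : ℝ → Spc m → W} (hc : ∀ t, Continuous (F t)) (hu : ∀ t, ∀ ε > 0, ∃ δ > 0, ∀ t', |t' - t| < δ → ∀ x, ‖F t' x - F t x‖ ≤ ε) :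
    Continuous fun z : ℝ × Spc m => F z.1 z.2 := by
  rw [continuous_iff_continuousAt]
  rintro ⟨t, x⟩
  rw [Metric.continuousAt_iff]
  intro ε hε
  obtain ⟨d1, hd1, H1⟩ := hu t (ε/2) (by positivity)
  obtain ⟨d2, hd2, H2⟩ := Metric.continuousAt_iff.1 ((hc t).continuousAt (x := x)) (ε/2) (by positivity)
  refine ⟨min d1 d2, lt_min hd1 hd2, fun {z} hz => ?_⟩
  rw [Prod.dist_eq, max_lt_iff] at hz
  have a := H1 z.1 (by have := hz.1.trans_le (min_le_left _ _); rwa [Real.dist_eq] at this) z.2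
  have b := H2 (x := z.2) (hz.2.trans_le (min_le_right _ _))
  rw [← dist_eq_norm] at a
  exact (dist_triangle _ (F t z.2) _).trans_lt (by linarith)

lemma per_bd2 {W : Type*} [NormedAddCommGroup W] {F : ℝ → Spc m → W} (hc : Continuous fun z : ℝ × Spc m => F z.1 z.2) (h : ∀ t, Per (F t)) (δ : ℝ) : ∃ C, 0 ≤ C ∧ ∀ t ∈ Icc 0 δ, ∀ x, ‖F t x‖ ≤ C := by
  obtain ⟨C, hC⟩ := ((isCompact_Icc (a := (0:ℝ)) (b := δ)).prod (cpt_Kc (0 : Spc m) 1)).exists_bound_of_continuousOn hc.continuousOn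
  refine ⟨max C 0, le_max_right _ _, fun t ht x => le_max_of_le_left ?_⟩
  obtain ⟨y, hy, k, rfl⟩ := per_red x
  rw [h t y k]; exact hC (t, y) ⟨ht, hy⟩

lemma marg_lb {F : ℝ → Spc m → ℝ} (hc : Continuous fun z : ℝ × Spc m => F z.1 z.2) (h : ∀ t, Per (F t)) {R : ℝ} (hb : ∀ t x, |F t x| ≤ R) {δ : ℝ} (hδ : 0 ≤ δ) (hpos : ∀ t x1, 0 < marg (F t) x1) :
    ∃ c > 0, ∀ t ∈ Icc 0 δ, ∀ x1, c ≤ marg (F t) x1 := by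
  have := fin_cube1 (m := m)
  have hI : Continuous fun z : ℝ × Spc m => Im (F z.1) z.2 := by
    refine continuous_of_dominated (bound := fun _ => R) (fun z => ?_) (fun z => ae_of_all _ fun y => hb _ _) (integrable_const R) (ae_of_all _ fun y => ?_)
    · exact (hc.comp (by fun_prop : Continuous fun y : Fin m → ℝ => (z.1, ((z.2.1, y) : Spc m)))).aestronglyMeasurable
    · exact hc.comp (by fun_prop : Continuous fun z : ℝ × Spc m => (z.1, ((z.2.1, y) : Spc m)))
  have hne : (Icc (0:ℝ) δ ×ˢ Kc (0 : Spc m) 1).Nonempty := ⟨(0, 0), ⟨le_rfl, hδ⟩, by rw [mem_Kc]; simp⟩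
  obtain ⟨z, hz, hmin⟩ := ((isCompact_Icc (a := (0:ℝ)) (b := δ)).prod (cpt_Kc (0 : Spc m) 1)).exists_isMinOn hne hI.continuousOn
  refine ⟨Im (F z.1) z.2, hpos _ _, fun t ht x1 => ?_⟩
  obtain ⟨y, hy, k, e⟩ := per_red ((x1, 0) : Spc m)
  have h1 : marg (F t) x1 = Im (F t) y := by
    rw [← Im_per (h t) y k, ← e]; rfl
  rw [h1]
  exact hmin (show (t, y) ∈ _ from ⟨ht, hy⟩)

lemma hyp2_s {σ p : ℝ} (h2 : Hyp2 m σ p) : 1 ≤ σ := by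
  have := h2.2.2.1
  have hp := hyp2_one h2
  have : 0 ≤ ((m:ℝ) + 1)/p := by positivity
  linarith

lemma memW_bd {σ p : ℝ} (h2 : Hyp2 m σ p) {f : Spc m → ℝ} (hf : MemW σ p f) : Continuous f ∧ Continuous (grd f) ∧ Per f := by
  obtain ⟨C, hC, H⟩ := embed h2
  have hW := hf.2.2.2.2
  obtain ⟨a, -, -⟩ := H f (WNorm σ p f).toReal hf ENNReal.toReal_nonneg (by rw [ENNReal.ofReal_toReal hW.ne])
  refine ⟨(hf.2.2.1 (hyp2_s h2)).continuous, ?_, (per_iff _).1 hf.1⟩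
  set N := (WNorm σ p f).toReal
  have hr : 0 < (qq m σ p - 2 * (m + 1)) / p := div_pos (by linarith [hyp2_q h2]) (by linarith [hyp2_one h2])
  set r := (qq m σ p - 2 * (m + 1)) / p
  rw [continuous_iff_continuousAt]
  intro x
  rw [ContinuousAt, tendsto_iff_norm_sub_tendsto_zero]
  have hlim : Tendsto (fun y : Spc m => C * ‖y - x‖ ^ r * N) (nhds x) (nhds 0) := by
    have h1 : Continuous fun y : Spc m => C * ‖y - x‖ ^ r * N := (continuous_const.mul ((by fun_prop : Continuous fun y : Spc m => ‖y - x‖).rpow_const fun _ => Or.inr hr.le)).mul_const N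
    have := h1.tendsto x
    simpa [Real.zero_rpow hr.ne'] using this
  refine squeeze_zero' (Eventually.of_forall fun y => norm_nonneg _) ?_ hlim
  filter_upwards [Metric.ball_mem_nhds x one_pos] with y hy
  exact a y x (by rwa [Metric.mem_ball, dist_eq_norm] at hy)

lemma contW_bd {σ p : ℝ} (h2 : Hyp2 m σ p) {δ : ℝ} {ψ : ℝ → Spc m → ℝ} (hm : ∀ t ∈ Icc 0 δ, MemD σ p (ψ t)) (hc : ContW σ p (Icc 0 δ) ψ) :
    ∀ t ∈ Icc 0 δ, ∀ ε > 0, ∃ d > 0, ∀ t' ∈ Icc 0 δ, |t' - t| < d → ∀ x, |ψ t' x - ψ t x| ≤ ε ∧ ‖grd (ψ t') x - grd (ψ t) x‖ ≤ ε := by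
  obtain ⟨C, hC, H⟩ := embed h2
  intro t ht ε hε
  obtain ⟨d, hd, Hd⟩ := hc t ht (ε / C) (by positivity)
  refine ⟨d, hd, fun t' ht' hlt x => ?_⟩
  have hw := Hd t' ht' hlt
  have w1 := (hm t ht).1
  have w2 := (hm t' ht').1
  have d1 := w1.2.2.1 (hyp2_s h2)
  have d2 := w2.2.2.1 (hyp2_s h2)
  have hmem : MemW σ p (fun x => ψ t' x - ψ t x) :=
    ⟨fun x k j => by simp only [w1.1 x k j, w2.1 x k j], w2.2.1.sub w1.2.1, fun _ => d2.sub d1, fun h3 => absurd h2.2.2.2 (not_lt.2 h3), hw.trans ENNReal.ofReal_lt_top⟩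
  obtain ⟨-, a, b⟩ := H _ (ε / C) hmem (by positivity) hw.le
  rw [mul_div_cancel₀ _ hC.ne'] at a b
  refine ⟨b x, ?_⟩
  have e : grd (fun x => ψ t' x - ψ t x) x = grd (ψ t') x - grd (ψ t) x := ((d2 x).hasFDerivAt.sub (d1 x).hasFDerivAt).fderiv
  rw [← e]; exact a x

lemma mild_sol {V : Spc m → ℝ} {β δ S σ p : ℝ} (hV : ContDiff ℝ 2 V) (hp : Per V) (hβ : 0 < β) (hδ0 : 0 ≤ δ) (hδ1 : δ ≤ 1) (h2 : Hyp2 m σ p) {ψ0 : Spc m → ℝ} (hdf : Differentiable ℝ ψ0) (hg : Continuous (grd ψ0)) (hS : ∀ x, |ψ0 x| ≤ S) (hS' : ∀ x, ‖grd ψ0 x‖ ≤ S)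
    {ψ : ℝ → Spc m → ℝ} (h : MildOnIcc V β σ p ψ0 δ ψ) :
    ∃ R c, 0 ≤ R ∧ 0 < c ∧ Cur R c (fun t => ψ (cl δ t)) (fun t => grd (ψ (cl δ t))) ∧ Sol V β δ ψ0 (fun t => ψ (cl δ t)) (fun t => grd (ψ (cl δ t))) := by
  obtain ⟨hm, hcw, heq⟩ := h
  have hmem : ∀ t, cl δ t ∈ Icc 0 δ := fun t => ⟨cl_nn δ t, cl_le hδ0 t⟩
  have hbd := contW_bd h2 hm hcw
  have hx := fun t => memW_bd h2 (hm _ (hmem t)).1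
  have hcl : ∀ t t', |cl δ t' - cl δ t| ≤ |t' - t| := fun t t' => by
    unfold cl
    have a := abs_max_sub_max_le_max (0:ℝ) (min δ t') 0 (min δ t)
    have b := abs_min_sub_min_le_max δ t' δ t
    simp only [sub_self, abs_zero] at a b
    rw [max_eq_right (abs_nonneg _)] at b
    rw [max_eq_right (abs_nonneg (min δ t' - min δ t))] at a
    exact a.trans b
  have cu : Continuous fun z : ℝ × Spc m => ψ (cl δ z.1) z.2 := joint_cont (F := fun t => ψ (cl δ t)) (fun t => (hx t).1) fun t ε hε => by
    obtain ⟨d, hd, H⟩ := hbd _ (hmem t) ε hε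
    exact ⟨d, hd, fun t' ht' x => (H _ (hmem t') ((hcl t t').trans_lt ht') x).1⟩
  have cg : Continuous fun z : ℝ × Spc m => grd (ψ (cl δ z.1)) z.2 := joint_cont (F := fun t => grd (ψ (cl δ t))) (fun t => (hx t).2.1) fun t ε hε => by
    obtain ⟨d, hd, H⟩ := hbd _ (hmem t) ε hε
    exact ⟨d, hd, fun t' ht' x => (H _ (hmem t') ((hcl t t').trans_lt ht') x).2⟩
  have pu := fun t => (hx t).2.2
  have pg := fun t => per_grd (pu t)
  obtain ⟨R1, n1, b1⟩ := per_bd2 (F := fun t => ψ (cl δ t)) cu pu δ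
  obtain ⟨R2, n2, b2⟩ := per_bd2 (F := fun t => grd (ψ (cl δ t))) cg pg δ
  have clcl : ∀ t, cl δ (cl δ t) = cl δ t := fun t => cl_id (hmem t).1 (hmem t).2
  have b1' : ∀ t x, |ψ (cl δ t) x| ≤ max R1 R2 := fun t x => by
    have := b1 _ (hmem t) x
    rw [clcl] at this
    exact this.trans (le_max_left _ _)
  have b2' : ∀ t x, ‖grd (ψ (cl δ t)) x‖ ≤ max R1 R2 := fun t x => by
    have := b2 _ (hmem t) x
    simp only [clcl] at this
    exact this.trans (le_max_right _ _)
  obtain ⟨c, hc, hlb⟩ := marg_lb (F := fun t => ψ (cl δ t)) cu pu b1' hδ0 (fun t x1 => (hm _ (hmem t)).2 x1)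
  have hR : 0 ≤ max R1 R2 := n1.trans (le_max_left _ _)
  have hcur : Cur (max R1 R2) c (fun t => ψ (cl δ t)) (fun t => grd (ψ (cl δ t))) :=
    ⟨fun t => ⟨(hx t).1, (hx t).2.1, b1' t, b2' t, fun x1 => by
      have := hlb _ (hmem t) x1
      simpa only [clcl] using this⟩, pu, pg, cu, cg⟩
  refine ⟨_, c, hR, hc, hcur, ?_⟩
  obtain ⟨⟨B, hB⟩, hG⟩ := FT_good hV hp hR hc
  have hF := hcur.bc hG hB
  have hB0 := hB.1
  set F := Fs V (fun t => ψ (cl δ t)) (fun t => grd (ψ (cl δ t))) with hFdef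
  intro t ht
  have htc : cl δ t = t := cl_id ht.1 ht.2
  have hcx : Continuous fun x : Spc m => HU β ψ0 t x + DU β F t x :=
    ((HU_cont (β := β) hdf.continuous hS).comp (by fun_prop : Continuous fun x : Spc m => (t, x))).add ((DU_cont hF).comp (by fun_prop : Continuous fun x : Spc m => (t, x)))
  have hψc : Continuous (ψ t) := by have := (hx t).1; rwa [htc] at this
  have hfe : ψ t = fun x => HU β ψ0 t x + DU β F t x := by
    refine (Continuous.ae_eq_iff_eq (volume : Measure (Spc m)) hψc hcx).1 ?_
    filter_upwards [heq t ht] with x hxe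
    have hi : ∀ s ∈ Ioc 0 t, heatSG β (t - s) (Fop V (ψ s)) x = heatSG β (t - s) (F s) x := by
      intro s hs'
      have hsc : cl δ s = s := cl_id hs'.1.le (hs'.2.trans ht.2)
      have ha := hcur.a s
      have hm' := (hm _ (hmem s)).1.2.2.1 (hyp2_s h2)
      have e := Fop_eq hV hp hR hc hm' ha
      rw [hsc] at e
      rw [e, hFdef]
      unfold Fs
      simp only [hsc]
    rw [heat_HU hβ ht.1 hdf.continuous hS, setIntegral_congr_fun measurableSet_Ioc hi, DU_eq hβ ht.1] at hxe
    linarith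
  intro x
  simp only [htc]
  refine ⟨congrFun hfe x, ?_⟩
  have : HasFDerivAt (ψ t) (HU β (grd ψ0) t x + DG β F t x) x := by
    rw [hfe]
    exact (HU_deriv hdf hg hS hS' t x).add (DU_deriv hβ hF hB0 ht.1 (ht.2.trans hδ1) x)
  exact this.fderiv
end fin

/-- **Local existence and uniqueness of a mild solution (Proposition `loc0`).** Assume `[H₁]`
and `[H₂]`. There exists `δ > 0` and a unique `ψ ∈ C([0,δ], 𝒟^{σ,p}(𝕋ⁿ))` such that for all
`t ∈ [0,δ]`, `ψ(t) − 1 = e^{−tA_p}(ψ₀ − 1) + ∫₀ᵗ e^{−(t−s)A_p} F(ψ(s)) ds`. -/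
theorem local_mild_existence_uniqueness
    (m : ℕ) (V : Spc m → ℝ) (β σ p : ℝ) (ψ0 : Spc m → ℝ)
    (hV : ContDiff ℝ 2 V) (hVper : IsPeriodic V) (hβ : 0 < β)
    (h1 : Hyp1 σ p ψ0) (h2 : Hyp2 m σ p) :
    ∃ δ : ℝ, 0 < δ ∧ ∃ ψ : ℝ → Spc m → ℝ, MildOnIcc V β σ p ψ0 δ ψ ∧
      ∀ ψ' : ℝ → Spc m → ℝ, MildOnIcc V β σ p ψ0 δ ψ' →
        ∀ t ∈ Set.Icc (0 : ℝ) δ, ∀ᵐ x ∂(volume : Measure (Spc m)), ψ' t x = ψ t x := by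
  have hp := (per_iff V).1 hVper
  obtain ⟨⟨hw, hpos⟩, -, -⟩ := h1
  obtain ⟨hc, hg, hper⟩ := memW_bd h2 hw
  have hdf := hw.2.2.1 (hyp2_s h2)
  obtain ⟨S1, n1, b1⟩ := per_bd hper hc
  obtain ⟨S2, n2, b2⟩ := per_bd (per_grd hper) hg
  have hS : ∀ x, |ψ0 x| ≤ max S1 S2 := fun x => (b1 x).trans (le_max_left _ _)
  have hS' : ∀ x, ‖grd ψ0 x‖ ≤ max S1 S2 := fun x => (b2 x).trans (le_max_right _ _)
  obtain ⟨c0, hc0, hlb⟩ := marg_lb (F := fun _ => ψ0) (hc.comp continuous_snd) (fun _ => hper) (fun _ => hS) (le_refl (0:ℝ)) (fun _ => hpos)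
  have hlb' : ∀ x1, 2 * (c0/2) ≤ marg ψ0 x1 := fun x1 => by
    have := hlb 0 ⟨le_rfl, le_rfl⟩ x1
    linarith
  have hS0 : 0 ≤ max S1 S2 := n1.trans (le_max_left _ _)
  obtain ⟨δ, hδ, hδ1, u, g, hcur, hsol⟩ := cur_exist hV hp hβ hc hg hS hS' hper (half_pos hc0) hlb'
  refine ⟨δ, hδ, u, sol_mild hV hp hβ hδ1 h2 hw hg hS hS' (by linarith) (half_pos hc0) hcur hsol, fun ψ' h' t ht => ae_of_all _ fun x => ?_⟩
  obtain ⟨R', c', hR', hc', hcur', hsol'⟩ := mild_sol hV hp hβ hδ.le hδ1 h2 hdf hg hS hS' h'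
  have := cur_unique hV hp hδ1 (R := max R' (max S1 S2 + 1)) (c := min c' (c0/2)) (hR'.trans (le_max_left _ _)) (lt_min hc' (half_pos hc0))
    (hcur'.mono (le_max_left _ _) (min_le_left _ _)) (hcur.mono (le_max_right _ _) (min_le_right _ _)) hsol' hsol t ht x
  simpa only [cl_id ht.1 ht.2] using this
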